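/- arXiv:1612.04584 — 3 statements merged into one kernel-verified Lean document; each statement's English description precedes it below -/
import Mathlib

section
/- Let M be a right R-module and let s, g be natural numbers such that R satisfies the stable range condition (S_s) and R^g is a direct summand of M. Let M ∪ (M + e_1) ⊆ M^∞ denote the set of elements of the form m or m + e_1 with m ∈ M, where e_1 is the first basis vector of R^∞. Then the poset O(M ∪ (M + e_1)) ∩ U(M^∞) is (g − s)-connected. -/
open CategoryTheory MulOpposite

/-- `O(V)`: the poset of ordered sequences of distinct elements of `V`, of length at least
one, ordered by refinement (i.e. by the sublist relation). -/
def OSeq (V : Type u) : Type u := {l : List V // l ≠ [] ∧ l.Nodup}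

instance (V : Type u) : PartialOrder (OSeq V) where
  le a b := a.1.Sublist b.1
  le_refl a := List.Sublist.refl a.1
  le_trans a b c hab hbc := List.Sublist.trans hab hbc
  le_antisymm a b h h' := Subtype.ext (List.Sublist.antisymm h h')

/-- A space is `d`-connected (for an integer `d`) if it is nonempty and all its homotopy
groups in degrees `≤ d` vanish; for `d ≤ -2` the condition is vacuous. -/
def TopDConnected (X : Type*) [TopologicalSpace X] (d : ℤ) : Prop :=
  d ≤ -2 ∨
    (Nonempty X ∧ ∀ (n : ℕ), (n : ℤ) ≤ d → ∀ x : X, Subsingleton (HomotopyGroup (Fin n) X x))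

/-- A poset is `d`-connected if the geometric realization of its order complex (nerve) is. -/
def PosetDConnected (P : Type) [PartialOrder P] (d : ℤ) : Prop :=
  TopDConnected (SSet.toTop.obj (nerve P)) d

/-- A set of sequences is `d`-connected if it is so as a subposet of `O(V)`. -/
def SetDConnected {V : Type} (F : Set (OSeq V)) (d : ℤ) : Prop :=
  PosetDConnected F d

/-- `F ⊆ O(V)` satisfies the chain condition: it is downwards closed for refinement. -/
def ChainCondition {V : Type u} (F : Set (OSeq V)) : Prop :=
  ∀ ⦃w v : OSeq V⦄, w ≤ v → v ∈ F → w ∈ F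

/-- `F_v`: the subposet of sequences `w ∈ F` whose concatenation with `v` again lies in `F`. -/
def SeqExt {V : Type u} (F : Set (OSeq V)) (v : OSeq V) : Set (OSeq V) :=
  {w | w ∈ F ∧ ∃ h : w.1 ++ v.1 ≠ [] ∧ (w.1 ++ v.1).Nodup, (⟨w.1 ++ v.1, h⟩ : OSeq V) ∈ F}

/-- `O(X)` inside `O(V)`: sequences all of whose entries lie in `X`. -/
def SeqIn {V : Type u} (X : Set V) : Set (OSeq V) :=
  {w | ∀ x ∈ w.1, x ∈ X}

/-- A sequence `v` in a right `R`-module `M` (viewed as a left `Rᵐᵒᵖ`-module) is unimodular. -/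
def IsUnimodularSeq (R : Type*) [Ring R] (M : Type*) [AddCommGroup M] [Module Rᵐᵒᵖ M]
    {n : ℕ} (v : Fin n → M) : Prop :=
  ∃ (f : Fin n → (R →ₗ[Rᵐᵒᵖ] M)) (φ : Fin n → (M →ₗ[Rᵐᵒᵖ] R)),
    (∀ i, f i 1 = v i) ∧ ∀ i j, (φ j).comp (f i) = if i = j then LinearMap.id else 0

/-- `M^∞ := M ⊕ R^∞`, where `R^∞` is free with basis `e_1, e_2, …`. -/
abbrev MInf (R : Type u) [Ring R] (M : Type u) [AddCommGroup M] [Module Rᵐᵒᵖ M] : Type u :=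
  M × (ℕ →₀ R)

/-- `U(W)`: the subposet of `O(W)` consisting of unimodular sequences in the module `W`. -/
def UnimodSeqs (R : Type*) [Ring R] (W : Type*) [AddCommGroup W] [Module Rᵐᵒᵖ W] :
    Set (OSeq W) :=
  {w | IsUnimodularSeq R W (fun i : Fin w.1.length => w.1.get i)}

/-- `R` satisfies the stable range condition `(S_s)`. -/
def SatisfiesStableRange (R : Type*) [Ring R] (s : ℕ) : Prop :=
  ∀ r : Fin (s + 1) → R,
    IsUnimodularSeq R (Fin (s + 1) → R) (fun _ : Fin 1 => r) →
      ∃ t : Fin s → R,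
        IsUnimodularSeq R (Fin s → R)
          (fun _ : Fin 1 => fun i => r i.castSucc + t i * r (Fin.last s))

/-- The point of the realization of the nerve with barycentric coordinates `t` in the chain `c`. -/
noncomputable def nerveCell {P : Type} [PartialOrder P] {n : ℕ} (c : Fin (n + 1) →o P)
    (t : stdSimplex ℝ (Fin (n + 1))) : SSet.toTop.obj (nerve P) :=
  TopCat.toSSetObjEquiv _ (Opposite.op (SimplexCategory.mk n))
    ((sSetTopAdj.unit.app (nerve P)).app (Opposite.op (SimplexCategory.mk n)) c.monotone.functor) t

theorem continuous_nerveCell {P : Type} [PartialOrder P] {n : ℕ} (c : Fin (n + 1) →o P) :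
    Continuous (nerveCell c) :=
  ContinuousMap.continuous _

theorem nerveCell_map {P : Type} [PartialOrder P] {m n : ℕ} (c : Fin (n + 1) →o P)
    (θ : Fin (m + 1) →o Fin (n + 1)) (t : stdSimplex ℝ (Fin (m + 1))) :
    nerveCell (c.comp θ) t = nerveCell c (stdSimplex.map θ t) := by
  have h := (sSetTopAdj.unit.app (nerve P)).naturality (SimplexCategory.mkHom θ).op
  have h2 := congrArg (fun k => TopCat.toSSetObjEquiv _ (Opposite.op (SimplexCategory.mk m))
    (k c.monotone.functor) t) h
  exact h2

theorem exists_nerve_desc {P : Type} [PartialOrder P] {Z : Type} [TopologicalSpace Z]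
    (h : ∀ n, (Fin (n + 1) →o P) → C(stdSimplex ℝ (Fin (n + 1)), Z))
    (hh : ∀ m n (c : Fin (n + 1) →o P) (θ : Fin (m + 1) →o Fin (n + 1)) t,
      h m (c.comp θ) t = h n c (stdSimplex.map θ t)) :
    ∃ H : C(SSet.toTop.obj (nerve P), Z), ∀ n (c : Fin (n + 1) →o P) t,
      H (nerveCell c t) = h n c t := by
  let F : nerve P ⟶ TopCat.toSSet.obj (TopCat.of Z) :=
    { app := fun k => ↾fun x => (TopCat.toSSetObjEquiv (TopCat.of Z) k).symm
        (h k.unop.len ⟨x.obj, x.monotone⟩)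
      naturality := by
        intro k l f
        ext x
        apply (TopCat.toSSetObjEquiv (TopCat.of Z) l).injective
        ext t
        exact hh _ _ ⟨x.obj, x.monotone⟩ f.unop.toOrderHom t }
  refine ⟨((sSetTopAdj.homEquiv _ _).symm F).hom, fun n c t => ?_⟩
  have := (sSetTopAdj.homEquiv _ _).apply_symm_apply F
  rw [Adjunction.homEquiv_unit] at this
  have h2 := congrArg (fun k => TopCat.toSSetObjEquiv _ (Opposite.op (SimplexCategory.mk n))
    (k.app (Opposite.op (SimplexCategory.mk n)) c.monotone.functor) t) this
  exact h2

theorem exists_nerveCell_eq {P : Type} [PartialOrder P] (x : SSet.toTop.obj (nerve P)) :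
    ∃ n, ∃ (c : Fin (n + 1) →o P) (t : stdSimplex ℝ (Fin (n + 1))), nerveCell c t = x := by
  let _ : TopologicalSpace Prop := ⊤
  let f : SSet.toTop.obj (nerve P) ⟶ TopCat.of Prop :=
    TopCat.ofHom ⟨fun x => ∃ n, ∃ (c : Fin (n + 1) →o P) (t : stdSimplex ℝ (Fin (n + 1))),
      nerveCell c t = x, continuous_top⟩
  let g : SSet.toTop.obj (nerve P) ⟶ TopCat.of Prop := TopCat.ofHom ⟨fun _ => True, continuous_top⟩
  have : f = g := by
    apply (sSetTopAdj.homEquiv _ _).injective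
    rw [Adjunction.homEquiv_unit, Adjunction.homEquiv_unit]
    ext k c
    apply (TopCat.toSSetObjEquiv _ k).injective
    ext t
    refine iff_true_intro ?_
    exact ⟨_, ⟨c.obj, c.monotone⟩, t, rfl⟩
  have h := congrArg (fun k => k x) this
  exact of_eq_true h

/-- Every continuous map from the boundary of the `k`-cube to `S` extends to the cube. -/
def FillsSphere {Y : Type*} [TopologicalSpace Y] (k : ℕ) (S : Set Y) : Prop :=
  ∀ f : (Fin k → ℝ) → Y, ContinuousOn f (Metric.sphere 0 1) →
    Set.MapsTo f (Metric.sphere 0 1) S →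
    ∃ G : (Fin k → ℝ) → Y, ContinuousOn G (Metric.closedBall 0 1) ∧
      Set.MapsTo G (Metric.closedBall 0 1) S ∧ Set.EqOn G f (Metric.sphere 0 1)

/-- `d`-connectivity of a subset, phrased through extensions from cube boundaries. -/
def SetConn {Y : Type*} [TopologicalSpace Y] (d : ℤ) (S : Set Y) : Prop :=
  ∀ k : ℕ, (k : ℤ) ≤ d + 1 → FillsSphere k S

namespace Grid

variable {k : ℕ}

/-- A cell of the integral grid: base corner and the set of nondegenerate directions. -/
abbrev Cell (k : ℕ) := (Fin k → ℤ) × Finset (Fin k)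

/-- The closed cell. -/
def cell (c : Cell k) : Set (Fin k → ℝ) :=
  {x | ∀ i, (c.1 i : ℝ) ≤ x i ∧ x i ≤ c.1 i + (if i ∈ c.2 then 1 else 0)}

/-- The boundary of a closed cell. -/
def bdry (c : Cell k) : Set (Fin k → ℝ) :=
  {x | x ∈ cell c ∧ ∃ i ∈ c.2, x i = c.1 i ∨ x i = c.1 i + 1}

/-- The open cell containing a point. -/
noncomputable def carrier (x : Fin k → ℝ) : Cell k :=
  (fun i => ⌊x i⌋, Finset.univ.filter fun i => x i ≠ ⌊x i⌋)

theorem mem_carrier (x : Fin k → ℝ) : x ∈ cell (carrier x) := by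
  intro i
  refine ⟨Int.floor_le _, ?_⟩
  by_cases h : x i = ⌊x i⌋
  · simp [carrier, ← h]
  · simp [carrier, h, (Int.lt_floor_add_one (x i)).le]

theorem isClosed_cell (c : Cell k) : IsClosed (cell c) := by
  have : cell c = ⋂ i, {x : Fin k → ℝ | (c.1 i : ℝ) ≤ x i ∧
      x i ≤ c.1 i + (if i ∈ c.2 then 1 else 0)} := by
    ext x; simp [cell]
  rw [this]
  refine isClosed_iInter fun i => ?_
  exact (isClosed_le continuous_const (continuous_apply i)).inter
    (isClosed_le (continuous_apply i) continuous_const)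

theorem carrier_eq {c : Cell k} {x : Fin k → ℝ} (hx : x ∈ cell c) (hb : x ∉ bdry c) :
    carrier x = c := by
  have h1 : ∀ i, ⌊x i⌋ = c.1 i := by
    intro i
    rw [Int.floor_eq_iff]
    refine ⟨(hx i).1, ?_⟩
    have := (hx i).2
    by_cases hi : i ∈ c.2
    · rw [if_pos hi] at this
      refine lt_of_le_of_ne this fun h => hb ⟨hx, i, hi, Or.inr h⟩
    · rw [if_neg hi] at this
      linarith
  refine Prod.ext (funext h1) ?_
  ext i
  simp only [carrier, Finset.mem_filter, Finset.mem_univ, true_and, h1]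
  constructor
  · intro h
    by_contra hi
    have := hx i
    rw [if_neg hi, add_zero] at this
    exact h (le_antisymm this.2 this.1)
  · intro hi h
    exact hb ⟨hx, i, hi, Or.inl h⟩

theorem notMem_of_eq_int {c : Cell k} {x : Fin k → ℝ} (hx : x ∈ cell c) {i : Fin k}
    (hi : i ∉ c.2) : x i = c.1 i := by
  have := hx i
  rw [if_neg hi, add_zero] at this
  exact le_antisymm this.2 this.1

theorem carrier_subset {c : Cell k} {x : Fin k → ℝ} (hx : x ∈ cell c) :
    (carrier x).2 ⊆ c.2 := by
  intro i hi
  by_contra h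
  simp only [carrier, Finset.mem_filter, Finset.mem_univ, true_and] at hi
  apply hi
  rw [notMem_of_eq_int hx h]
  simp

theorem carrier_card_lt {c : Cell k} {x : Fin k → ℝ} (hx : x ∈ bdry c) :
    (carrier x).2.card < c.2.card := by
  apply Finset.card_lt_card
  refine ⟨carrier_subset hx.1, fun h => ?_⟩
  obtain ⟨i, hi, h'⟩ := hx.2
  have := h hi
  simp only [carrier, Finset.mem_filter, Finset.mem_univ, true_and] at this
  apply this
  rcases h' with h' | h' <;> rw [h']
  · simp
  · have : ((c.1 i : ℝ) + 1) = ((c.1 i + 1 : ℤ) : ℝ) := by push_cast; ring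
    rw [this]; simp

theorem carrier_ne_of_mem_bdry {c : Cell k} {x : Fin k → ℝ} (hx : x ∈ bdry c) :
    carrier x ≠ c := fun h => by
  have := carrier_card_lt hx
  rw [h] at this
  exact lt_irrefl _ this

theorem carrier_cell_subset_closedBall {N : ℕ} {x y : Fin k → ℝ}
    (hx : x ∈ Metric.closedBall (0 : Fin k → ℝ) N) (hy : y ∈ cell (carrier x)) :
    y ∈ Metric.closedBall (0 : Fin k → ℝ) N := by
  rw [mem_closedBall_zero_iff, pi_norm_le_iff_of_nonneg (Nat.cast_nonneg _)] at *
  intro i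
  have h1 := hx i
  have h2 := hy i
  rw [Real.norm_eq_abs, abs_le] at *
  have h3 : (-(N : ℤ)) ≤ ⌊x i⌋ := by
    rw [Int.le_floor]; push_cast; exact h1.1
  have h3' : (-(N : ℝ)) ≤ ⌊x i⌋ := by exact_mod_cast h3
  refine ⟨h3'.trans h2.1, h2.2.trans ?_⟩
  by_cases h : x i = ⌊x i⌋
  · simp only [carrier, Finset.mem_filter, Finset.mem_univ, true_and, ← h]
    simpa using h1.2
  · simp only [carrier, Finset.mem_filter, Finset.mem_univ, true_and, ne_eq, h,
      not_false_eq_true, if_true]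
    have h4 : (⌊x i⌋ : ℝ) < N := lt_of_le_of_ne ((Int.floor_le _).trans h1.2) (fun h' => by
      have := Int.floor_le (x i)
      exact h (le_antisymm (by linarith) this))
    have h5 : ⌊x i⌋ < (N : ℤ) := by exact_mod_cast h4
    have : ⌊x i⌋ + 1 ≤ (N : ℤ) := h5
    exact_mod_cast this

theorem carrier_cell_subset_sphere {N : ℕ} (hN : 0 < N) {x y : Fin k → ℝ}
    (hx : x ∈ Metric.sphere (0 : Fin k → ℝ) N) (hy : y ∈ cell (carrier x)) :
    y ∈ Metric.sphere (0 : Fin k → ℝ) N := by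
  have hb := carrier_cell_subset_closedBall (Metric.sphere_subset_closedBall hx) hy
  rw [mem_closedBall_zero_iff] at hb
  rw [mem_sphere_zero_iff_norm] at *
  refine le_antisymm hb ?_
  have : Nonempty (Fin k) := by
    by_contra h
    rw [not_nonempty_iff] at h
    rw [Subsingleton.elim x 0, norm_zero] at hx
    have : (0 : ℝ) < N := by exact_mod_cast hN
    linarith
  obtain ⟨i, hi⟩ : ∃ i, ‖x i‖ = N := by
    by_contra! h
    have h1 : ‖x‖ < N := by
      rw [pi_norm_lt_iff (by exact_mod_cast hN)]
      intro i
      exact lt_of_le_of_ne (hx ▸ norm_le_pi_norm x i) (h i)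
    linarith
  have hxi : x i = ⌊x i⌋ := by
    rw [Real.norm_eq_abs, abs_eq (Nat.cast_nonneg _)] at hi
    rcases hi with hi | hi
    · rw [hi]; simp
    · have : x i = ((-(N : ℤ) : ℤ) : ℝ) := by rw [hi]; push_cast; rfl
      rw [this, Int.floor_intCast]
  have : i ∉ (carrier x).2 := by
    simp only [carrier, Finset.mem_filter, Finset.mem_univ, true_and, not_not]
    exact hxi
  have h2 := notMem_of_eq_int hy this
  have h3 : y i = x i := by rw [h2, hxi]; simp [carrier]
  rw [← hi, ← h3]
  exact norm_le_pi_norm y i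

theorem finite_carrier_ball (N : ℕ) :
    (carrier '' Metric.closedBall (0 : Fin k → ℝ) N).Finite := by
  refine Set.Finite.subset (s := (Set.pi Set.univ fun _ => Set.Icc (-(N : ℤ)) N) ×ˢ Set.univ)
    ((Set.Finite.pi fun _ => Set.finite_Icc _ _).prod Set.finite_univ) ?_
  rintro _ ⟨x, hx, rfl⟩
  refine ⟨fun i _ => ?_, trivial⟩
  have := carrier_cell_subset_closedBall hx (mem_carrier x)
  rw [mem_closedBall_zero_iff, pi_norm_le_iff_of_nonneg (Nat.cast_nonneg _)] at hx
  have h1 := hx i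
  rw [Real.norm_eq_abs, abs_le] at h1
  constructor
  · change _ ≤ ⌊x i⌋
    rw [Int.le_floor]; push_cast; exact h1.1
  · change ⌊x i⌋ ≤ _
    have : (⌊x i⌋ : ℝ) ≤ N := (Int.floor_le _).trans h1.2
    exact_mod_cast this

theorem dist_le_of_mem_cell {c : Cell k} {x y : Fin k → ℝ} (hx : x ∈ cell c) (hy : y ∈ cell c) :
    dist x y ≤ 1 := by
  rw [dist_pi_le_iff zero_le_one]
  intro i
  have h1 := hx i
  have h2 := hy i
  rw [Real.dist_eq, abs_le]
  split_ifs at h1 h2 <;> constructor <;> linarith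

/-- Filling a single cell. -/
theorem fill_cell {Y : Type*} [TopologicalSpace Y] {S : Set Y} (c : Cell k)
    (hS : FillsSphere c.2.card S) (f : (Fin k → ℝ) → Y) (hf : ContinuousOn f (bdry c))
    (hm : Set.MapsTo f (bdry c) S) :
    ∃ G : (Fin k → ℝ) → Y, ContinuousOn G (cell c) ∧ Set.MapsTo G (cell c) S ∧
      Set.EqOn G f (bdry c) := by
  classical
  set j := c.2.card with hj
  let e : Fin j ≃ c.2 := c.2.equivFin.symm
  let A : (Fin j → ℝ) → (Fin k → ℝ) := fun y i =>
    if h : i ∈ c.2 then c.1 i + (y (e.symm ⟨i, h⟩) + 1) / 2 else c.1 i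
  let B : (Fin k → ℝ) → (Fin j → ℝ) := fun x m => 2 * (x (e m) - c.1 (e m)) - 1
  have hA : Continuous A := by
    refine continuous_pi fun i => ?_
    by_cases h : i ∈ c.2
    · simp only [A, h, dif_pos]; fun_prop
    · simp only [A, h, dif_neg, not_false_eq_true]; fun_prop
  have hB : Continuous B := by
    refine continuous_pi fun m => ?_
    simp only [B]; fun_prop
  have hAB : ∀ x ∈ cell c, A (B x) = x := by
    intro x hx
    funext i
    by_cases h : i ∈ c.2
    · simp only [A, B, h, dif_pos, Equiv.apply_symm_apply]; ring
    · simp only [A, h, dif_neg, not_false_eq_true]; exact (notMem_of_eq_int hx h).symm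
  have hAe : ∀ y m, A y (e m) = c.1 (e m) + (y m + 1) / 2 := by
    intro y m
    have : (e m : Fin k) ∈ c.2 := (e m).2
    simp only [A, this, dif_pos, Subtype.coe_eta, Equiv.symm_apply_apply]
  have hBA : ∀ y, B (A y) = y := by
    intro y; funext m
    simp only [B, hAe]; ring
  have hAcell : ∀ y ∈ Metric.closedBall (0 : Fin j → ℝ) 1, A y ∈ cell c := by
    intro y hy i
    rw [mem_closedBall_zero_iff, pi_norm_le_iff_of_nonneg zero_le_one] at hy
    by_cases h : i ∈ c.2
    · have := hy (e.symm ⟨i, h⟩)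
      rw [Real.norm_eq_abs, abs_le] at this
      simp only [A, h, dif_pos, if_true]
      constructor <;> linarith
    · simp [A, h]
  have hBball : ∀ x ∈ cell c, B x ∈ Metric.closedBall (0 : Fin j → ℝ) 1 := by
    intro x hx
    rw [mem_closedBall_zero_iff, pi_norm_le_iff_of_nonneg zero_le_one]
    intro m
    have := hx (e m)
    rw [if_pos (e m).2] at this
    rw [Real.norm_eq_abs, abs_le]
    simp only [B]
    constructor <;> linarith
  have hAs : Set.MapsTo A (Metric.sphere 0 1) (bdry c) := by
    intro y hy
    refine ⟨hAcell y (Metric.sphere_subset_closedBall hy), ?_⟩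
    rw [mem_sphere_zero_iff_norm] at hy
    obtain ⟨m, hm⟩ : ∃ m, ‖y m‖ = 1 := by
      by_contra! h
      have h1 : ‖y‖ < 1 := by
        rw [pi_norm_lt_iff one_pos]
        intro i
        exact lt_of_le_of_ne (hy ▸ norm_le_pi_norm y i) (h i)
      linarith
    refine ⟨e m, (e m).2, ?_⟩
    rw [hAe]
    rw [Real.norm_eq_abs, abs_eq zero_le_one] at hm
    rcases hm with hm | hm
    · right; rw [hm]; ring
    · left; rw [hm]; ring
  have hBs : Set.MapsTo B (bdry c) (Metric.sphere 0 1) := by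
    intro x hx
    have h1 := hBball x hx.1
    rw [mem_closedBall_zero_iff] at h1
    rw [mem_sphere_zero_iff_norm]
    refine le_antisymm h1 ?_
    obtain ⟨i, hi, h⟩ := hx.2
    have h2 := norm_le_pi_norm (B x) (e.symm ⟨i, hi⟩)
    refine le_trans (le_of_eq ?_) h2
    simp only [B, Equiv.apply_symm_apply]
    rcases h with h | h <;> rw [h]
    · simp
    · rw [show (2 * ((c.1 i : ℝ) + 1 - c.1 i) - 1) = 1 by ring]; simp
  obtain ⟨G, hG1, hG2, hG3⟩ := hS (f ∘ A) (hf.comp hA.continuousOn hAs) (hm.comp hAs)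
  refine ⟨G ∘ B, hG1.comp hB.continuousOn hBball, hG2.comp hBball, ?_⟩
  intro x hx
  simp only [Function.comp]
  rw [hG3 (hBs hx)]
  simp only [Function.comp]
  rw [hAB x hx.1]

theorem isClosed_biUnion_cells (T : Finset (Cell k)) : IsClosed (⋃ c ∈ T, cell c) :=
  T.finite_toSet.isClosed_biUnion fun c _ => isClosed_cell c

theorem fill_cells {Y : Type*} [TopologicalSpace Y] {N : ℕ} (hN : 0 < N)
    (f : (Fin k → ℝ) → Y) (hf : ContinuousOn f (Metric.sphere 0 N)) (S : Cell k → Set Y)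
    (hfS : ∀ x ∈ Metric.sphere (0 : Fin k → ℝ) N, ∀ y ∈ Metric.closedBall (0 : Fin k → ℝ) N,
      x ∈ cell (carrier y) → f x ∈ S (carrier y))
    (hS : ∀ y ∈ Metric.closedBall (0 : Fin k → ℝ) N,
      FillsSphere (carrier y).2.card (S (carrier y)))
    (hmono : ∀ y ∈ Metric.closedBall (0 : Fin k → ℝ) N, ∀ x ∈ bdry (carrier y),
      S (carrier x) ⊆ S (carrier y)) (T : Finset (Cell k))
    (hT : ∀ c ∈ T, c ∈ carrier '' Metric.closedBall (0 : Fin k → ℝ) N)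
    (hTd : ∀ c ∈ T, ∀ x ∈ cell c, carrier x ∈ T) :
    ∃ G : (Fin k → ℝ) → Y, ContinuousOn G (Metric.sphere 0 N ∪ ⋃ c ∈ T, cell c) ∧
      Set.EqOn G f (Metric.sphere 0 N) ∧ ∀ c ∈ T, ∀ x ∈ cell c, G x ∈ S (carrier x) := by
  classical
  induction T using Finset.strongInduction with
  | H T ih =>
  rcases T.eq_empty_or_nonempty with rfl | hne
  · exact ⟨f, by simpa using hf, fun _ _ => rfl, by simp⟩
  obtain ⟨c, hc, hmax⟩ := T.exists_max_image (fun c => c.2.card) hne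
  have hce : ∀ c' ∈ T, ∀ x ∈ cell c', c' ≠ c → carrier x ≠ c := by
    intro c' hc' x hx hne h
    by_cases hb : x ∈ bdry c'
    · have := carrier_card_lt hb
      rw [h] at this
      exact absurd (hmax c' hc') (by omega)
    · exact hne ((carrier_eq hx hb).symm.trans h)
  obtain ⟨G, hG1, hG2, hG3⟩ := ih (T.erase c) (Finset.erase_ssubset hc)
    (fun c' h => hT c' (Finset.mem_of_mem_erase h)) (fun c' h x hx => by
      have h' := Finset.mem_of_mem_erase h
      exact Finset.mem_erase.2 ⟨hce c' h' x hx (Finset.ne_of_mem_erase h), hTd c' h' x hx⟩)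
  obtain ⟨y, hy, rfl⟩ := hT c hc
  set c := carrier y with hcdef
  have hTeq : (⋃ c' ∈ T, cell c') = (⋃ c' ∈ T.erase c, cell c') ∪ cell c := by
    conv_lhs => rw [← Finset.insert_erase hc]
    rw [Finset.set_biUnion_insert, Set.union_comm]
  by_cases hys : y ∈ Metric.sphere (0 : Fin k → ℝ) N
  · have hsub : cell c ⊆ Metric.sphere 0 N := fun z hz => carrier_cell_subset_sphere hN hys hz
    refine ⟨G, ?_, hG2, ?_⟩
    · rw [hTeq]
      refine hG1.mono ?_
      rintro x (hx | hx | hx)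
      · exact Or.inl hx
      · exact Or.inr hx
      · exact Or.inl (hsub hx)
    · intro c' hc' x hx
      by_cases h : c' = c
      · subst h
        rw [hG2 (hsub hx)]
        exact hfS x (hsub hx) x (Metric.sphere_subset_closedBall (hsub hx)) (mem_carrier x)
      · exact hG3 c' (Finset.mem_erase.2 ⟨h, hc'⟩) x hx
  set L := Metric.sphere (0 : Fin k → ℝ) N ∪ ⋃ c' ∈ T.erase c, cell c' with hL
  have hLc : IsClosed L := Metric.isClosed_sphere.union (isClosed_biUnion_cells _)
  have hbL : bdry c ⊆ L := by
    intro x hx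
    refine Or.inr (Set.mem_biUnion (x := carrier x) ?_ (mem_carrier x))
    exact Finset.mem_erase.2 ⟨carrier_ne_of_mem_bdry hx, hTd c hc x hx.1⟩
  have hcL : cell c ∩ L ⊆ bdry c := by
    rintro x ⟨hx, hxL⟩
    by_contra hb
    have hcx := carrier_eq hx hb
    rcases hxL with hxs | hxT
    · apply hys
      refine carrier_cell_subset_sphere hN hxs ?_
      rw [hcx]; exact mem_carrier y
    · simp only [Set.mem_iUnion] at hxT
      obtain ⟨c', hc', hx'⟩ := hxT
      exact hce c' (Finset.mem_of_mem_erase hc') x hx' (Finset.ne_of_mem_erase hc') hcx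
  have hGb : Set.MapsTo G (bdry c) (S c) := by
    intro x hx
    refine hmono y hy x hx ?_
    exact hG3 (carrier x) (Finset.mem_erase.2 ⟨carrier_ne_of_mem_bdry hx, hTd c hc x hx.1⟩) x
      (mem_carrier x)
  obtain ⟨H, hH1, hH2, hH3⟩ := fill_cell c (hS y hy) G (hG1.mono hbL) hGb
  let G' : (Fin k → ℝ) → Y := fun x => if x ∈ L then G x else H x
  have hG'L : Set.EqOn G' G L := fun x hx => if_pos hx
  have hG'c : Set.EqOn G' H (cell c) := by
    intro x hx
    by_cases h : x ∈ L
    · simp only [G', h, if_true]; exact (hH3 (hcL ⟨hx, h⟩)).symm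
    · simp only [G', h, if_false]
  refine ⟨G', ?_, ?_, ?_⟩
  · rw [hTeq, ← Set.union_assoc]
    exact ContinuousOn.union_of_isClosed (hG1.congr hG'L) (hH1.congr hG'c) hLc (isClosed_cell c)
  · intro x hx
    rw [hG'L (Or.inl hx)]; exact hG2 hx
  · intro c' hc' x hx
    by_cases h : x ∈ L
    · rw [hG'L h]
      rcases h with h | h
      · rw [hG2 h]
        exact hfS x h x (Metric.sphere_subset_closedBall h) (mem_carrier x)
      · simp only [Set.mem_iUnion] at h
        obtain ⟨c'', hc'', hx''⟩ := h
        exact hG3 c'' hc'' x hx''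
    · have h' : c' = c := by
        by_contra hne
        exact h (Or.inr (Set.mem_biUnion (Finset.mem_erase.2 ⟨hne, hc'⟩) hx))
      subst h'
      have hb : x ∉ bdry c := fun hb => h (hbL hb)
      rw [carrier_eq hx hb, hG'c hx]
      exact hH2 hx

/-- Filling the cube along the grid of mesh `1 / N`. -/
theorem fill_grid {Y : Type*} [TopologicalSpace Y] {N : ℕ} (hN : 0 < N)
    (f : (Fin k → ℝ) → Y) (hf : ContinuousOn f (Metric.sphere 0 1)) (S : Cell k → Set Y)
    (hfS : ∀ x ∈ Metric.sphere (0 : Fin k → ℝ) 1, ∀ y ∈ Metric.closedBall (0 : Fin k → ℝ) 1,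
      (N : ℝ) • x ∈ cell (carrier ((N : ℝ) • y)) → f x ∈ S (carrier ((N : ℝ) • y)))
    (hS : ∀ y ∈ Metric.closedBall (0 : Fin k → ℝ) 1,
      FillsSphere (carrier ((N : ℝ) • y)).2.card (S (carrier ((N : ℝ) • y))))
    (hmono : ∀ y ∈ Metric.closedBall (0 : Fin k → ℝ) 1,
      ∀ x ∈ Metric.closedBall (0 : Fin k → ℝ) 1,
      (N : ℝ) • x ∈ bdry (carrier ((N : ℝ) • y)) →
      S (carrier ((N : ℝ) • x)) ⊆ S (carrier ((N : ℝ) • y))) :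
    ∃ G : (Fin k → ℝ) → Y, ContinuousOn G (Metric.closedBall 0 1) ∧
      Set.EqOn G f (Metric.sphere 0 1) ∧
      ∀ x ∈ Metric.closedBall (0 : Fin k → ℝ) 1, G x ∈ S (carrier ((N : ℝ) • x)) := by
  have hN' : (0 : ℝ) < N := by exact_mod_cast hN
  have hN0 : (N : ℝ) ≠ 0 := hN'.ne'
  have hs : ∀ x : Fin k → ℝ, x ∈ Metric.sphere (0 : Fin k → ℝ) 1 ↔
      (N : ℝ) • x ∈ Metric.sphere (0 : Fin k → ℝ) N := by
    intro x
    rw [mem_sphere_zero_iff_norm, mem_sphere_zero_iff_norm, norm_smul, Real.norm_of_nonneg hN'.le]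
    constructor
    · intro h; rw [h, mul_one]
    · intro h; exact mul_left_cancel₀ hN0 (by rw [h, mul_one])
  have hb : ∀ x : Fin k → ℝ, x ∈ Metric.closedBall (0 : Fin k → ℝ) 1 ↔
      (N : ℝ) • x ∈ Metric.closedBall (0 : Fin k → ℝ) N := by
    intro x
    rw [mem_closedBall_zero_iff, mem_closedBall_zero_iff, norm_smul, Real.norm_of_nonneg hN'.le]
    exact (mul_le_iff_le_one_right hN').symm
  have hinv : ∀ x : Fin k → ℝ, (N : ℝ) • ((N : ℝ)⁻¹ • x) = x := fun x => smul_inv_smul₀ hN0 x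
  have hinv' : ∀ x : Fin k → ℝ, (N : ℝ)⁻¹ • ((N : ℝ) • x) = x := fun x => inv_smul_smul₀ hN0 x
  obtain ⟨G, hG1, hG2, hG3⟩ := fill_cells hN (fun x => f ((N : ℝ)⁻¹ • x))
    (hf.comp (by fun_prop) (fun x hx => by rw [hs, hinv]; exact hx)) S
    (fun x hx y hy h => by
      have := hfS ((N : ℝ)⁻¹ • x) (by rw [hs, hinv]; exact hx) ((N : ℝ)⁻¹ • y)
        (by rw [hb, hinv]; exact hy)
      rw [hinv, hinv] at this
      exact this h)
    (fun y hy => by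
      have := hS ((N : ℝ)⁻¹ • y) (by rw [hb, hinv]; exact hy)
      rwa [hinv] at this)
    (fun y hy x hx => by
      have := hmono ((N : ℝ)⁻¹ • y) (by rw [hb, hinv]; exact hy) ((N : ℝ)⁻¹ • x)
        (by rw [hb, hinv]; exact carrier_cell_subset_closedBall hy hx.1)
      rw [hinv, hinv] at this
      exact this hx)
    (finite_carrier_ball N).toFinset (fun c hc => by simpa using hc)
    (fun c hc x hx => by
      rw [Set.Finite.mem_toFinset] at hc ⊢
      obtain ⟨y, hy, rfl⟩ := hc
      exact ⟨x, carrier_cell_subset_closedBall hy hx, rfl⟩)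
  refine ⟨fun x => G ((N : ℝ) • x), hG1.comp (by fun_prop) ?_, ?_, ?_⟩
  · intro x hx
    refine Or.inr (Set.mem_biUnion (x := carrier ((N : ℝ) • x)) ?_ (mem_carrier _))
    rw [Finset.mem_coe, Set.Finite.mem_toFinset]
    exact ⟨_, (hb x).1 hx, rfl⟩
  · intro x hx
    have := hG2 ((hs x).1 hx)
    simpa only [hinv'] using this
  · intro x hx
    refine hG3 (carrier ((N : ℝ) • x)) ?_ _ (mem_carrier _)
    rw [Set.Finite.mem_toFinset]
    exact ⟨_, (hb x).1 hx, rfl⟩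

theorem dist_lt_of_mem_cell {N : ℕ} (hN : 0 < N) {δ : ℝ} (hδ : 1 / (N : ℝ) < δ)
    {c : Cell k} {x y : Fin k → ℝ}
    (hx : (N : ℝ) • x ∈ cell c) (hy : (N : ℝ) • y ∈ cell c) : dist x y < δ := by
  have hN' : (0 : ℝ) < N := by exact_mod_cast hN
  have := dist_le_of_mem_cell hx hy
  rw [dist_smul₀, Real.norm_of_nonneg hN'.le] at this
  refine lt_of_le_of_lt ?_ hδ
  rw [le_div_iff₀ hN']; linarith

end Grid

open Topology

theorem Grid.cell_carrier_subset {k : ℕ} {c : Grid.Cell k} {x : Fin k → ℝ}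
    (hx : x ∈ Grid.cell c) : Grid.cell (Grid.carrier x) ⊆ Grid.cell c := by
  intro z hz i
  have h1 := hx i
  have h2 := hz i
  have h3 : c.1 i ≤ ⌊x i⌋ := Int.le_floor.2 h1.1
  have h3' : (c.1 i : ℝ) ≤ ⌊x i⌋ := by exact_mod_cast h3
  refine ⟨h3'.trans h2.1, h2.2.trans ?_⟩
  by_cases h : x i = ⌊x i⌋
  · have : i ∉ (Grid.carrier x).2 := by
      simp only [Grid.carrier, Finset.mem_filter, Finset.mem_univ, true_and, not_not]
      exact h
    rw [if_neg this]
    change (⌊x i⌋ : ℝ) + 0 ≤ _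
    rw [add_zero, ← h]; exact h1.2
  · have hi : i ∈ (Grid.carrier x).2 := by
      simp only [Grid.carrier, Finset.mem_filter, Finset.mem_univ, true_and]
      exact h
    have hi' := Grid.carrier_subset hx hi
    rw [if_pos hi] 
    rw [if_pos hi'] at h1 ⊢
    change (⌊x i⌋ : ℝ) + 1 ≤ _
    have h4 : (⌊x i⌋ : ℝ) < c.1 i + 1 := lt_of_le_of_ne ((Int.floor_le _).trans h1.2) (fun h' => by
      have := Int.floor_le (x i)
      exact h (le_antisymm (by linarith) this))
    have h5 : ⌊x i⌋ < c.1 i + 1 := by exact_mod_cast h4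
    have : ⌊x i⌋ + 1 ≤ c.1 i + 1 := h5
    exact_mod_cast this

theorem SetConn.of_le {Y : Type*} [TopologicalSpace Y] {S : Set Y} {d : ℤ} (h : d ≤ -2) :
    SetConn d S := fun k hk => by omega

theorem SetConn.nonempty {Y : Type*} [TopologicalSpace Y] {S : Set Y} {d : ℤ} (h : SetConn d S)
    (hd : -1 ≤ d) (y : Y) : S.Nonempty := by
  obtain ⟨G, -, hG, -⟩ := h 0 (by omega) (fun _ => y) continuousOn_const (fun x hx => by
    rw [mem_sphere_zero_iff_norm, Subsingleton.elim x 0, norm_zero] at hx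
    exact absurd hx zero_ne_one)
  exact ⟨_, hG (Metric.mem_closedBall_self zero_le_one)⟩

/-- Gluing of connectivity along an open cover by two sets. -/
theorem SetConn.union {Y : Type*} [TopologicalSpace Y] {A B : Set Y} {d : ℤ} (hAo : IsOpen A)
    (hBo : IsOpen B) (hA : SetConn d A) (hB : SetConn d B) (hAB : SetConn (d - 1) (A ∩ B)) :
    SetConn d (A ∪ B) := by
  classical
  intro k hk f hf hfm
  obtain ⟨U, hU, hfU⟩ := (continuousOn_iff'.1 hf) A hAo
  obtain ⟨V, hV, hfV⟩ := (continuousOn_iff'.1 hf) B hBo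
  obtain ⟨δ, hδ, hleb⟩ := lebesgue_number_lemma_of_metric (isCompact_sphere (0 : Fin k → ℝ) 1)
    (c := fun b : Bool => if b then U else V) (by intro b; cases b <;> simpa) (by
      intro x hx
      rcases hfm hx with h | h
      · have : x ∈ U ∩ Metric.sphere 0 1 := hfU ▸ ⟨h, hx⟩
        exact Set.mem_iUnion.2 ⟨true, this.1⟩
      · have : x ∈ V ∩ Metric.sphere 0 1 := hfV ▸ ⟨h, hx⟩
        exact Set.mem_iUnion.2 ⟨false, this.1⟩)
  obtain ⟨n, hn⟩ := exists_nat_one_div_lt hδ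
  set N := n + 1 with hNdef
  have hN : 0 < N := Nat.succ_pos n
  have hNδ : 1 / (N : ℝ) < δ := by rw [hNdef]; push_cast; exact hn
  let inA : Grid.Cell k → Prop := fun c => ∀ x ∈ Metric.sphere (0 : Fin k → ℝ) 1,
    (N : ℝ) • x ∈ Grid.cell c → f x ∈ A
  let inB : Grid.Cell k → Prop := fun c => ∀ x ∈ Metric.sphere (0 : Fin k → ℝ) 1,
    (N : ℝ) • x ∈ Grid.cell c → f x ∈ B
  have hor : ∀ c, inA c ∨ inB c := by
    intro c
    by_cases hne : ∃ x ∈ Metric.sphere (0 : Fin k → ℝ) 1, (N : ℝ) • x ∈ Grid.cell c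
    · obtain ⟨x, hx, hxc⟩ := hne
      obtain ⟨b, hb⟩ := hleb x hx
      have key : ∀ y, (N : ℝ) • y ∈ Grid.cell c → y ∈ Metric.ball x δ := fun y hy =>
        Grid.dist_lt_of_mem_cell hN hNδ hy hxc
      cases b
      · right
        intro y hy hyc
        have : y ∈ V ∩ Metric.sphere 0 1 := ⟨hb (key y hyc), hy⟩
        rw [← hfV] at this
        exact this.1
      · left
        intro y hy hyc
        have : y ∈ U ∩ Metric.sphere 0 1 := ⟨hb (key y hyc), hy⟩
        rw [← hfU] at this
        exact this.1
    · exact Or.inl fun x hx hxc => absurd ⟨x, hx, hxc⟩ hne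
  let S : Grid.Cell k → Set Y := fun c =>
    if c.2.card < k then {y | (inA c → y ∈ A) ∧ (inB c → y ∈ B)}
    else if inA c then A else B
  have hSsub : ∀ c, S c ⊆ A ∪ B := by
    intro c y hy
    simp only [S] at hy
    split_ifs at hy
    · rcases hor c with h' | h'
      · exact Or.inl (hy.1 h')
      · exact Or.inr (hy.2 h')
    · exact Or.inl hy
    · exact Or.inr hy
  obtain ⟨G, hG1, hG2, hG3⟩ := Grid.fill_grid hN f hf S (by
      intro x hx y hy h
      simp only [S]
      split_ifs with h1 h2
      · exact ⟨fun h' => h' x hx h, fun h' => h' x hx h⟩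
      · exact h2 x hx h
      · exact (hor _).resolve_left h2 x hx h) (by
      intro y hy
      generalize Grid.carrier ((N : ℝ) • y) = c
      have hck : c.2.card ≤ k := by simpa using Finset.card_le_univ c.2
      simp only [S]
      split_ifs with h1 h2
      · by_cases h3 : inA c
        · by_cases h4 : inB c
          · have : {y | (inA c → y ∈ A) ∧ (inB c → y ∈ B)} = A ∩ B := by
              ext; simp [h3, h4]
            rw [this]
            exact hAB _ (by omega)
          · have : {y | (inA c → y ∈ A) ∧ (inB c → y ∈ B)} = A := by
              ext; simp [h3, h4]
            rw [this]
            exact hA _ (by omega)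
        · have h4 := (hor c).resolve_left h3
          have : {y | (inA c → y ∈ A) ∧ (inB c → y ∈ B)} = B := by
              ext; simp [h3, h4]
          rw [this]
          exact hB _ (by omega)
      · exact hA _ (by omega)
      · exact hB _ (by omega)) (by
      intro y hy x hx hxb
      have hlt := Grid.carrier_card_lt hxb
      have hsub := Grid.cell_carrier_subset hxb.1
      generalize Grid.carrier ((N : ℝ) • y) = c at *
      generalize Grid.carrier ((N : ℝ) • x) = c' at *
      have hck : c.2.card ≤ k := by simpa using Finset.card_le_univ c.2
      have hA' : inA c → inA c' := fun h z hz hzc => h z hz (hsub hzc)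
      have hB' : inB c → inB c' := fun h z hz hzc => h z hz (hsub hzc)
      intro z hz
      simp only [S, if_pos (show c'.2.card < k by omega)] at hz
      simp only [S]
      split_ifs with h1 h2
      · exact ⟨fun h => hz.1 (hA' h), fun h => hz.2 (hB' h)⟩
      · exact hz.1 (hA' h2)
      · exact hz.2 (hB' ((hor c).resolve_left h2)))
  exact ⟨G, hG1, fun x hx => hSsub _ (hG3 x hx), hG2⟩

theorem SetConn.iUnion_of_directed {Y : Type*} [TopologicalSpace Y] {ι : Type*} [Nonempty ι]
    {S : ι → Set Y} {d : ℤ} (ho : ∀ i, IsOpen (S i)) (hdir : Directed (· ⊆ ·) S)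
    (h : ∀ i, SetConn d (S i)) : SetConn d (⋃ i, S i) := by
  intro k hk f hf hfm
  obtain ⟨i, hi⟩ := ((isCompact_sphere (0 : Fin k → ℝ) 1).image_of_continuousOn
    hf).elim_directed_cover S ho (by rintro _ ⟨x, hx, rfl⟩; exact hfm hx) hdir
  obtain ⟨G, h1, h2, h3⟩ := h i k hk f hf fun x hx => hi ⟨x, hx, rfl⟩
  exact ⟨G, h1, fun x hx => Set.mem_iUnion.2 ⟨i, h2 hx⟩, h3⟩

theorem SetConn.union_iUnion {Y : Type*} [TopologicalSpace Y] {ι : Type*} {A : Set Y}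
    {B : ι → Set Y} {d : ℤ} (hAo : IsOpen A) (hBo : ∀ i, IsOpen (B i)) (hA : SetConn d A)
    (hB : ∀ i, SetConn d (B i)) (hAB : ∀ i, SetConn (d - 1) (A ∩ B i))
    (hBB : ∀ i j, i ≠ j → B i ∩ B j ⊆ A) : SetConn d (A ∪ ⋃ i, B i) := by
  classical
  have hfin : ∀ T : Finset ι, SetConn d (A ∪ ⋃ i ∈ T, B i) := by
    intro T
    induction T using Finset.induction_on with
    | empty => simpa using hA
    | insert j T hj ih =>
      have : A ∪ ⋃ i ∈ insert j T, B i = (A ∪ ⋃ i ∈ T, B i) ∪ B j := by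
        rw [Finset.set_biUnion_insert, Set.union_assoc, Set.union_comm (B j)]
      rw [this]
      refine ih.union (hAo.union (isOpen_biUnion fun i _ => hBo i)) (hBo j) (hB j) ?_
      have : (A ∪ ⋃ i ∈ T, B i) ∩ B j = A ∩ B j := by
        ext x
        constructor
        · rintro ⟨h | h, hx⟩
          · exact ⟨h, hx⟩
          · simp only [Set.mem_iUnion] at h
            obtain ⟨i, hi, hxi⟩ := h
            exact ⟨hBB i j (fun h => hj (h ▸ hi)) ⟨hxi, hx⟩, hx⟩
        · rintro ⟨h, hx⟩
          exact ⟨Or.inl h, hx⟩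
      rw [this]
      exact hAB j
  have : A ∪ ⋃ i, B i = ⋃ T : Finset ι, (A ∪ ⋃ i ∈ T, B i) := by
    ext x
    simp only [Set.mem_union, Set.mem_iUnion]
    constructor
    · rintro (h | ⟨i, h⟩)
      · exact ⟨∅, Or.inl h⟩
      · exact ⟨{i}, Or.inr ⟨i, by simp, h⟩⟩
    · rintro ⟨T, h | ⟨i, -, h⟩⟩
      · exact Or.inl h
      · exact Or.inr ⟨i, h⟩
  rw [this]
  refine SetConn.iUnion_of_directed (fun T => hAo.union (isOpen_biUnion fun i _ => hBo i)) ?_ hfin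
  refine directed_of_isDirected_le fun T T' hTT' => ?_
  exact Set.union_subset_union_right _ (Set.biUnion_subset_biUnion_left hTT')

section LowerTopology

variable {P : Type*} [TopologicalSpace P] [PartialOrder P] [Topology.IsLowerSet P]

theorem continuousOn_lower_iff {X : Type*} [TopologicalSpace X] {f : X → P} {D : Set X} :
    ContinuousOn f D ↔ ∀ x ∈ D, ∀ᶠ z in 𝓝[D] x, f z ≤ f x := by
  refine forall₂_congr fun x _ => ?_
  rw [ContinuousWithinAt, Topology.IsLowerSet.nhds_eq_principal_Iic, Filter.tendsto_principal]
  rfl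

theorem MonotoneOn.comp_continuousOn_lower {Q : Type*} [TopologicalSpace Q] [PartialOrder Q]
    [Topology.IsLowerSet Q] {X : Type*} [TopologicalSpace X] {f : X → P} {D : Set X} {S : Set P}
    {h : P → Q} (hh : MonotoneOn h S) (hf : ContinuousOn f D) (hm : Set.MapsTo f D S) :
    ContinuousOn (h ∘ f) D := by
  rw [continuousOn_lower_iff] at *
  intro x hx
  filter_upwards [hf x hx, self_mem_nhdsWithin] with z hz hzD
  exact hh (hm hzD) (hm hx) hz

/-- The filling property for a single map. -/
def Fillable {Y : Type*} [TopologicalSpace Y] {k : ℕ} (S : Set Y) (f : (Fin k → ℝ) → Y) : Prop :=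
  ∃ G : (Fin k → ℝ) → Y, ContinuousOn G (Metric.closedBall 0 1) ∧
      Set.MapsTo G (Metric.closedBall 0 1) S ∧ Set.EqOn G f (Metric.sphere 0 1)

theorem Fillable.of_ge {k : ℕ} {S : Set P} {f f' : (Fin k → ℝ) → P} (h : Fillable S f')
    (hf : ContinuousOn f (Metric.sphere 0 1)) (hfS : Set.MapsTo f (Metric.sphere 0 1) S)
    (hle : ∀ x ∈ Metric.sphere (0 : Fin k → ℝ) 1, f' x ≤ f x) : Fillable S f := by
  classical
  obtain ⟨G, hG1, hG2, hG3⟩ := h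
  refine ⟨fun x => if x ∈ Metric.sphere (0 : Fin k → ℝ) 1 then f x else G x, ?_, ?_, ?_⟩
  · rw [continuousOn_lower_iff] at *
    intro x hx
    by_cases hxs : x ∈ Metric.sphere (0 : Fin k → ℝ) 1
    · simp only [if_pos hxs]
      have h1 := hf x hxs
      rw [eventually_nhdsWithin_iff] at h1
      filter_upwards [hG1 x hx, mem_nhdsWithin_of_mem_nhds h1] with z hz1 hz2
      split_ifs with hzs
      · exact hz2 hzs
      · refine hz1.trans ?_
        rw [hG3 hxs]; exact hle x hxs
    · simp only [if_neg hxs]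
      have : ∀ᶠ z in 𝓝 x, z ∉ Metric.sphere (0 : Fin k → ℝ) 1 :=
        Metric.isClosed_sphere.isOpen_compl.mem_nhds hxs
      filter_upwards [hG1 x hx, mem_nhdsWithin_of_mem_nhds this] with z hz1 hz2
      have hz2 : z ∉ Metric.sphere (0 : Fin k → ℝ) 1 := hz2
      rw [if_neg hz2]; exact hz1
  · intro x hx
    simp only
    split_ifs with hxs
    · exact hfS hxs
    · exact hG2 hx
  · intro x hx
    simp only [if_pos hx]

theorem Fillable.of_le {k : ℕ} {S : Set P} {f f' : (Fin k → ℝ) → P} (h : Fillable S f')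
    (hf : ContinuousOn f (Metric.sphere 0 1)) (hfS : Set.MapsTo f (Metric.sphere 0 1) S)
    (hle : ∀ x ∈ Metric.sphere (0 : Fin k → ℝ) 1, f x ≤ f' x) : Fillable S f := by
  classical
  obtain ⟨G, hG1, hG2, hG3⟩ := h
  let ρ : (Fin k → ℝ) → (Fin k → ℝ) := fun x => ‖x‖⁻¹ • x
  have hρs : ∀ x : Fin k → ℝ, 1 / 2 ≤ ‖x‖ → ρ x ∈ Metric.sphere (0 : Fin k → ℝ) 1 := by
    intro x hx
    rw [mem_sphere_zero_iff_norm]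
    simp only [ρ, norm_smul, norm_inv, norm_norm]
    exact inv_mul_cancel₀ (by linarith)
  have hρc : ∀ x : Fin k → ℝ, 1 / 2 ≤ ‖x‖ → ContinuousAt ρ x := by
    intro x hx
    exact (continuousAt_id.norm.inv₀ (by simp; rintro rfl; simp at hx; linarith)).smul
      continuousAt_id
  have hev : ∀ x : Fin k → ℝ, 1 / 2 ≤ ‖x‖ → ∀ᶠ z in 𝓝 x, 1 / 2 ≤ ‖z‖ → f (ρ z) ≤ f (ρ x) := by
    intro x hx
    rw [continuousOn_lower_iff] at hf
    have h1 := hf (ρ x) (hρs x hx)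
    rw [eventually_nhdsWithin_iff] at h1
    filter_upwards [(hρc x hx).eventually h1] with z hz hz'
    exact hz (hρs z hz')
  have hGev : ∀ x : Fin k → ℝ, ‖x‖ ≤ 1 / 2 → ∀ᶠ z in 𝓝 x, ‖z‖ ≤ 1 / 2 →
      G ((2 : ℝ) • z) ≤ G ((2 : ℝ) • x) := by
    intro x hx
    have hb : ∀ x : Fin k → ℝ, ‖x‖ ≤ 1 / 2 → (2 : ℝ) • x ∈ Metric.closedBall (0 : Fin k → ℝ) 1 := by
      intro x hx
      rw [mem_closedBall_zero_iff, norm_smul, Real.norm_of_nonneg zero_le_two]; linarith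
    rw [continuousOn_lower_iff] at hG1
    have h1 := hG1 _ (hb x hx)
    rw [eventually_nhdsWithin_iff] at h1
    have hc : ContinuousAt (fun x : Fin k → ℝ => (2 : ℝ) • x) x := by fun_prop
    filter_upwards [hc.eventually h1] with z hz hz'
    exact hz (hb z hz')
  refine ⟨fun x => if ‖x‖ ≤ 1 / 2 then G ((2 : ℝ) • x) else f (ρ x), ?_, ?_, ?_⟩
  · rw [continuousOn_lower_iff]
    intro x hx
    refine mem_nhdsWithin_of_mem_nhds ?_
    rcases lt_trichotomy ‖x‖ (1 / 2) with hlt | heq | hgt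
    · filter_upwards [hGev x hlt.le, continuous_norm.continuousAt.eventually_lt
        (continuousAt_const (y := (1 / 2 : ℝ))) hlt] with z hz1 hz2
      simp only [if_pos hlt.le, if_pos hz2.le]
      exact hz1 hz2.le
    · filter_upwards [hGev x heq.le, hev x heq.ge] with z hz1 hz2
      simp only [if_pos heq.le]
      split_ifs with hz
      · exact hz1 hz
      · refine (hz2 (not_le.1 hz).le).trans ?_
        have : (2 : ℝ) • x = ρ x := by simp only [ρ, heq]; norm_num
        rw [this, hG3 (hρs x heq.ge)]
        exact hle _ (hρs x heq.ge)
    · filter_upwards [hev x hgt.le, (continuousAt_const (y := (1 / 2 : ℝ))).eventually_lt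
        continuous_norm.continuousAt hgt] with z hz1 hz2
      simp only [if_neg (not_le.2 hgt), if_neg (not_le.2 hz2)]
      exact hz1 hz2.le
  · intro x hx
    simp only
    split_ifs with h
    · refine hG2 ?_
      rw [mem_closedBall_zero_iff, norm_smul, Real.norm_of_nonneg zero_le_two]; linarith
    · exact hfS (hρs x (not_le.1 h).le)
  · intro x hx
    rw [mem_sphere_zero_iff_norm] at hx
    have : ¬ ‖x‖ ≤ 1 / 2 := by rw [hx]; norm_num
    simp only [if_neg this]
    simp only [ρ, hx, inv_one, one_smul]

/-- A poset with a conical contraction fills all spheres. -/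
theorem SetConn.of_cone {S : Set P} (d : ℤ) (p₀ : P) (hp : p₀ ∈ S) (h : P → P)
    (hS : Set.MapsTo h S S) (hmono : MonotoneOn h S) (hle : ∀ a ∈ S, a ≤ h a)
    (hge : ∀ a ∈ S, p₀ ≤ h a) : SetConn d S := by
  intro k _ f hf hfS
  have h0 : Fillable S (fun _ : Fin k → ℝ => p₀) :=
    ⟨_, continuousOn_const, fun _ _ => hp, fun _ _ => rfl⟩
  have h1 : Fillable S (h ∘ f) := h0.of_ge (hmono.comp_continuousOn_lower hf hfS) (hS.comp hfS)
    fun x hx => hge _ (hfS hx)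
  exact h1.of_le hf hfS fun x hx => hle _ (hfS hx)

theorem SetConn.image [Nonempty P] {Q : Type*} [TopologicalSpace Q] [PartialOrder Q] [Topology.IsLowerSet Q]
    {d : ℤ} {S : Set P} {T : Set Q} (h : SetConn d S) (φ : P → Q) (hφ : Set.MapsTo φ S T)
    (hsurj : Set.SurjOn φ S T) (hle : ∀ a ∈ S, ∀ b ∈ S, φ a ≤ φ b ↔ a ≤ b) : SetConn d T := by
  intro k hk f hf hfm
  let ψ : Q → P := Function.invFunOn φ S
  have hψ : ∀ t ∈ T, ψ t ∈ S ∧ φ (ψ t) = t := fun t ht => by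
    obtain ⟨a, ha, rfl⟩ := hsurj ht
    exact ⟨Function.invFunOn_mem ⟨a, ha, rfl⟩, Function.invFunOn_eq ⟨a, ha, rfl⟩⟩
  have hψm : MonotoneOn ψ T := fun a ha b hb hab => by
    rw [← hle _ (hψ a ha).1 _ (hψ b hb).1, (hψ a ha).2, (hψ b hb).2]
    exact hab
  have hφm : MonotoneOn φ S := fun a ha b hb hab => (hle a ha b hb).2 hab
  obtain ⟨G, hG1, hG2, hG3⟩ := h k hk (ψ ∘ f) (hψm.comp_continuousOn_lower hf hfm)
    (fun x hx => (hψ _ (hfm hx)).1)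
  refine ⟨φ ∘ G, hφm.comp_continuousOn_lower hG1 hG2, hφ.comp hG2, fun x hx => ?_⟩
  simp only [Function.comp]
  rw [hG3 hx]
  exact (hψ _ (hfm hx)).2

/-- Lifting of connectivity along a map to a poset with contractible lower fibres. -/
theorem SetConn.of_fibres {X : Type*} [TopologicalSpace X] {p : X → P} (hp : Continuous p)
    (hfib : ∀ x k, FillsSphere k (p ⁻¹' Set.Iic x)) {d : ℤ} (h : SetConn d (Set.univ : Set P)) :
    SetConn d (Set.univ : Set X) := by
  classical
  intro k hk f hf _
  obtain ⟨F, hF, -, hFf⟩ := h k hk (p ∘ f) (hp.comp_continuousOn hf) (Set.mapsTo_univ _ _)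
  have hF' := continuousOn_lower_iff.1 hF
  have hleb : ∀ δ : ℝ, ∃ η : ℝ, 0 < δ → 0 < η ∧ η ≤ δ ∧
      ∀ x ∈ Metric.closedBall (0 : Fin k → ℝ) 1, ∃ z ∈ Metric.closedBall (0 : Fin k → ℝ) 1,
        dist x z < δ ∧ ∀ y ∈ Metric.closedBall (0 : Fin k → ℝ) 1, dist y x < η → F y ≤ F z := by
    intro δ
    by_cases hδ : 0 < δ
    swap
    · exact ⟨0, fun h => absurd h hδ⟩
    have h1 : ∀ z : Metric.closedBall (0 : Fin k → ℝ) 1, ∃ U : Set (Fin k → ℝ), IsOpen U ∧ z.1 ∈ U ∧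
        ∀ y ∈ U, y ∈ Metric.closedBall (0 : Fin k → ℝ) 1 → F y ≤ F z := by
      intro z
      have := hF' z z.2
      rw [eventually_nhdsWithin_iff, eventually_nhds_iff] at this
      obtain ⟨U, hU1, hU2, hU3⟩ := this
      exact ⟨U, hU2, hU3, hU1⟩
    choose U hU1 hU2 hU3 using h1
    obtain ⟨η, hη, hη'⟩ := lebesgue_number_lemma_of_metric
      (isCompact_closedBall (0 : Fin k → ℝ) 1) (c := fun z => U z ∩ Metric.ball z.1 δ)
      (fun z => (hU1 z).inter Metric.isOpen_ball) (fun x hx => Set.mem_iUnion.2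
        ⟨⟨x, hx⟩, hU2 ⟨x, hx⟩, Metric.mem_ball_self hδ⟩)
    refine ⟨min η δ, fun _ => ⟨lt_min hη hδ, min_le_right _ _, fun x hx => ?_⟩⟩
    obtain ⟨z, hz⟩ := hη' x hx
    refine ⟨z.1, z.2, (hz (Metric.mem_ball_self hη)).2, fun y hy hyx => ?_⟩
    exact hU3 z y (hz (lt_of_lt_of_le hyx (min_le_left _ _))).1 hy
  choose H hH using hleb
  let e : ℕ → ℝ := fun n => Nat.rec 1 (fun _ r => H (r / 2)) n
  have he0 : ∀ n, 0 < e n := by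
    intro n
    induction n with
    | zero => exact one_pos
    | succ n ih => exact (hH (e n / 2) (by linarith)).1
  have hes : ∀ n, e (n + 1) ≤ e n / 2 := fun n => (hH (e n / 2) (by linarith [he0 n])).2.1
  have hanti : Antitone e := antitone_nat_of_succ_le fun n => by linarith [hes n, he0 n]
  obtain ⟨n, hn⟩ := exists_nat_one_div_lt (half_pos (he0 (k + 1)))
  set N := n + 1 with hNdef
  have hN : 0 < N := Nat.succ_pos n
  have hNδ : 1 / (N : ℝ) < e (k + 1) / 2 := by rw [hNdef]; push_cast; exact hn
  have hz : ∀ c : Grid.Cell k, ∃ z : Fin k → ℝ, ∀ x ∈ Metric.closedBall (0 : Fin k → ℝ) 1,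
      Grid.carrier ((N : ℝ) • x) = c → z ∈ Metric.closedBall (0 : Fin k → ℝ) 1 ∧
      ∃ xc ∈ Metric.closedBall (0 : Fin k → ℝ) 1, (N : ℝ) • xc ∈ Grid.cell c ∧
        dist xc z < e (k - c.2.card) / 2 ∧
        ∀ y ∈ Metric.closedBall (0 : Fin k → ℝ) 1, dist y xc < e (k - c.2.card + 1) →
          F y ≤ F z := by
    intro c
    by_cases hc : ∃ x ∈ Metric.closedBall (0 : Fin k → ℝ) 1, Grid.carrier ((N : ℝ) • x) = c
    · obtain ⟨x, hx, rfl⟩ := hc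
      obtain ⟨z, hz1, hz2, hz3⟩ := (hH (e (k - (Grid.carrier ((N : ℝ) • x)).2.card) / 2)
        (by linarith [he0 (k - (Grid.carrier ((N : ℝ) • x)).2.card)])).2.2 x hx
      exact ⟨z, fun _ _ _ => ⟨hz1, x, hx, Grid.mem_carrier _, hz2, hz3⟩⟩
    · exact ⟨0, fun x hx h => absurd ⟨x, hx, h⟩ hc⟩
  choose z hz using hz
  obtain ⟨G, hG1, hG2, -⟩ := Grid.fill_grid hN f hf (fun c => p ⁻¹' Set.Iic (F (z c))) (by
      intro x hx y hy hxy
      obtain ⟨-, xc, hxc, hxcc, -, h⟩ := hz _ y hy rfl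
      have : p (f x) = F x := (hFf hx).symm
      change p (f x) ≤ _
      rw [this]
      refine h x (Metric.sphere_subset_closedBall hx) ?_
      refine Grid.dist_lt_of_mem_cell hN (lt_of_lt_of_le hNδ ?_) hxy hxcc
      have : e (k + 1) ≤ e (k - (Grid.carrier ((N : ℝ) • y)).2.card + 1) :=
        @hanti (k - (Grid.carrier ((N : ℝ) • y)).2.card + 1) (k + 1) (by omega)
      linarith [he0 (k + 1)]) (fun y hy => hfib _ _) (by
      intro y hy x hx hxb
      obtain ⟨-, xc, hxc, hxcc, -, h⟩ := hz _ y hy rfl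
      obtain ⟨hz1, xc', hxc', hxcc', hz2, -⟩ := hz _ x hx rfl
      refine Set.preimage_mono (Set.Iic_subset_Iic.2 (h _ hz1 ?_))
      have hlt := Grid.carrier_card_lt hxb
      have hd := Grid.dist_lt_of_mem_cell hN hNδ (Grid.cell_carrier_subset hxb.1 hxcc') hxcc
      generalize Grid.carrier ((N : ℝ) • y) = c at *
      generalize Grid.carrier ((N : ℝ) • x) = c' at *
      have hck : c.2.card ≤ k := by simpa using Finset.card_le_univ c.2
      have h1 : e (k - c'.2.card) ≤ e (k - c.2.card + 1) :=
        @hanti (k - c.2.card + 1) (k - c'.2.card) (by omega)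
      have h2 : e (k + 1) ≤ e (k - c.2.card + 1) := @hanti (k - c.2.card + 1) (k + 1) (by omega)
      calc dist (z c') xc ≤ dist (z c') xc' + dist xc' xc := dist_triangle _ _ _
        _ < e (k - c'.2.card) / 2 + e (k + 1) / 2 := by
          rw [dist_comm (z c')]; exact add_lt_add hz2 hd
        _ ≤ e (k - c.2.card + 1) := by linarith)
  exact ⟨G, hG1, Set.mapsTo_univ _ _, hG2⟩

end LowerTopology

theorem stdSimplex.map_apply_eq {X Y : Type*} [Fintype X] [Fintype Y] [DecidableEq Y] (f : X → Y)
    (s : stdSimplex ℝ X) (y : Y) : stdSimplex.map f s y = ∑ x with f x = y, s x := by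
  rw [stdSimplex.map_coe]
  simp [FunOnFinite.linearMap_apply_apply]

theorem stdSimplex.sum_mul_map {X Y : Type*} [Fintype X] [Fintype Y] (f : X → Y)
    (s : stdSimplex ℝ X) (g : Y → ℝ) :
    ∑ y, g y * stdSimplex.map f s y = ∑ x, g (f x) * s x := by
  classical
  simp only [stdSimplex.map_apply_eq, Finset.mul_sum]
  rw [← Finset.sum_fiberwise_of_maps_to (s := Finset.univ) (t := Finset.univ) (g := f)
    (fun _ _ => Finset.mem_univ _)]
  refine Finset.sum_congr rfl fun y _ => Finset.sum_congr rfl fun x hx => ?_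
  rw [(Finset.mem_filter.1 hx).2]

theorem stdSimplex.map_pos_iff {X Y : Type*} [Fintype X] [Fintype Y] (f : X → Y)
    (s : stdSimplex ℝ X) (y : Y) : 0 < stdSimplex.map f s y ↔ ∃ x, f x = y ∧ 0 < s x := by
  classical
  rw [stdSimplex.map_apply_eq]
  constructor
  · intro h
    by_contra! h'
    refine absurd h (not_lt.2 (Finset.sum_nonpos fun x hx => h' x (Finset.mem_filter.1 hx).2))
  · rintro ⟨x, hx, hs⟩
    exact Finset.sum_pos' (fun x _ => s.2.1 x) ⟨x, by simp [hx], hs⟩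

section LeastVertex

variable {P : Type} [PartialOrder P]

theorem stdSimplex.exists_least {n : ℕ} (t : stdSimplex ℝ (Fin (n + 1))) :
    ∃ i, 0 < t i ∧ ∀ j, 0 < t j → i ≤ j := by
  classical
  have hne : (Finset.univ.filter fun i => 0 < t i).Nonempty := by
    by_contra h
    rw [Finset.not_nonempty_iff_eq_empty, Finset.filter_eq_empty_iff] at h
    have : ∑ i, t i ≤ 0 := Finset.sum_nonpos fun i _ => not_lt.1 (h (Finset.mem_univ i))
    have h1 : ∑ i, t i = 1 := t.2.2
    linarith
  refine ⟨Finset.min' _ hne, (Finset.mem_filter.1 (Finset.min'_mem _ hne)).2, fun j hj => ?_⟩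
  exact Finset.min'_le _ _ (by simp [hj])

/-- The least vertex of the support of a point in a chain. -/
noncomputable def leastVertex {n : ℕ} (c : Fin (n + 1) →o P) (t : stdSimplex ℝ (Fin (n + 1))) : P :=
  c (stdSimplex.exists_least t).choose

theorem leastVertex_le_iff {n : ℕ} (c : Fin (n + 1) →o P) (t : stdSimplex ℝ (Fin (n + 1))) (x : P) :
    leastVertex c t ≤ x ↔ ∃ i, 0 < t i ∧ c i ≤ x := by
  have h := (stdSimplex.exists_least t).choose_spec
  constructor
  · intro hx
    exact ⟨_, h.1, hx⟩
  · rintro ⟨i, hi, hx⟩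
    exact (c.monotone (h.2 i hi)).trans hx

theorem exists_leastVertexMap [TopologicalSpace P] [Topology.IsLowerSet P] :
    ∃ p : C(SSet.toTop.obj (nerve P), P), ∀ n (c : Fin (n + 1) →o P) t x,
      p (nerveCell c t) ≤ x ↔ ∃ i, 0 < t i ∧ c i ≤ x := by
  have hcont : ∀ n (c : Fin (n + 1) →o P), Continuous (leastVertex c) := by
    intro n c
    rw [← continuousOn_univ, continuousOn_lower_iff]
    intro t _
    rw [nhdsWithin_univ]
    obtain ⟨i, hi, hx⟩ := (leastVertex_le_iff c t _).1 le_rfl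
    have hc : Continuous fun s : stdSimplex ℝ (Fin (n + 1)) => s i :=
      (continuous_apply i).comp continuous_subtype_val
    filter_upwards [hc.continuousAt.eventually (lt_mem_nhds hi)] with s hs
    exact (leastVertex_le_iff c s _).2 ⟨i, hs, hx⟩
  obtain ⟨p, hp⟩ := exists_nerve_desc (Z := P) (fun n c => ⟨leastVertex c, hcont n c⟩) (by
    intro m n c θ t
    apply eq_of_forall_ge_iff
    intro x
    simp only [ContinuousMap.coe_mk, leastVertex_le_iff, stdSimplex.map_pos_iff]
    constructor
    · rintro ⟨i, hi, hx⟩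
      exact ⟨θ i, ⟨i, rfl, hi⟩, hx⟩
    · rintro ⟨_, ⟨i, rfl, hi⟩, hx⟩
      exact ⟨i, hi, hx⟩)
  refine ⟨p, fun n c t x => ?_⟩
  rw [hp]
  exact leastVertex_le_iff c t x

open Classical in
/-- The total weight of the vertices below `x`. -/
noncomputable def lowerWeight (x : P) {n : ℕ} (c : Fin (n + 1) →o P)
    (t : stdSimplex ℝ (Fin (n + 1))) : ℝ :=
  ∑ i, (if c i ≤ x then 1 else 0) * t i

theorem continuous_coord {n : ℕ} (i : Fin (n + 1)) :
    Continuous fun s : stdSimplex ℝ (Fin (n + 1)) => s i :=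
  (continuous_apply i).comp continuous_subtype_val

theorem continuous_lowerWeight (x : P) {n : ℕ} (c : Fin (n + 1) →o P) :
    Continuous (lowerWeight x c) :=
  continuous_finsetSum _ fun i _ => continuous_const.mul (continuous_coord i)

theorem lowerWeight_comp (x : P) {m n : ℕ} (c : Fin (n + 1) →o P)
    (θ : Fin (m + 1) →o Fin (n + 1)) (t : stdSimplex ℝ (Fin (m + 1))) :
    lowerWeight x (c.comp θ) t = lowerWeight x c (stdSimplex.map θ t) := by
  classical
  exact (stdSimplex.sum_mul_map θ t fun i => if c i ≤ x then 1 else 0).symm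

theorem lowerWeight_nonneg (x : P) {n : ℕ} (c : Fin (n + 1) →o P)
    (t : stdSimplex ℝ (Fin (n + 1))) : 0 ≤ lowerWeight x c t :=
  Finset.sum_nonneg fun i _ => mul_nonneg (by split_ifs <;> simp) (t.2.1 i)

theorem lowerWeight_le_one (x : P) {n : ℕ} (c : Fin (n + 1) →o P)
    (t : stdSimplex ℝ (Fin (n + 1))) : lowerWeight x c t ≤ 1 := by
  rw [← show ∑ i, t i = 1 from t.2.2]
  refine Finset.sum_le_sum fun i _ => ?_
  have := t.2.1 i
  change 0 ≤ t i at this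
  split_ifs <;> linarith

theorem lowerWeight_pos (x : P) {n : ℕ} (c : Fin (n + 1) →o P)
    (t : stdSimplex ℝ (Fin (n + 1))) (h : ∃ i, 0 < t i ∧ c i ≤ x) : 0 < lowerWeight x c t := by
  obtain ⟨i, hi, hx⟩ := h
  refine Finset.sum_pos' (fun i _ => mul_nonneg (by split_ifs <;> simp) (t.2.1 i))
    ⟨i, Finset.mem_univ i, ?_⟩
  simpa [hx] using hi

open Classical in
/-- The factor by which weights are rescaled in the deformation towards `Iic x`. -/
noncomputable def rescaleFactor (δ : ℝ) (x : P) (u l : ℝ) (y : P) : ℝ :=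
  if y ≤ x then 1 + u * (1 - l) / max l δ else 1 - u * l / max l δ

open Classical in
theorem rescaleFactor_nonneg {δ : ℝ} (hδ : 0 < δ) (x : P) {u l : ℝ} (hu0 : 0 ≤ u) (hu1 : u ≤ 1)
    (hl0 : 0 ≤ l) (hl1 : l ≤ 1) (y : P) : 0 ≤ rescaleFactor δ x u l y := by
  have hm : 0 < max l δ := lt_max_of_lt_right hδ
  unfold rescaleFactor
  split_ifs
  · have : 0 ≤ u * (1 - l) / max l δ := div_nonneg (mul_nonneg hu0 (by linarith)) hm.le
    linarith
  · rw [sub_nonneg, div_le_one hm]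
    exact (mul_le_of_le_one_left hl0 hu1).trans (le_max_left _ _)

/-- Rescaling barycentric coordinates towards the vertices below `x`. -/
noncomputable def rescale {δ : ℝ} (hδ : 0 < δ) (x : P) {n : ℕ} (c : Fin (n + 1) →o P)
    (q : stdSimplex ℝ (Fin (n + 1)) × unitInterval) : stdSimplex ℝ (Fin (n + 1)) :=
  ⟨fun i => rescaleFactor δ x q.2 (lowerWeight x c q.1) (c i) * q.1 i,
    fun i => mul_nonneg (rescaleFactor_nonneg hδ x q.2.2.1 q.2.2.2 (lowerWeight_nonneg x c _)
      (lowerWeight_le_one x c _) _) (q.1.2.1 i), by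
    classical
    set l := lowerWeight x c q.1 with hl
    have hm : 0 < max l δ := lt_max_of_lt_right hδ
    have h1 : ∀ i, rescaleFactor δ x q.2 l (c i) * q.1 i =
        (1 - q.2 * l / max l δ) * q.1 i +
          (q.2 / max l δ) * ((if c i ≤ x then 1 else 0) * q.1 i) := by
      intro i
      unfold rescaleFactor
      split_ifs
      · field_simp; ring
      · ring
    rw [Finset.sum_congr rfl fun i _ => h1 i, Finset.sum_add_distrib, ← Finset.mul_sum,
      ← Finset.mul_sum, show ∑ i, q.1 i = 1 from q.1.2.2]
    change _ + _ * l = 1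
    field_simp; ring⟩

theorem rescale_apply {δ : ℝ} (hδ : 0 < δ) (x : P) {n : ℕ} (c : Fin (n + 1) →o P)
    (q : stdSimplex ℝ (Fin (n + 1)) × unitInterval) (i : Fin (n + 1)) :
    rescale hδ x c q i = rescaleFactor δ x q.2 (lowerWeight x c q.1) (c i) * q.1 i := rfl

theorem continuous_rescale {δ : ℝ} (hδ : 0 < δ) (x : P) {n : ℕ} (c : Fin (n + 1) →o P) :
    Continuous (rescale hδ x c) := by
  refine Continuous.subtype_mk (continuous_pi fun i => ?_) _
  have h1 : Continuous fun q : stdSimplex ℝ (Fin (n + 1)) × unitInterval =>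
      lowerWeight x c q.1 := (continuous_lowerWeight x c).comp continuous_fst
  have h2 : Continuous fun q : stdSimplex ℝ (Fin (n + 1)) × unitInterval => (q.2 : ℝ) :=
    continuous_subtype_val.comp continuous_snd
  have h3 : ∀ q : stdSimplex ℝ (Fin (n + 1)) × unitInterval, max (lowerWeight x c q.1) δ ≠ 0 :=
    fun q => (lt_max_of_lt_right hδ).ne'
  refine Continuous.mul ?_ ((continuous_coord i).comp continuous_fst)
  unfold rescaleFactor
  split_ifs
  · exact continuous_const.add
      ((h2.mul (continuous_const.sub h1)).div (h1.max continuous_const) h3)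
  · exact continuous_const.sub ((h2.mul h1).div (h1.max continuous_const) h3)

theorem rescale_comp {δ : ℝ} (hδ : 0 < δ) (x : P) {m n : ℕ} (c : Fin (n + 1) →o P)
    (θ : Fin (m + 1) →o Fin (n + 1)) (t : stdSimplex ℝ (Fin (m + 1))) (u : unitInterval) :
    stdSimplex.map θ (rescale hδ x (c.comp θ) (t, u)) =
      rescale hδ x c (stdSimplex.map θ t, u) := by
  classical
  apply stdSimplex.ext
  funext i
  rw [rescale_apply, stdSimplex.map_apply_eq, stdSimplex.map_apply_eq, Finset.mul_sum]
  refine Finset.sum_congr rfl fun j hj => ?_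
  rw [rescale_apply, ← lowerWeight_comp]
  simp only [OrderHom.comp_coe, Function.comp, (Finset.mem_filter.1 hj).2]

theorem exists_rescaleHomotopy {δ : ℝ} (hδ : 0 < δ) (x : P) :
    ∃ H : C(SSet.toTop.obj (nerve P), C(unitInterval, SSet.toTop.obj (nerve P))),
      ∀ n (c : Fin (n + 1) →o P) t u,
        H (nerveCell c t) u = nerveCell c (rescale hδ x c (t, u)) := by
  obtain ⟨H, hH⟩ := exists_nerve_desc (P := P)
    (Z := C(unitInterval, SSet.toTop.obj (nerve P)))
    (fun n c => ContinuousMap.curry ⟨fun q => nerveCell c (rescale hδ x c q),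
      (continuous_nerveCell c).comp (continuous_rescale hδ x c)⟩) (by
      intro m n c θ t
      ext u
      change nerveCell (c.comp θ) (rescale hδ x (c.comp θ) (t, u)) = nerveCell c _
      rw [nerveCell_map, rescale_comp])
  refine ⟨H, fun n c t u => ?_⟩
  rw [hH]
  rfl

open Classical in
/-- The monotone retraction onto `Iic x` collapsing everything else to `x`. -/
noncomputable def retractIic (x : P) : P →o P where
  toFun y := if y ≤ x then y else x
  monotone' y z hyz := by
    by_cases hz : z ≤ x
    · simp only [if_pos hz, if_pos (hyz.trans hz)]; exact hyz
    · simp only [if_neg hz]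
      split_ifs with hy
      · exact hy
      · exact le_rfl

theorem retractIic_le (x y : P) : retractIic x y ≤ x := by
  classical
  change (if y ≤ x then y else x) ≤ x
  split_ifs with h
  · exact h
  · exact le_rfl

theorem retractIic_of_le {x y : P} (h : y ≤ x) : retractIic x y = y := if_pos h

/-- The chain obtained by retracting to `Iic x` and appending `x`. -/
noncomputable def coneChain (x : P) {n : ℕ} (c : Fin (n + 1) →o P) : Fin (n + 2) →o P where
  toFun := Fin.snoc (α := fun _ => P) (fun i => retractIic x (c i)) x
  monotone' := by
    intro i j hij
    induction j using Fin.lastCases with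
    | last =>
      rw [Fin.snoc_last]
      induction i using Fin.lastCases with
      | last => rw [Fin.snoc_last]
      | cast i => rw [Fin.snoc_castSucc]; exact retractIic_le x _
    | cast j =>
      induction i using Fin.lastCases with
      | last => exact absurd hij (not_le.2 (Fin.castSucc_lt_last j))
      | cast i =>
        rw [Fin.snoc_castSucc, Fin.snoc_castSucc]
        exact (retractIic x).monotone (c.monotone (Fin.castSucc_le_castSucc_iff.1 hij))

theorem coneChain_le (x : P) {n : ℕ} (c : Fin (n + 1) →o P) (i : Fin (n + 2)) :
    coneChain x c i ≤ x := by
  change Fin.snoc (α := fun _ => P) (fun i => retractIic x (c i)) x i ≤ x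
  induction i using Fin.lastCases with
  | last => rw [Fin.snoc_last]
  | cast i => rw [Fin.snoc_castSucc]; exact retractIic_le x _

/-- Coordinates on the segment from `t` to the last vertex. -/
noncomputable def conePoint {n : ℕ} (q : stdSimplex ℝ (Fin (n + 1)) × unitInterval) :
    stdSimplex ℝ (Fin (n + 2)) :=
  ⟨Fin.snoc (α := fun _ => ℝ) (fun i => (1 - q.2) * q.1 i) q.2, by
    intro i
    induction i using Fin.lastCases with
    | last => rw [Fin.snoc_last]; exact q.2.2.1
    | cast i =>
      rw [Fin.snoc_castSucc]; exact mul_nonneg (sub_nonneg.2 q.2.2.2) (q.1.2.1 i), by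
    rw [Fin.sum_univ_castSucc]
    simp only [Fin.snoc_castSucc, Fin.snoc_last]
    rw [← Finset.mul_sum, show ∑ i, q.1 i = 1 from q.1.2.2]
    ring⟩

theorem conePoint_castSucc {n : ℕ} (q : stdSimplex ℝ (Fin (n + 1)) × unitInterval)
    (i : Fin (n + 1)) : conePoint q i.castSucc = (1 - q.2) * q.1 i := by
  change Fin.snoc (α := fun _ => ℝ) (fun i => (1 - q.2) * q.1 i) q.2 i.castSucc = _
  rw [Fin.snoc_castSucc]

theorem conePoint_last {n : ℕ} (q : stdSimplex ℝ (Fin (n + 1)) × unitInterval) :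
    conePoint q (Fin.last (n + 1)) = q.2 := by
  change Fin.snoc (α := fun _ => ℝ) (fun i => (1 - q.2) * q.1 i) q.2 (Fin.last _) = _
  rw [Fin.snoc_last]

theorem continuous_conePoint {n : ℕ} : Continuous (conePoint (n := n)) := by
  refine Continuous.subtype_mk (continuous_pi fun i => ?_) _
  induction i using Fin.lastCases with
  | last =>
    simp only [Fin.snoc_last]
    exact continuous_subtype_val.comp continuous_snd
  | cast i =>
    simp only [Fin.snoc_castSucc]
    exact (continuous_const.sub (continuous_subtype_val.comp continuous_snd)).mul
      ((continuous_coord i).comp continuous_fst)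

/-- Extension of a simplicial operator by a new last vertex. -/
def coneHom {m n : ℕ} (θ : Fin (m + 1) →o Fin (n + 1)) : Fin (m + 2) →o Fin (n + 2) where
  toFun := Fin.snoc (α := fun _ => Fin (n + 2)) (fun i => (θ i).castSucc) (Fin.last (n + 1))
  monotone' := by
    intro i j hij
    induction j using Fin.lastCases with
    | last => rw [Fin.snoc_last]; exact Fin.le_last _
    | cast j =>
      induction i using Fin.lastCases with
      | last => exact absurd hij (not_le.2 (Fin.castSucc_lt_last j))
      | cast i =>
        rw [Fin.snoc_castSucc, Fin.snoc_castSucc]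
        exact Fin.castSucc_le_castSucc_iff.2 (θ.monotone (Fin.castSucc_le_castSucc_iff.1 hij))

theorem coneHom_castSucc {m n : ℕ} (θ : Fin (m + 1) →o Fin (n + 1)) (i : Fin (m + 1)) :
    coneHom θ i.castSucc = (θ i).castSucc := by
  change Fin.snoc (α := fun _ => Fin (n + 2)) (fun i => (θ i).castSucc) (Fin.last (n + 1)) i.castSucc = _
  rw [Fin.snoc_castSucc]

theorem coneHom_last {m n : ℕ} (θ : Fin (m + 1) →o Fin (n + 1)) :
    coneHom θ (Fin.last (m + 1)) = Fin.last (n + 1) := by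
  change Fin.snoc (α := fun _ => Fin (n + 2)) (fun i => (θ i).castSucc) (Fin.last (n + 1)) (Fin.last _) = _
  rw [Fin.snoc_last]

theorem coneChain_castSucc (x : P) {n : ℕ} (c : Fin (n + 1) →o P) (i : Fin (n + 1)) :
    coneChain x c i.castSucc = retractIic x (c i) := by
  change Fin.snoc (α := fun _ => P) (fun i => retractIic x (c i)) x i.castSucc = _
  rw [Fin.snoc_castSucc]

theorem coneChain_last (x : P) {n : ℕ} (c : Fin (n + 1) →o P) :
    coneChain x c (Fin.last (n + 1)) = x := by
  change Fin.snoc (α := fun _ => P) (fun i => retractIic x (c i)) x (Fin.last _) = _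
  rw [Fin.snoc_last]

theorem coneChain_comp (x : P) {m n : ℕ} (c : Fin (n + 1) →o P) (θ : Fin (m + 1) →o Fin (n + 1)) :
    coneChain x (c.comp θ) = (coneChain x c).comp (coneHom θ) := by
  ext i
  change coneChain x (c.comp θ) i = coneChain x c (coneHom θ i)
  induction i using Fin.lastCases with
  | last => rw [coneHom_last, coneChain_last, coneChain_last]
  | cast i => rw [coneHom_castSucc, coneChain_castSucc, coneChain_castSucc]; rfl

theorem map_coneHom_conePoint {m n : ℕ} (θ : Fin (m + 1) →o Fin (n + 1))
    (t : stdSimplex ℝ (Fin (m + 1))) (u : unitInterval) :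
    stdSimplex.map (coneHom θ) (conePoint (t, u)) = conePoint (stdSimplex.map θ t, u) := by
  classical
  apply stdSimplex.ext
  funext i
  rw [stdSimplex.map_apply_eq, Finset.sum_filter, Fin.sum_univ_castSucc]
  simp only [coneHom_castSucc, coneHom_last, conePoint_castSucc, conePoint_last]
  induction i using Fin.lastCases with
  | last =>
    rw [conePoint_last, if_pos rfl]
    rw [Finset.sum_eq_zero, zero_add]
    intro i _
    rw [if_neg (Fin.castSucc_lt_last _).ne]
  | cast i =>
    rw [conePoint_castSucc, if_neg (Fin.castSucc_lt_last _).ne', add_zero,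
      stdSimplex.map_apply_eq, Finset.sum_filter, Finset.mul_sum]
    refine Finset.sum_congr rfl fun j _ => ?_
    simp only [Fin.castSucc_inj]
    split_ifs <;> simp

theorem exists_coneHomotopy (x : P) :
    ∃ H : C(SSet.toTop.obj (nerve P), C(unitInterval, SSet.toTop.obj (nerve P))),
      ∀ n (c : Fin (n + 1) →o P) t u,
        H (nerveCell c t) u = nerveCell (coneChain x c) (conePoint (t, u)) := by
  obtain ⟨H, hH⟩ := exists_nerve_desc (P := P)
    (Z := C(unitInterval, SSet.toTop.obj (nerve P)))
    (fun n c => ContinuousMap.curry ⟨fun q => nerveCell (coneChain x c) (conePoint q),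
      (continuous_nerveCell _).comp continuous_conePoint⟩) (by
      intro m n c θ t
      ext u
      change nerveCell (coneChain x (c.comp θ)) (conePoint (t, u)) =
        nerveCell (coneChain x c) (conePoint (stdSimplex.map θ t, u))
      rw [coneChain_comp, nerveCell_map, map_coneHom_conePoint])
  refine ⟨H, fun n c t u => ?_⟩
  rw [hH]
  rfl

/-- The vertex of the realization given by an element. -/
noncomputable def nerveVertex (x : P) : SSet.toTop.obj (nerve P) :=
  nerveCell (n := 0) (OrderHom.const _ x) default

theorem nerveCell_coneChain_one (x : P) {n : ℕ} (c : Fin (n + 1) →o P)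
    (t : stdSimplex ℝ (Fin (n + 1))) :
    nerveCell (coneChain x c) (conePoint (t, 1)) = nerveVertex x := by
  classical
  have h1 : conePoint (t, 1) = stdSimplex.map (OrderHom.const (Fin 1) (Fin.last (n + 1)))
      (default : stdSimplex ℝ (Fin 1)) := by
    apply stdSimplex.ext
    funext i
    rw [stdSimplex.map_apply_eq, Finset.sum_filter]
    induction i using Fin.lastCases with
    | last =>
      rw [conePoint_last]
      simp
    | cast i =>
      rw [conePoint_castSucc]
      simp [(Fin.castSucc_lt_last _).ne']
  rw [h1, ← nerveCell_map]
  unfold nerveVertex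
  congr 1
  ext i
  exact coneChain_last x c

theorem nerveCell_coneChain_zero (x : P) {n : ℕ} (c : Fin (n + 1) →o P)
    (t : stdSimplex ℝ (Fin (n + 1))) :
    nerveCell (coneChain x c) (conePoint (t, 0)) = nerveCell ((retractIic x).comp c) t := by
  classical
  have h1 : conePoint (t, 0) = stdSimplex.map (Fin.castSuccOrderEmb (n := n + 1)).toOrderHom t := by
    apply stdSimplex.ext
    funext i
    rw [stdSimplex.map_apply_eq, Finset.sum_filter]
    induction i using Fin.lastCases with
    | last =>
      rw [conePoint_last]
      simp [(Fin.castSucc_lt_last _).ne]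
    | cast i =>
      rw [conePoint_castSucc]
      simp
  rw [h1, ← nerveCell_map]
  congr 1
  ext i
  exact coneChain_castSucc x c i

theorem nerveCell_retractIic (x : P) {n : ℕ} (c : Fin (n + 1) →o P)
    (t : stdSimplex ℝ (Fin (n + 1))) (h : ∀ i, 0 < t i → c i ≤ x) :
    nerveCell ((retractIic x).comp c) t = nerveCell c t := by
  classical
  obtain ⟨i₀, hi₀, -⟩ := (stdSimplex.exists_least t)
  have hne : (Finset.univ.filter fun i => c i ≤ x).Nonempty := ⟨i₀, by simp [h i₀ hi₀]⟩
  set j := Finset.max' _ hne with hj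
  have hjx : c j ≤ x := (Finset.mem_filter.1 (Finset.max'_mem _ hne)).2
  let θ : Fin (n + 1) →o Fin (n + 1) := ⟨fun i => min i j, fun a b hab => min_le_min_right j hab⟩
  have hθ : stdSimplex.map θ t = t := by
    apply stdSimplex.ext
    funext i
    rw [stdSimplex.map_apply_eq, Finset.sum_filter]
    have h0 : ∀ a, 0 < t a → θ a = a := fun a ha =>
      min_eq_left (Finset.le_max' _ _ (by simp [h a ha]))
    rw [Finset.sum_eq_single i]
    · by_cases hi : 0 < t i
      · rw [if_pos (h0 i hi)]
      · have : t i = 0 := le_antisymm (not_lt.1 hi) (t.2.1 i)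
        rw [this]; simp
    · intro a _ hai
      by_cases ha : 0 < t a
      · rw [h0 a ha, if_neg hai]
      · have : t a = 0 := le_antisymm (not_lt.1 ha) (t.2.1 a)
        rw [this]; simp
    · simp
  rw [← hθ, ← nerveCell_map, ← nerveCell_map]
  congr 1
  ext i
  exact retractIic_of_le ((c.monotone (min_le_right i j)).trans hjx)

end LeastVertex

theorem Fillable.of_homotopy {Y : Type*} [TopologicalSpace Y] {k : ℕ} {S : Set Y}
    {f f' : (Fin k → ℝ) → Y} (h : Fillable S f') (K : (Fin k → ℝ) × unitInterval → Y)
    (hK : ContinuousOn K (Metric.sphere 0 1 ×ˢ Set.univ))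
    (hKS : ∀ z ∈ Metric.sphere (0 : Fin k → ℝ) 1, ∀ u, K (z, u) ∈ S)
    (hK0 : ∀ z ∈ Metric.sphere (0 : Fin k → ℝ) 1, K (z, 0) = f z)
    (hK1 : ∀ z ∈ Metric.sphere (0 : Fin k → ℝ) 1, K (z, 1) = f' z) : Fillable S f := by
  classical
  obtain ⟨G, hG1, hG2, hG3⟩ := h
  let ρ : (Fin k → ℝ) → (Fin k → ℝ) := fun x => ‖x‖⁻¹ • x
  let A : Set (Fin k → ℝ) := {x | ‖x‖ ≤ 1 / 2}
  let B : Set (Fin k → ℝ) := {x | 1 / 2 ≤ ‖x‖}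
  have hρs : ∀ x ∈ B, ρ x ∈ Metric.sphere (0 : Fin k → ℝ) 1 := by
    intro x hx
    have hx : 1 / 2 ≤ ‖x‖ := hx
    rw [mem_sphere_zero_iff_norm]
    simp only [ρ, norm_smul, norm_inv, norm_norm]
    exact inv_mul_cancel₀ (by linarith)
  have hρc : ContinuousOn ρ B := by
    refine (continuousOn_id.norm.inv₀ fun x hx => ?_).smul continuousOn_id
    have hx : 1 / 2 ≤ ‖x‖ := hx
    change ‖x‖ ≠ 0
    linarith
  have hA : ∀ x ∈ A, (2 : ℝ) • x ∈ Metric.closedBall (0 : Fin k → ℝ) 1 := by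
    intro x hx
    have hx : ‖x‖ ≤ 1 / 2 := hx
    rw [mem_closedBall_zero_iff, norm_smul, Real.norm_of_nonneg zero_le_two]; linarith
  let τ : (Fin k → ℝ) → unitInterval := fun x => Set.projIcc 0 1 zero_le_one (2 - 2 * ‖x‖)
  have hτ : Continuous τ := by
    refine continuous_projIcc.comp ?_
    fun_prop
  let G' : (Fin k → ℝ) → Y := fun x => if ‖x‖ ≤ 1 / 2 then G ((2 : ℝ) • x) else K (ρ x, τ x)
  have hGA : Set.EqOn G' (fun x => G ((2 : ℝ) • x)) A := fun x hx => if_pos hx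
  have hGB : Set.EqOn G' (fun x => K (ρ x, τ x)) B := by
    intro x hx
    by_cases h : ‖x‖ ≤ 1 / 2
    · have heq : ‖x‖ = 1 / 2 := le_antisymm h hx
      have h1 : τ x = 1 := by
        simp only [τ, heq]; norm_num
      have h2 : (2 : ℝ) • x = ρ x := by simp only [ρ, heq]; norm_num
      simp only [G', if_pos h, h1, h2]
      rw [hK1 _ (hρs x hx), hG3 (hρs x hx)]
    · simp only [G', if_neg h]
  refine ⟨G', ?_, ?_, ?_⟩
  · have : ContinuousOn G' (A ∪ B) := by
      refine ContinuousOn.union_of_isClosed ?_ ?_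
        (isClosed_le continuous_norm continuous_const) (isClosed_le continuous_const continuous_norm)
      · refine ContinuousOn.congr ?_ hGA
        exact hG1.comp (by fun_prop) hA
      · refine ContinuousOn.congr ?_ hGB
        exact hK.comp (hρc.prodMk hτ.continuousOn) fun x hx => ⟨hρs x hx, trivial⟩
    refine this.mono fun x _ => ?_
    rcases le_total ‖x‖ (1 / 2) with h | h
    · exact Or.inl h
    · exact Or.inr h
  · intro x _
    rcases le_total ‖x‖ (1 / 2) with h | h
    · rw [hGA h]; exact hG2 (hA x h)
    · rw [hGB h]; exact hKS _ (hρs x h) _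
  · intro x hx
    rw [mem_sphere_zero_iff_norm] at hx
    have hB : x ∈ B := by change 1 / 2 ≤ ‖x‖; rw [hx]; norm_num
    have h1 : τ x = 0 := by simp [τ, hx]
    have h2 : ρ x = x := by simp [ρ, hx]
    rw [hGB hB]
    simp only [h1, h2]
    exact hK0 x (by rw [mem_sphere_zero_iff_norm]; exact hx)

theorem fillsSphere_lowerFibre {P : Type} [PartialOrder P] [TopologicalSpace P]
    (p : C(SSet.toTop.obj (nerve P), P))
    (hp : ∀ n (c : Fin (n + 1) →o P) t x, p (nerveCell c t) ≤ x ↔ ∃ i, 0 < t i ∧ c i ≤ x)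
    (x : P) (k : ℕ) : FillsSphere k (p ⁻¹' Set.Iic x) := by
  classical
  intro f hf hfm
  obtain ⟨l, hl⟩ := exists_nerve_desc (P := P) (Z := ℝ)
    (fun n c => ⟨lowerWeight x c, continuous_lowerWeight x c⟩)
    (fun m n c θ t => lowerWeight_comp x c θ t)
  have hlpos : ∀ y, p y ≤ x → 0 < l y := by
    intro y hy
    obtain ⟨n, c, t, rfl⟩ := exists_nerveCell_eq y
    rw [hl]
    exact lowerWeight_pos x c t ((hp n c t x).1 hy)
  obtain ⟨δ, hδ, hδl⟩ := (isCompact_sphere (0 : Fin k → ℝ) 1).exists_forall_le'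
    (l.continuous.comp_continuousOn hf) (a := 0) (fun z hz => hlpos _ (hfm hz))
  obtain ⟨H, hH⟩ := exists_rescaleHomotopy hδ x
  obtain ⟨C, hC⟩ := exists_coneHomotopy x
  have hHc : Continuous fun q : SSet.toTop.obj (nerve P) × unitInterval => H q.1 q.2 :=
    (ContinuousMap.uncurry H).continuous
  have hCc : Continuous fun q : SSet.toTop.obj (nerve P) × unitInterval => C q.1 q.2 :=
    (ContinuousMap.uncurry C).continuous
  have hm : ContinuousOn (fun q : (Fin k → ℝ) × unitInterval => (f q.1, q.2))
      (Metric.sphere 0 1 ×ˢ Set.univ) :=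
    (hf.comp continuousOn_fst fun q hq => hq.1).prodMk continuousOn_snd
  have hfac : ∀ (u l : ℝ) (y : P), 0 ≤ u → l ≤ 1 → y ≤ x → 0 < rescaleFactor δ x u l y := by
    intro u l y hu hl hy
    unfold rescaleFactor
    rw [if_pos hy]
    have : 0 ≤ u * (1 - l) / max l δ :=
      div_nonneg (mul_nonneg hu (by linarith)) (lt_max_of_lt_right hδ).le
    linarith
  have hHS : ∀ y, p y ≤ x → ∀ u, p (H y u) ≤ x := by
    intro y hy u
    obtain ⟨n, c, t, rfl⟩ := exists_nerveCell_eq y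
    rw [hH, hp]
    obtain ⟨i, hi, hx⟩ := (hp n c t x).1 hy
    refine ⟨i, ?_, hx⟩
    rw [rescale_apply]
    exact mul_pos (hfac _ _ _ u.2.1 (lowerWeight_le_one x c t) hx) hi
  have hCS : ∀ y u, p (C y u) ≤ x := by
    intro y u
    obtain ⟨n, c, t, rfl⟩ := exists_nerveCell_eq y
    rw [hC, hp]
    obtain ⟨i, hi, -⟩ := stdSimplex.exists_least (conePoint (t, u))
    exact ⟨i, hi, coneChain_le x c i⟩
  have hH0 : ∀ y, H y 0 = y := by
    intro y
    obtain ⟨n, c, t, rfl⟩ := exists_nerveCell_eq y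
    rw [hH]
    congr 1
    apply stdSimplex.ext
    funext i
    rw [rescale_apply]
    simp [rescaleFactor]
  have hC0 : ∀ y, δ ≤ l y → C (H y 1) 0 = H y 1 := by
    intro y hy
    obtain ⟨n, c, t, rfl⟩ := exists_nerveCell_eq y
    rw [hH, hC, nerveCell_coneChain_zero, nerveCell_retractIic]
    intro i hi
    rw [rescale_apply] at hi
    by_contra hci
    rw [hl] at hy
    have hy : δ ≤ lowerWeight x c t := hy
    refine absurd hi (not_lt.2 (le_of_eq ?_))
    unfold rescaleFactor
    rw [if_neg hci, max_eq_left hy]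
    simp only [Set.Icc.coe_one, one_mul]
    rw [div_self (by linarith)]
    simp
  have hC1 : ∀ y, C y 1 = nerveVertex x := by
    intro y
    obtain ⟨n, c, t, rfl⟩ := exists_nerveCell_eq y
    rw [hC, nerveCell_coneChain_one]
  have hv : p (nerveVertex x) ≤ x := by
    unfold nerveVertex
    rw [hp]
    obtain ⟨i, hi, -⟩ := stdSimplex.exists_least (default : stdSimplex ℝ (Fin 1))
    exact ⟨i, hi, le_rfl⟩
  have h0 : Fillable (p ⁻¹' Set.Iic x) (fun _ : Fin k → ℝ => nerveVertex x) :=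
    ⟨_, continuousOn_const, fun _ _ => hv, fun _ _ => rfl⟩
  have h1 : Fillable (p ⁻¹' Set.Iic x) (fun z => H (f z) 1) := by
    refine h0.of_homotopy (fun q => C (H (f q.1) 1) q.2) ?_ (fun z hz u => hCS _ u)
      (fun z hz => hC0 _ (hδl z hz)) (fun z _ => hC1 _)
    refine (hCc.comp ((hHc.comp (continuous_fst.prodMk continuous_const)).prodMk
      continuous_snd)).comp_continuousOn hm
  exact h1.of_homotopy (fun q => H (f q.1) q.2) (hHc.comp_continuousOn hm)
    (fun z hz u => hHS _ (hfm hz) u) (fun z _ => hH0 _) (fun z _ => rfl)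

theorem subsingleton_homotopyGroup_of_fillsSphere {X : Type*} [TopologicalSpace X] {n : ℕ}
    (h : FillsSphere (n + 1) (Set.univ : Set X)) (x : X) :
    Subsingleton (HomotopyGroup (Fin n) X x) := by
  classical
  refine ⟨fun a b => ?_⟩
  induction a using Quotient.inductionOn with | _ f
  induction b using Quotient.inductionOn with | _ g
  refine Quotient.sound ?_
  let q : (Fin (n + 1) → ℝ) → (Fin n → unitInterval) := fun y i =>
    Set.projIcc 0 1 zero_le_one ((y i.succ + 1) / 2)
  have hq : Continuous q := continuous_pi fun i => continuous_projIcc.comp (by fun_prop)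
  let F : (Fin (n + 1) → ℝ) → X := fun y =>
    if y 0 ≤ -1 then f (q y) else if 1 ≤ y 0 then g (q y) else x
  let A : Set (Fin (n + 1) → ℝ) := {y | y 0 ≤ -1}
  let B : Set (Fin (n + 1) → ℝ) := {y | 1 ≤ y 0}
  let C : Set (Fin (n + 1) → ℝ) := {y | ∃ i : Fin n, |y i.succ| = 1}
  have hA : IsClosed A := isClosed_le (continuous_apply 0) continuous_const
  have hB : IsClosed B := isClosed_le continuous_const (continuous_apply 0)
  have hC : IsClosed C := by
    have : C = ⋃ i : Fin n, {y | |y i.succ| = 1} := by ext; simp [C]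
    rw [this]
    exact isClosed_iUnion_of_finite fun i =>
      isClosed_eq (continuous_abs.comp (continuous_apply _)) continuous_const
  have hqC : ∀ y ∈ C, q y ∈ Cube.boundary (Fin n) := by
    rintro y ⟨i, hi⟩
    refine ⟨i, ?_⟩
    rw [abs_eq zero_le_one] at hi
    rcases hi with hi | hi
    · right; simp [q, hi]
    · left; simp [q, hi]
  have hFA : Set.EqOn F (fun y => f (q y)) A := fun y hy => if_pos hy
  have hFB : Set.EqOn F (fun y => g (q y)) B := fun y hy => by
    have hy : 1 ≤ y 0 := hy
    simp only [F]
    rw [if_neg (by linarith), if_pos hy]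
  have hFC : Set.EqOn F (fun _ => x) C := fun y hy => by
    simp only [F]
    split_ifs
    · exact GenLoop.boundary f _ (hqC y hy)
    · exact GenLoop.boundary g _ (hqC y hy)
    · rfl
  have hcov : Metric.sphere (0 : Fin (n + 1) → ℝ) 1 ⊆ (A ∪ B) ∪ C := by
    intro y hy
    rw [mem_sphere_zero_iff_norm] at hy
    obtain ⟨m, hm⟩ : ∃ m, ‖y m‖ = 1 := by
      by_contra! h
      have h1 : ‖y‖ < 1 := by
        rw [pi_norm_lt_iff one_pos]
        intro i
        exact lt_of_le_of_ne (hy ▸ norm_le_pi_norm y i) (h i)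
      linarith
    rw [Real.norm_eq_abs] at hm
    induction m using Fin.cases with
    | zero =>
      left
      rw [abs_eq zero_le_one] at hm
      rcases hm with hm | hm
      · right; exact hm.ge
      · left; exact hm.le
    | succ i => right; exact ⟨i, hm⟩
  have hFcont : ContinuousOn F (Metric.sphere 0 1) := by
    refine ContinuousOn.mono ?_ hcov
    refine ContinuousOn.union_of_isClosed (ContinuousOn.union_of_isClosed ?_ ?_ hA hB) ?_
      (hA.union hB) hC
    · exact ((f.1.continuous.comp hq).continuousOn).congr hFA
    · exact ((g.1.continuous.comp hq).continuousOn).congr hFB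
    · exact continuousOn_const.congr hFC
  obtain ⟨G, hG1, -, hG3⟩ := h F hFcont (Set.mapsTo_univ _ _)
  let e : unitInterval × (Fin n → unitInterval) → (Fin (n + 1) → ℝ) := fun w =>
    Fin.cons (2 * (w.1 : ℝ) - 1) (fun i => 2 * (w.2 i : ℝ) - 1)
  have he0 : ∀ w, e w 0 = 2 * (w.1 : ℝ) - 1 := fun w => rfl
  have hes : ∀ w i, e w (Fin.succ i) = 2 * (w.2 i : ℝ) - 1 := fun w i => rfl
  have he : Continuous e := by
    refine continuous_pi fun m => ?_
    induction m using Fin.cases with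
    | zero => simp only [he0]; fun_prop
    | succ i => simp only [hes]; fun_prop
  have heb : ∀ w, e w ∈ Metric.closedBall (0 : Fin (n + 1) → ℝ) 1 := by
    intro w
    rw [mem_closedBall_zero_iff, pi_norm_le_iff_of_nonneg zero_le_one]
    intro m
    rw [Real.norm_eq_abs, abs_le]
    induction m using Fin.cases with
    | zero =>
      have := w.1.2
      simp only [he0]; constructor <;> linarith [this.1, this.2]
    | succ i =>
      have := (w.2 i).2
      simp only [hes]; constructor <;> linarith [this.1, this.2]
  have hsph : ∀ w m, |e w m| = 1 → e w ∈ Metric.sphere (0 : Fin (n + 1) → ℝ) 1 := by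
    intro w m hm
    have h1 := heb w
    rw [mem_closedBall_zero_iff] at h1
    rw [mem_sphere_zero_iff_norm]
    refine le_antisymm h1 ?_
    rw [← hm, ← Real.norm_eq_abs]
    exact norm_le_pi_norm _ m
  have hqe : ∀ w, q (e w) = w.2 := by
    intro w
    funext i
    simp only [q, hes]
    rw [show (2 * (w.2 i : ℝ) - 1 + 1) / 2 = w.2 i by ring]
    exact Set.projIcc_val _ _
  exact ⟨{
    toFun := fun w => G (e w)
    continuous_toFun := hG1.comp_continuous he heb
    map_zero_left := fun v => by
      have h1 : e (0, v) 0 = -1 := by rw [he0]; simp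
      rw [hG3 (hsph (0, v) 0 (by rw [h1]; simp)), hFA h1.le]
      simp only [hqe]
      rfl
    map_one_left := fun v => by
      have h1 : e (1, v) 0 = 1 := by rw [he0]; norm_num
      rw [hG3 (hsph (1, v) 0 (by rw [h1]; simp)), hFB h1.ge]
      simp only [hqe]
      rfl
    prop' := fun u v hv => by
      obtain ⟨i, hi⟩ := hv
      have h1 : |e (u, v) i.succ| = 1 := by
        rw [hes]
        rcases hi with hi | hi <;> simp only [hi] <;> norm_num
      change G (e (u, v)) = f v
      rw [hG3 (hsph _ _ h1), hFC ⟨i, h1⟩]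
      exact (GenLoop.boundary f v ⟨i, hi⟩).symm }⟩

theorem topDConnected_of_setConn {P : Type} [PartialOrder P] [TopologicalSpace P]
    [Topology.IsLowerSet P] [Nonempty P] {d : ℤ} (h : SetConn d (Set.univ : Set P)) :
    Nonempty (SSet.toTop.obj (nerve P)) ∧ ∀ n : ℕ, (n : ℤ) ≤ d → ∀ x : SSet.toTop.obj (nerve P),
      Subsingleton (HomotopyGroup (Fin n) (SSet.toTop.obj (nerve P)) x) := by
  obtain ⟨p, hp⟩ := exists_leastVertexMap (P := P)
  have h' := SetConn.of_fibres p.continuous (fun x k => fillsSphere_lowerFibre p hp x k) h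
  refine ⟨⟨nerveVertex (Classical.arbitrary P)⟩, fun n hn x => ?_⟩
  exact subsingleton_homotopyGroup_of_fillsSphere (h' (n + 1) (by push_cast; omega)) x

instance OSeq.instTopologicalSpace (V : Type*) : TopologicalSpace (OSeq V) :=
  Topology.lowerSet (OSeq V)

instance OSeq.instIsLowerSet (V : Type*) : Topology.IsLowerSet (OSeq V) := ⟨rfl⟩

/-- Connectivity of the poset of nonempty words satisfying a predicate. -/
def WordConn {V : Type*} (d : ℤ) (L : List V → Prop) : Prop :=
  SetConn d {w : OSeq V | L w.1}

/-- The predicate passes to subwords. -/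
def SubwordClosed {V : Type*} (L : List V → Prop) : Prop :=
  ∀ ⦃l l' : List V⦄, l'.Sublist l → L l → L l'

theorem SubwordClosed.isOpen {V : Type*} {L : List V → Prop} (h : SubwordClosed L) :
    IsOpen {w : OSeq V | L w.1} :=
  Topology.IsLowerSet.isOpen_iff_isLowerSet.2 fun _ _ hba ha => h hba ha

theorem WordConn.congr {V : Type*} {d : ℤ} {L L' : List V → Prop} (h : WordConn d L)
    (hL : ∀ l, l ≠ [] → l.Nodup → (L l ↔ L' l)) : WordConn d L' := by
  have : {w : OSeq V | L w.1} = {w : OSeq V | L' w.1} := Set.ext fun w => hL _ w.2.1 w.2.2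
  rwa [WordConn, ← this]

theorem WordConn.of_cone {V : Type*} (d : ℤ) {L : List V → Prop} (z : V) (hz : L [z])
    (hhead : ∀ l, L l → z ∈ l → l.Nodup → ∃ t, l = z :: t)
    (hcone : ∀ l, L l → z ∉ l → l.Nodup → L (z :: l)) : WordConn d L := by
  classical
  have key : ∀ l, L l → l.Nodup → z :: l.filter (· ≠ z) = if z ∈ l then l else z :: l := by
    intro l hl hn
    split_ifs with h
    · obtain ⟨t, rfl⟩ := hhead l hl h hn
      have hz : z ∉ t := (List.nodup_cons.1 hn).1
      simp only [ne_eq, decide_not, List.filter_cons, decide_true, Bool.not_true, Bool.false_eq_true,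
        if_false, List.cons.injEq, true_and, List.filter_eq_self, Bool.not_eq_true',
        decide_eq_false_iff_not]
      rintro a ha rfl
      exact hz ha
    · simp only [ne_eq, decide_not, List.cons.injEq, true_and, List.filter_eq_self,
        Bool.not_eq_true', decide_eq_false_iff_not]
      rintro a ha rfl
      exact h ha
  refine SetConn.of_cone d (⟨[z], by simp, by simp⟩ : OSeq V) hz
    (fun w => ⟨z :: w.1.filter (· ≠ z), by simp, ?_⟩) ?_ ?_ ?_ ?_
  · refine List.nodup_cons.2 ⟨by simp, w.2.2.filter _⟩
  · intro w hw
    change L (z :: w.1.filter (· ≠ z))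
    rw [key w.1 hw w.2.2]
    split_ifs with h
    · exact hw
    · exact hcone _ hw h w.2.2
  · intro w _ w' _ h
    exact (List.Sublist.filter _ h).cons_cons z
  · intro w hw
    change w.1.Sublist (z :: w.1.filter (· ≠ z))
    rw [key w.1 hw w.2.2]
    split_ifs with h
    · exact List.Sublist.refl _
    · exact List.sublist_cons_self _ _
  · intro w hw
    exact (List.nil_sublist _).cons_cons z

/-- Concatenations of a subword of `c` with a word of `L`. -/
def FullJoin {V : Type*} (c : List V) (L : List V → Prop) (l : List V) : Prop :=
  ∃ w₁ w₂, l = w₁ ++ w₂ ∧ w₁.Sublist c ∧ L w₂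

/-- Concatenations of a proper subword of `c` with a word of `L`. -/
def ProperJoin {V : Type*} (c : List V) (L : List V → Prop) (l : List V) : Prop :=
  ∃ w₁ w₂, l = w₁ ++ w₂ ∧ w₁.Sublist c ∧ w₁ ≠ c ∧ L w₂

theorem FullJoin.subwordClosed {V : Type*} {c : List V} {L : List V → Prop}
    (hL : SubwordClosed L) : SubwordClosed (FullJoin c L) := by
  rintro l l' h ⟨w₁, w₂, rfl, h1, h2⟩
  obtain ⟨u₁, u₂, rfl, hu1, hu2⟩ := List.sublist_append_iff.1 h
  exact ⟨u₁, u₂, rfl, hu1.trans h1, hL hu2 h2⟩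

theorem ProperJoin.subwordClosed {V : Type*} {c : List V} {L : List V → Prop}
    (hL : SubwordClosed L) : SubwordClosed (ProperJoin c L) := by
  rintro l l' h ⟨w₁, w₂, rfl, h1, h1', h2⟩
  obtain ⟨u₁, u₂, rfl, hu1, hu2⟩ := List.sublist_append_iff.1 h
  refine ⟨u₁, u₂, rfl, hu1.trans h1, ?_, hL hu2 h2⟩
  rintro rfl
  exact h1' (h1.antisymm hu1)

theorem WordConn.fullJoin {V : Type*} (d : ℤ) {c : List V} {L : List V → Prop} (hc : c ≠ [])
    (hcn : c.Nodup) (hnil : L []) (hdisj : ∀ l, L l → ∀ x ∈ l, x ∉ c) :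
    WordConn d (FullJoin c L) := by
  obtain ⟨z, t, rfl⟩ := List.exists_cons_of_ne_nil hc
  refine WordConn.of_cone d z ⟨[z], [], by simp, by simp, hnil⟩ ?_ ?_
  · rintro l ⟨w₁, w₂, rfl, h1, h2⟩ hz hn
    rcases List.sublist_cons_iff.1 h1 with h | ⟨r, rfl, hr⟩
    · exfalso
      rcases List.mem_append.1 hz with h' | h'
      · exact (List.nodup_cons.1 hcn).1 (h.subset h')
      · exact hdisj _ h2 z h' (by simp)
    · exact ⟨r ++ w₂, rfl⟩
  · rintro l ⟨w₁, w₂, rfl, h1, h2⟩ hz hn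
    rcases List.sublist_cons_iff.1 h1 with h | ⟨r, rfl, hr⟩
    · exact ⟨z :: w₁, w₂, rfl, h.cons_cons z, h2⟩
    · simp at hz

theorem WordConn.properJoin {V : Type*} {m : ℤ} {L : List V → Prop} (hsub : SubwordClosed L)
    (hnil : L []) (hL : WordConn m L) (c : List V) (hc : c ≠ []) (hcn : c.Nodup)
    (hdisj : ∀ l, L l → ∀ x ∈ l, x ∉ c) : WordConn (m + c.length - 1) (ProperJoin c L) := by
  induction c with
  | nil => exact absurd rfl hc
  | cons z c ih =>
    by_cases hc0 : c = []
    · subst hc0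
      have : m + (([z] : List V).length : ℤ) - 1 = m := by simp
      rw [this]
      refine hL.congr fun l _ _ => ⟨fun h => ⟨[], l, rfl, by simp, by simp, h⟩, ?_⟩
      rintro ⟨w₁, w₂, rfl, h1, h2, h3⟩
      rcases List.sublist_cons_iff.1 h1 with h | ⟨r, rfl, hr⟩
      · rw [List.sublist_nil.1 h]; exact h3
      · rw [List.sublist_nil.1 hr] at h2; exact absurd rfl h2
    have hzc := (List.nodup_cons.1 hcn).1
    have hcn' := (List.nodup_cons.1 hcn).2
    have hdisj' : ∀ l, L l → ∀ x ∈ l, x ∉ c := fun l hl x hx h =>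
      hdisj l hl x hx (List.mem_cons_of_mem _ h)
    have hzJ : ∀ l, FullJoin c L l → z ∉ l := by
      rintro l ⟨w₁, w₂, rfl, h1, h2⟩ h
      rcases List.mem_append.1 h with h | h
      · exact hzc (h1.subset h)
      · exact hdisj _ h2 z h (by simp)
    have hPF : ∀ l, ProperJoin c L l → FullJoin c L l := by
      rintro l ⟨w₁, w₂, rfl, h1, -, h2⟩
      exact ⟨w₁, w₂, rfl, h1, h2⟩
    have ih := ih hc0 hcn' hdisj'
    let B : List V → Prop := fun l => ProperJoin c L l ∨ ∃ t, l = z :: t ∧ ProperJoin c L t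
    have hBs : SubwordClosed B := by
      rintro l l' h (hl | ⟨t, rfl, ht⟩)
      · exact Or.inl (ProperJoin.subwordClosed hsub h hl)
      · rcases List.sublist_cons_iff.1 h with h | ⟨r, rfl, hr⟩
        · exact Or.inl (ProperJoin.subwordClosed hsub h ht)
        · exact Or.inr ⟨r, rfl, ProperJoin.subwordClosed hsub hr ht⟩
    have hB : WordConn (m + c.length) B := by
      refine WordConn.of_cone _ z (Or.inr ⟨[], rfl, [], [], rfl, by simp, fun h => hc0 h.symm, hnil⟩)
        ?_ ?_
      · rintro l (hl | ⟨t, rfl, ht⟩) hz hn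
        · exact absurd hz (hzJ l (hPF l hl))
        · exact ⟨t, rfl⟩
      · rintro l (hl | ⟨t, rfl, ht⟩) hz hn
        · exact Or.inr ⟨l, rfl, hl⟩
        · simp at hz
    have hA : WordConn (m + c.length) (FullJoin c L) :=
      WordConn.fullJoin _ hc0 hcn' hnil hdisj'
    have hAB : WordConn (m + c.length - 1) (fun l => FullJoin c L l ∧ B l) := by
      refine ih.congr fun l _ _ => ⟨fun h => ⟨hPF l h, Or.inl h⟩, ?_⟩
      rintro ⟨hl, hl' | ⟨t, rfl, ht⟩⟩
      · exact hl'
      · exact absurd (by simp) (hzJ _ hl)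
    have hU : WordConn (m + c.length) (fun l => FullJoin c L l ∨ B l) :=
      SetConn.union (FullJoin.subwordClosed hsub).isOpen hBs.isOpen hA hB hAB
    have e : m + ((z :: c).length : ℤ) - 1 = m + c.length := by simp; ring
    rw [e]
    refine hU.congr fun l _ _ => ⟨?_, ?_⟩
    · rintro (⟨w₁, w₂, rfl, h1, h2⟩ | ⟨w₁, w₂, rfl, h1, h1', h2⟩ | ⟨_, rfl, w₁, w₂, rfl, h1, h1', h2⟩)
      · refine ⟨w₁, w₂, rfl, h1.cons z, ?_, h2⟩
        rintro rfl
        exact hzc (h1.subset (by simp))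
      · refine ⟨w₁, w₂, rfl, h1.cons z, ?_, h2⟩
        rintro rfl
        exact hzc (h1.subset (by simp))
      · exact ⟨z :: w₁, w₂, rfl, h1.cons_cons z, by simpa using h1', h2⟩
    · rintro ⟨w₁, w₂, rfl, h1, h1', h2⟩
      rcases List.sublist_cons_iff.1 h1 with h | ⟨r, rfl, hr⟩
      · exact Or.inl ⟨w₁, w₂, rfl, h, h2⟩
      · exact Or.inr (Or.inr ⟨r ++ w₂, rfl, r, w₂, rfl, hr, by simpa using h1', h2⟩)

/-- A complex of duplicate-free words that only depends on the underlying sets of letters. -/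
structure IsWordComplex {V : Type*} (K : List V → Prop) : Prop where
  nodup : ∀ l, K l → l.Nodup
  of_subset : ∀ l l', l'.Nodup → l' ⊆ l → K l → K l'

theorem IsWordComplex.link {V : Type*} {K : List V → Prop} (hK : IsWordComplex K) (σ : List V) :
    IsWordComplex (fun l => K (l ++ σ)) where
  nodup l h := (List.nodup_append.1 (hK.nodup _ h)).1
  of_subset l l' hn hs h := by
    have h' := List.nodup_append'.1 (hK.nodup _ h)
    refine hK.of_subset _ _ (List.nodup_append'.2 ⟨hn, h'.2.1, fun x hx => h'.2.2 (hs hx)⟩) ?_ h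
    exact List.append_subset.2 ⟨fun x hx => List.subset_append_left _ _ (hs hx), List.subset_append_right _ _⟩

theorem IsWordComplex.subwordClosed {V : Type*} {K : List V → Prop} (hK : IsWordComplex K)
    (X : Set V) : SubwordClosed (fun l => K l ∧ ∀ x ∈ l, x ∈ X) := fun l _ h hl =>
  ⟨hK.of_subset l _ ((hK.nodup _ hl.1).sublist h) h.subset hl.1, fun x hx => hl.2 x (h.subset hx)⟩

/-- The letter `y` occurs only in positions below `j`. -/
def OccursBelow {V : Type*} (y : V) (j : ℕ) (l : List V) : Prop :=
  ∀ a b, l = a ++ y :: b → a.length < j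

theorem OccursBelow.subwordClosed {V : Type*} (y : V) (j : ℕ) :
    SubwordClosed (OccursBelow y j) := by
  rintro l _ h hl a b rfl
  obtain ⟨r₁, r₂, rfl, h1, h2⟩ := List.append_sublist_iff.1 h
  obtain ⟨s₁, s₂, rfl, h3, h4⟩ := List.cons_sublist_iff.1 h2
  obtain ⟨p, q, rfl⟩ := List.append_of_mem h3
  have := hl (r₁ ++ p) (q ++ s₂) (by simp)
  have h5 := h1.length_le
  simp only [List.length_append] at this
  omega

/-- Adding one letter `y` to the alphabet `X`. -/
theorem WordConn.insert_letter {V : Type*} {K : List V → Prop} (hK : IsWordComplex K) {X : Set V}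
    {y : V} (hy : y ∉ X) {d : ℤ} (j₀ : ℕ)
    (h₀ : WordConn d (fun l => (K l ∧ ∀ x ∈ l, x ∈ insert y X) ∧ OccursBelow y j₀ l))
    (hlk : ∀ a : List V, (∀ x ∈ a, x ∈ X) → K (a ++ [y]) →
      WordConn (d - 1 - a.length) (fun l => K (l ++ (a ++ [y])) ∧ ∀ x ∈ l, x ∈ X)) :
    WordConn d (fun l => K l ∧ ∀ x ∈ l, x ∈ insert y X) := by
  let S : ℕ → List V → Prop := fun j l => (K l ∧ ∀ x ∈ l, x ∈ insert y X) ∧ OccursBelow y j l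
  have hSs : ∀ j, SubwordClosed (S j) := fun j l l' h hl =>
    ⟨hK.subwordClosed _ h hl.1, OccursBelow.subwordClosed y j h hl.2⟩
  have hstep : ∀ j, WordConn d (S j) → WordConn d (S (j + 1)) := by
    intro j hj
    let ι := {a : List V // (∀ x ∈ a, x ∈ X) ∧ K (a ++ [y]) ∧ a.length = j}
    let Lk : ι → List V → Prop := fun a l => K (l ++ (a.1 ++ [y])) ∧ ∀ x ∈ l, x ∈ X
    have hLks : ∀ a, SubwordClosed (Lk a) := fun a => (hK.link _).subwordClosed X
    have hnil : ∀ a : ι, Lk a [] := fun a => ⟨a.2.2.1, by simp⟩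
    have hcn : ∀ a : ι, (a.1 ++ [y]).Nodup := fun a => hK.nodup _ a.2.2.1
    have hdisj : ∀ a : ι, ∀ l, Lk a l → ∀ x ∈ l, x ∉ a.1 ++ [y] := fun a l hl x hx hx' =>
      (List.nodup_append'.1 (hK.nodup _ hl.1)).2.2 hx hx'
    have hpos : ∀ a : ι, ∀ w₁ w₂, w₁.Sublist (a.1 ++ [y]) → Lk a w₂ →
        (OccursBelow y j (w₁ ++ w₂) ↔ w₁ ≠ a.1 ++ [y]) := by
      intro a w₁ w₂ h1 h2
      have hya : y ∉ a.1 := fun h => hy (a.2.1 y h)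
      constructor
      · rintro h rfl
        have := h a.1 w₂ (by simp)
        rw [a.2.2.2] at this
        exact lt_irrefl _ this
      · intro hne p q hpq
        have hyw : y ∉ w₂ := fun h => hy (h2.2 y h)
        obtain ⟨u₁, u₂, rfl, hu1, hu2⟩ := List.sublist_append_iff.1 h1
        have hu2' : u₂ = [] ∨ u₂ = [y] := by
          rcases List.sublist_cons_iff.1 hu2 with h | ⟨r, rfl, hr⟩
          · exact Or.inl (List.sublist_nil.1 h)
          · rw [List.sublist_nil.1 hr]; exact Or.inr rfl
        have hyu : y ∉ u₁ := fun h => hya (hu1.subset h)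
        rcases hu2' with rfl | rfl
        · exfalso
          have : y ∈ u₁ ++ [] ++ w₂ := by rw [hpq]; simp
          simp only [List.append_nil, List.mem_append] at this
          tauto
        · rw [List.append_assoc] at hpq
          have h3 : u₁ = p := by
            rcases List.append_eq_append_iff.1 hpq with ⟨c, hc1, hc2⟩ | ⟨c, hc1, hc2⟩
            · cases c with
              | nil => simpa using hc1.symm
              | cons z c =>
                simp only [List.cons_append, List.nil_append, List.cons.injEq] at hc2
                exact absurd (by rw [hc2.2]; simp) hyw
            · cases c with
              | nil => simpa using hc1
              | cons z c =>
                simp only [List.cons_append, List.cons.injEq] at hc2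
                exact absurd (by rw [hc1, hc2.1]; simp) hyu
          subst h3
          rw [← a.2.2.2]
          refine lt_of_le_of_ne hu1.length_le fun h => hne ?_
          rw [hu1.eq_of_length h]
    have hsub : ∀ a : ι, ∀ l, l.Nodup → FullJoin (a.1 ++ [y]) (Lk a) l →
        K l ∧ ∀ x ∈ l, x ∈ insert y X := by
      rintro a l hn ⟨w₁, w₂, rfl, h1, h2⟩
      refine ⟨hK.of_subset _ _ hn ?_ h2.1, ?_⟩
      · exact List.append_subset.2 ⟨fun x hx => List.subset_append_right _ _ (h1.subset hx),
          List.subset_append_left _ _⟩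
      · intro x hx
        rcases List.mem_append.1 hx with h | h
        · rcases List.mem_append.1 (h1.subset h) with h | h
          · exact Or.inr (a.2.1 x h)
          · exact Or.inl (by simpa using h)
        · exact Or.inr (h2.2 x h)
    have hU := SetConn.union_iUnion (d := d) (A := {w : OSeq V | S j w.1})
      (B := fun a : ι => {w : OSeq V | FullJoin (a.1 ++ [y]) (Lk a) w.1})
      (hSs j).isOpen (fun a => (FullJoin.subwordClosed (hLks a)).isOpen) hj
      (fun a => WordConn.fullJoin d (by simp) (hcn a) (hnil a) (hdisj a)) ?_ ?_
    · have : {w : OSeq V | S (j + 1) w.1} = {w : OSeq V | S j w.1} ∪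
          ⋃ a : ι, {w : OSeq V | FullJoin (a.1 ++ [y]) (Lk a) w.1} := by
        ext w
        simp only [Set.mem_ofPred_eq, Set.mem_union, Set.mem_iUnion]
        constructor
        · intro hw
          by_cases h : OccursBelow y j w.1
          · exact Or.inl ⟨hw.1, h⟩
          · unfold OccursBelow at h
            push Not at h
            obtain ⟨a, b, hab, hj'⟩ := h
            have h1 := hw.2 a b hab
            have hn := w.2.2
            rw [hab] at hn
            have hm := List.nodup_middle.1 hn
            have hya := (List.nodup_cons.1 hm).1
            have hX : ∀ x ∈ a ++ b, x ∈ X := fun x hx => by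
              have hx' : x ∈ w.1 := by
                rw [hab]; simp only [List.mem_append, List.mem_cons] at hx ⊢; tauto
              rcases hw.1.2 x hx' with rfl | h
              · exact absurd hx hya
              · exact h
            refine Or.inr ⟨⟨a, fun x hx => hX x (by simp [hx]), ?_, by omega⟩, a ++ [y], b,
              by simp [hab], List.Sublist.refl _, ?_, fun x hx => hX x (by simp [hx])⟩
            · refine hK.of_subset _ _ ?_ ?_ hw.1.1
              · refine hn.sublist ?_
                simp
              · rw [hab]; intro x; simp; tauto
            · refine hK.of_subset _ _ ?_ ?_ hw.1.1
              · refine (List.Perm.nodup_iff ?_).1 hn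
                have h2 : (a ++ [y] ++ b).Perm (b ++ (a ++ [y])) := List.perm_append_comm
                simpa using h2
              · intro x hx
                simp only [List.mem_append, List.mem_singleton] at hx
                rw [hab, List.mem_append, List.mem_cons]
                tauto
        · rintro (hw | ⟨a, ha⟩)
          · exact ⟨hw.1, fun a b hab => (hw.2 a b hab).trans (Nat.lt_succ_self _)⟩
          · refine ⟨hsub a _ w.2.2 ha, ?_⟩
            obtain ⟨w₁, w₂, h, h1, h2⟩ := ha
            by_cases hw : w₁ = a.1 ++ [y]
            · intro p q hpq
              rw [h, hw, List.append_assoc] at hpq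
              have hyw : y ∉ w₂ := fun h => hy (h2.2 y h)
              rcases List.append_eq_append_iff.1 hpq with ⟨c, hc1, hc2⟩ | ⟨c, hc1, hc2⟩
              · cases c with
                | nil => simp [hc1, a.2.2.2]
                | cons z c =>
                  simp only [List.cons_append, List.nil_append, List.cons.injEq] at hc2
                  exact absurd (by rw [hc2.2]; simp) hyw
              · rw [← a.2.2.2, hc1, List.length_append]; omega
            · rw [h]
              intro p q hpq
              exact ((hpos a w₁ w₂ h1 h2).2 hw p q hpq).trans (Nat.lt_succ_self _)
      change SetConn d {w : OSeq V | S (j + 1) w.1}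
      rwa [this]
    · intro a
      have h := WordConn.properJoin (hLks a) (hnil a) (hlk a.1 a.2.1 a.2.2.1) (a.1 ++ [y])
        (by simp) (hcn a) (hdisj a)
      have e : d - 1 - (a.1.length : ℤ) + ((a.1 ++ [y]).length : ℤ) - 1 = d - 1 := by
        simp only [List.length_append, List.length_singleton]; push_cast; ring
      rw [e] at h
      refine WordConn.congr (L' := fun l => S j l ∧ FullJoin (a.1 ++ [y]) (Lk a) l) h
        fun l _ hn => ⟨?_, ?_⟩
      · rintro ⟨w₁, w₂, rfl, h1, h1', h2⟩
        exact ⟨⟨hsub a _ hn ⟨w₁, w₂, rfl, h1, h2⟩, (hpos a w₁ w₂ h1 h2).2 h1'⟩,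
          w₁, w₂, rfl, h1, h2⟩
      · rintro ⟨hl, w₁, w₂, rfl, h1, h2⟩
        exact ⟨w₁, w₂, rfl, h1, (hpos a w₁ w₂ h1 h2).1 hl.2, h2⟩
    · rintro a b hab w ⟨⟨w₁, w₂, h, h1, h2⟩, w₁', w₂', h', h1', h2'⟩
      refine ⟨hsub a _ w.2.2 ⟨w₁, w₂, h, h1, h2⟩, ?_⟩
      rw [h, hpos a w₁ w₂ h1 h2]
      rintro rfl
      have hb : ¬ OccursBelow y j w.1 := by
        rw [h, hpos a _ w₂ h1 h2]; simp
      rw [h', hpos b _ _ h1' h2', not_not] at hb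
      subst hb
      rw [h] at h'
      refine hab (Subtype.ext ?_)
      rw [List.append_assoc, List.append_assoc] at h'
      exact (List.append_inj h' (by rw [a.2.2.2, b.2.2.2])).1
  have hS : ∀ j, WordConn d (S (j₀ + j)) := fun j => by
    induction j with
    | zero => exact h₀
    | succ j ih => exact hstep _ ih
  have hun := SetConn.iUnion_of_directed (S := fun j => {w : OSeq V | S (j₀ + j) w.1})
    (fun j => (hSs _).isOpen) (Monotone.directed_le (by
      intro i j hij w hw
      exact ⟨hw.1, fun a b hab => (hw.2 a b hab).trans_le (by omega)⟩)) hS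
  have : {w : OSeq V | K w.1 ∧ ∀ x ∈ w.1, x ∈ insert y X} =
      ⋃ j, {w : OSeq V | S (j₀ + j) w.1} := by
    ext w
    simp only [Set.mem_ofPred_eq, Set.mem_iUnion]
    refine ⟨fun h => ⟨w.1.length, h, fun a b hab => ?_⟩, fun ⟨_, h⟩ => h.1⟩
    rw [hab, List.length_append, List.length_cons]
    omega
  change SetConn d {w : OSeq V | K w.1 ∧ ∀ x ∈ w.1, x ∈ insert y X}
  rwa [this]

theorem IsWordComplex.wordConn_of_finset {V : Type*} {K : List V → Prop} (hK : IsWordComplex K)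
    {X Z : Set V} (hXZ : X ⊆ Z) {d : ℤ}
    (h : ∀ T : Finset V, (∀ t ∈ T, t ∈ Z ∧ t ∉ X) →
      WordConn d (fun l => K l ∧ ∀ x ∈ l, x ∈ X ∪ (T : Set V))) :
    WordConn d (fun l => K l ∧ ∀ x ∈ l, x ∈ Z) := by
  classical
  let ι := {T : Finset V // ∀ t ∈ T, t ∈ Z ∧ t ∉ X}
  have : Nonempty ι := ⟨⟨∅, by simp⟩⟩
  have hun := SetConn.iUnion_of_directed (d := d)
    (S := fun T : ι => {w : OSeq V | K w.1 ∧ ∀ x ∈ w.1, x ∈ X ∪ (T.1 : Set V)})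
    (fun T => (hK.subwordClosed _).isOpen) (by
      intro T T'
      refine ⟨⟨T.1 ∪ T'.1, fun t ht => ?_⟩, ?_, ?_⟩
      · rcases Finset.mem_union.1 ht with h | h
        exacts [T.2 t h, T'.2 t h]
      · intro w hw
        refine ⟨hw.1, fun x hx => (hw.2 x hx).imp id fun h => ?_⟩
        exact Finset.mem_union_left _ h
      · intro w hw
        refine ⟨hw.1, fun x hx => (hw.2 x hx).imp id fun h => ?_⟩
        exact Finset.mem_union_right _ h) (fun T => h T.1 T.2)
  have e : {w : OSeq V | K w.1 ∧ ∀ x ∈ w.1, x ∈ Z} =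
      ⋃ T : ι, {w : OSeq V | K w.1 ∧ ∀ x ∈ w.1, x ∈ X ∪ (T.1 : Set V)} := by
    ext w
    simp only [Set.mem_ofPred_eq, Set.mem_iUnion]
    constructor
    · rintro ⟨h1, h2⟩
      refine ⟨⟨w.1.toFinset.filter (· ∉ X), fun t ht => ?_⟩, h1, fun x hx => ?_⟩
      · rw [Finset.mem_filter, List.mem_toFinset] at ht
        exact ⟨h2 t ht.1, ht.2⟩
      · by_cases hxX : x ∈ X
        · exact Or.inl hxX
        · exact Or.inr (Finset.mem_coe.2 (Finset.mem_filter.2 ⟨List.mem_toFinset.2 hx, hxX⟩))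
    · rintro ⟨T, h1, h2⟩
      exact ⟨h1, fun x hx => (h2 x hx).elim (fun h => hXZ h) fun h => (T.2 x h).1⟩
  change SetConn d {w : OSeq V | K w.1 ∧ ∀ x ∈ w.1, x ∈ Z}
  rwa [e]

theorem occursBelow_zero_of_notMem {V : Type*} {y : V} {l : List V} (h : y ∉ l) (j : ℕ) :
    OccursBelow y j l := by
  rintro a b rfl
  simp at h

theorem WordConn.insert_letter_of_links {V : Type*} {K : List V → Prop} (hK : IsWordComplex K)
    {X : Set V} {y : V} (hy : y ∉ X) {d : ℤ}
    (h₀ : WordConn d (fun l => K l ∧ ∀ x ∈ l, x ∈ X))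
    (hlk : ∀ a : List V, (∀ x ∈ a, x ∈ X) → K (a ++ [y]) →
      WordConn (d - 1 - a.length) (fun l => K (l ++ (a ++ [y])) ∧ ∀ x ∈ l, x ∈ X)) :
    WordConn d (fun l => K l ∧ ∀ x ∈ l, x ∈ insert y X) := by
  refine WordConn.insert_letter hK hy 0 (h₀.congr fun l _ _ => ⟨fun h => ?_, fun h => ?_⟩) hlk
  · exact ⟨⟨h.1, fun x hx => Or.inr (h.2 x hx)⟩,
      occursBelow_zero_of_notMem (fun h' => hy (h.2 y h')) 0⟩
  · refine ⟨h.1.1, fun x hx => (h.1.2 x hx).resolve_left ?_⟩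
    rintro rfl
    obtain ⟨a, b, hab⟩ := List.append_of_mem hx
    exact absurd (h.2 a b hab) (Nat.not_lt_zero _)

theorem WordConn.links_union_finset {V : Type*} {K : List V → Prop} (hK : IsWordComplex K)
    {X : Set V} {d : ℤ} {Q : List V → Prop} (hQ : ∀ σ a y, y ∉ X → Q (a ++ y :: σ))
    (h : ∀ σ, Q σ → K σ → WordConn (d - σ.length) (fun l => K (l ++ σ) ∧ ∀ x ∈ l, x ∈ X))
    (T : Finset V) (hT : ∀ t ∈ T, t ∉ X) (σ : List V) (hσ : Q σ) (hKσ : K σ) :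
    WordConn (d - σ.length) (fun l => K (l ++ σ) ∧ ∀ x ∈ l, x ∈ X ∪ (T : Set V)) := by
  classical
  induction T using Finset.induction_on generalizing σ with
  | empty => simpa using h σ hσ hKσ
  | insert y T hyT ih =>
    have ih := ih fun t ht => hT t (Finset.mem_insert_of_mem ht)
    have hyX := hT y (Finset.mem_insert_self _ _)
    have hset : X ∪ ((insert y T : Finset V) : Set V) = insert y (X ∪ (T : Set V)) := by
      rw [Finset.coe_insert, Set.union_insert]
    rw [hset]
    refine WordConn.insert_letter_of_links (hK.link σ) ?_ (ih σ hσ hKσ) fun a _ hKa => ?_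
    · rintro (h | h)
      exacts [hyX h, hyT h]
    · have h1 := ih (a ++ y :: σ) (hQ σ a y hyX) (by simpa using hKa)
      have e : d - ((a ++ y :: σ).length : ℤ) = d - σ.length - 1 - a.length := by
        rw [List.length_append, List.length_cons]; push_cast; ring
      rw [e] at h1
      simpa using h1

/-- Connectivity of all links over the alphabet `X` passes to larger alphabets. -/
theorem WordConn.links_mono {V : Type*} {K : List V → Prop} (hK : IsWordComplex K)
    {X Z : Set V} (hXZ : X ⊆ Z) {d : ℤ}
    (h : ∀ σ, K σ → WordConn (d - σ.length) (fun l => K (l ++ σ) ∧ ∀ x ∈ l, x ∈ X))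
    (σ : List V) (hσ : K σ) :
    WordConn (d - σ.length) (fun l => K (l ++ σ) ∧ ∀ x ∈ l, x ∈ Z) :=
  (hK.link σ).wordConn_of_finset hXZ fun T hT =>
    WordConn.links_union_finset (Q := fun _ => True) hK (fun _ _ _ _ => trivial)
      (fun σ _ => h σ) T (fun t ht => (hT t ht).2) σ trivial hσ

/-- If a letter `y` cones off all words over `X`, then connectivity of those links over `X`
that involve a letter outside `X` suffices for connectivity over larger alphabets. -/
theorem WordConn.of_cone_letter {V : Type*} {K : List V → Prop} (hK : IsWordComplex K)
    {X Z : Set V} (hXZ : X ⊆ Z) {y : V} (hyX : y ∉ X) (hyZ : y ∈ Z) {d : ℤ} (hnil : K [])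
    (hcone : ∀ l, K l → (∀ x ∈ l, x ∈ X) → K (y :: l))
    (h : ∀ σ, (∃ x ∈ σ, x ∉ X) → K σ →
      WordConn (d - σ.length) (fun l => K (l ++ σ) ∧ ∀ x ∈ l, x ∈ X)) :
    WordConn d (fun l => K l ∧ ∀ x ∈ l, x ∈ Z) := by
  classical
  have hlk := WordConn.links_union_finset (Q := fun σ => ∃ x ∈ σ, x ∉ X) hK
    (fun σ a y hy => ⟨y, by simp, hy⟩) h
  refine hK.wordConn_of_finset (X := insert y X) (Set.insert_subset hyZ hXZ) fun T hT => ?_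
  induction T using Finset.induction_on with
  | empty =>
    simp only [Finset.coe_empty, Set.union_empty]
    refine WordConn.insert_letter hK hyX 1 ?_ fun a ha hKa => ?_
    · refine WordConn.of_cone d y ?_ ?_ ?_
      · refine ⟨⟨hcone [] hnil (by simp), by simp⟩, fun a b hab => ?_⟩
        have := congrArg List.length hab
        simp only [List.length_append, List.length_cons, List.length_nil] at this
        omega
      · rintro l hl hy _
        obtain ⟨a, b, rfl⟩ := List.append_of_mem hy
        have := hl.2 a b rfl
        rw [Nat.lt_one_iff, List.length_eq_zero_iff] at this
        exact ⟨b, by rw [this, List.nil_append]⟩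
      · rintro l hl hy _
        have hlX : ∀ x ∈ l, x ∈ X := fun x hx => (hl.1.2 x hx).resolve_left (by
          rintro rfl
          exact hy hx)
        refine ⟨⟨hcone l hl.1.1 hlX, ?_⟩, ?_⟩
        · intro x hx
          rcases List.mem_cons.1 hx with rfl | hx
          exacts [Or.inl rfl, Or.inr (hlX x hx)]
        · intro a b hab
          cases a with
          | nil => simp
          | cons c a =>
            simp only [List.cons_append, List.cons.injEq] at hab
            exact absurd (by rw [hab.2]; simp) hy
    · have h1 := h (a ++ [y]) ⟨y, by simp, hyX⟩ hKa
      have e : d - ((a ++ [y]).length : ℤ) = d - 1 - a.length := by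
        rw [List.length_append, List.length_singleton]; push_cast; ring
      rwa [e] at h1
  | insert z T hzT ih =>
    have ih := ih fun t ht => hT t (Finset.mem_insert_of_mem ht)
    have hz := (hT z (Finset.mem_insert_self _ _)).2
    have hset : insert y X ∪ ((insert z T : Finset V) : Set V) =
        insert z (insert y X ∪ (T : Set V)) := by
      rw [Finset.coe_insert, Set.union_insert]
    rw [hset]
    refine WordConn.insert_letter_of_links hK ?_ ih fun a _ hKa => ?_
    · rintro (h | h)
      exacts [hz h, hzT h]
    · have h1 := hlk (insert y T) (fun t ht => ?_) (a ++ [z])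
        ⟨z, by simp, fun h => hz (Or.inr h)⟩ hKa
      · have e : d - ((a ++ [z]).length : ℤ) = d - 1 - a.length := by
          rw [List.length_append, List.length_singleton]; push_cast; ring
        have e' : X ∪ ((insert y T : Finset V) : Set V) = insert y X ∪ (T : Set V) := by
          rw [Finset.coe_insert, Set.union_insert, Set.insert_union]
        rwa [e, e'] at h1
      · rcases Finset.mem_insert.1 ht with rfl | ht
        · exact hyX
        · exact fun h => (hT t (Finset.mem_insert_of_mem ht)).2 (Or.inr h)

theorem WordConn.map_injective {V V' : Type*} [Nonempty V] {f : V → V'} (hf : f.Injective)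
    {d : ℤ} {L : List V → Prop} {L' : List V' → Prop} (hL : ∀ l, L l ↔ L' (l.map f))
    (hr : ∀ l, L' l → ∀ x ∈ l, x ∈ Set.range f) (h : WordConn d L) : WordConn d L' := by
  have : Nonempty (OSeq V) := ⟨⟨[Classical.arbitrary V], by simp, by simp⟩⟩
  refine SetConn.image h (fun w => ⟨w.1.map f, by simpa using w.2.1, w.2.2.map hf⟩)
    (fun w hw => (hL _).1 hw) ?_ ?_
  · intro w hw
    have hmem : w.1 ∈ Set.range (List.map f) := by
      rw [Set.range_list_map]
      exact hr _ hw
    obtain ⟨l, hl⟩ := hmem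
    have hne : l ≠ [] := by
      rintro rfl
      exact w.2.1 hl.symm
    have hn : l.Nodup := List.Nodup.of_map f (hl ▸ w.2.2)
    exact ⟨⟨l, hne, hn⟩, (hL _).2 (hl ▸ hw), Subtype.ext hl⟩
  · intro a _ b _
    refine ⟨fun h => ?_, fun h => List.Sublist.map f h⟩
    obtain ⟨l, hl, hab⟩ := List.sublist_map_iff.1 h
    have : l = a.1 := (List.map_injective_iff.2 hf hab).symm
    rw [this] at hl
    exact hl

section Unimodular

variable {R : Type*} [Ring R] {E : Type*} [AddCommGroup E] [Module Rᵐᵒᵖ E]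

/-- A duplicate-free list in a right module is unimodular if each entry is split off by a
functional vanishing on the other entries. -/
def UnimodList (R : Type*) [Ring R] {E : Type*} [AddCommGroup E] [Module Rᵐᵒᵖ E]
    (l : List E) : Prop :=
  l.Nodup ∧ ∀ x ∈ l, ∃ φ : E →ₗ[Rᵐᵒᵖ] R, φ x = 1 ∧ ∀ y ∈ l, y ≠ x → φ y = 0

theorem unimodList_isWordComplex : IsWordComplex (UnimodList R (E := E)) where
  nodup _ h := h.1
  of_subset l l' hn hs h := ⟨hn, fun x hx => by
    obtain ⟨φ, h1, h2⟩ := h.2 x (hs hx)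
    exact ⟨φ, h1, fun y hy => h2 y (hs hy)⟩⟩

theorem UnimodList.perm {l l' : List E} (h : UnimodList R l) (hp : l.Perm l') :
    UnimodList R l' :=
  unimodList_isWordComplex.of_subset l l' (hp.nodup_iff.1 h.1) hp.symm.subset h

/-- The map `r ↦ v r` into a right module. -/
def rightSpan (v : E) : R →ₗ[Rᵐᵒᵖ] E where
  toFun r := op r • v
  map_add' a b := by rw [MulOpposite.op_add, add_smul]
  map_smul' a b := by
    induction a using MulOpposite.rec'
    rw [op_smul_eq_mul, MulOpposite.op_mul, mul_smul, RingHom.id_apply]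

theorem rightSpan_apply (v : E) (r : R) : rightSpan v r = op r • v := rfl

theorem functional_op_smul (φ : E →ₗ[Rᵐᵒᵖ] R) (r : R) (x : E) : φ (op r • x) = φ x * r := by
  rw [map_smul, op_smul_eq_mul]

/-- The projection along `v` to the kernel of a functional `β` with `β v = 1`. -/
def kerProj (β : E →ₗ[Rᵐᵒᵖ] R) (v : E) (hv : β v = 1) : E →ₗ[Rᵐᵒᵖ] LinearMap.ker β :=
  (LinearMap.id - (rightSpan v).comp β).codRestrict _ fun x => by
    simp [rightSpan_apply, hv]

theorem kerProj_coe (β : E →ₗ[Rᵐᵒᵖ] R) (v : E) (hv : β v = 1) (x : E) :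
    (kerProj β v hv x : E) = x - op (β x) • v := rfl

theorem kerProj_self (β : E →ₗ[Rᵐᵒᵖ] R) (v : E) (hv : β v = 1) : kerProj β v hv v = 0 := by
  ext
  simp [kerProj_coe, hv]

theorem kerProj_of_mem (β : E →ₗ[Rᵐᵒᵖ] R) (v : E) (hv : β v = 1) (x : LinearMap.ker β) :
    kerProj β v hv x = x := by
  ext
  simp [kerProj_coe]

theorem unimodList_cons_iff [Nontrivial R] (β : E →ₗ[Rᵐᵒᵖ] R) (v : E) (hv : β v = 1)
    (l : List E) : UnimodList R (v :: l) ↔ UnimodList R (l.map (kerProj β v hv)) := by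
  classical
  constructor
  · rintro ⟨hn, h⟩
    have key : ∀ x ∈ l, ∃ φ : LinearMap.ker β →ₗ[Rᵐᵒᵖ] R, φ (kerProj β v hv x) = 1 ∧
        ∀ y ∈ l, y ≠ x → φ (kerProj β v hv y) = 0 := by
      intro x hx
      obtain ⟨φ, h1, h2⟩ := h x (List.mem_cons_of_mem _ hx)
      have hφv : φ v = 0 := h2 v (by simp) (by
        rintro rfl
        exact (List.nodup_cons.1 hn).1 hx)
      have hφ : ∀ y, φ (kerProj β v hv y : E) = φ y := fun y => by
        rw [kerProj_coe, map_sub, functional_op_smul, hφv, zero_mul, sub_zero]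
      exact ⟨φ.comp (Submodule.subtype _), (hφ x).trans h1,
        fun y hy hyx => (hφ y).trans (h2 y (List.mem_cons_of_mem _ hy) hyx)⟩
    refine ⟨(List.nodup_map_iff_inj_on (List.nodup_cons.1 hn).2).2 ?_, ?_⟩
    · intro x hx y hy hxy
      obtain ⟨φ, h1, h2⟩ := key x hx
      by_contra hne
      rw [hxy, h2 y hy (Ne.symm hne)] at h1
      exact zero_ne_one h1
    · intro _ hx'
      obtain ⟨x, hx, rfl⟩ := List.mem_map.1 hx'
      obtain ⟨φ, h1, h2⟩ := key x hx
      refine ⟨φ, h1, fun _ hy' hne => ?_⟩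
      obtain ⟨y, hy, rfl⟩ := List.mem_map.1 hy'
      exact h2 y hy fun h => hne (h ▸ rfl)
  · rintro ⟨hn, h⟩
    have hinj := List.inj_on_of_nodup_map hn
    have key : ∀ x, ∃ φ : E →ₗ[Rᵐᵒᵖ] R, x ∈ l → φ x = 1 ∧ φ v = 0 ∧
        ∀ y ∈ l, y ≠ x → φ y = 0 := by
      intro x
      by_cases hx : x ∈ l
      · obtain ⟨φ, h1, h2⟩ := h _ (List.mem_map_of_mem hx)
        refine ⟨φ.comp (kerProj β v hv), fun _ => ⟨h1, ?_, fun y hy hne => ?_⟩⟩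
        · rw [LinearMap.comp_apply, kerProj_self, map_zero]
        · exact h2 _ (List.mem_map_of_mem hy) fun h' => hne (hinj hy hx h')
      · exact ⟨0, fun h => absurd h hx⟩
    choose φ hφ using key
    have hvl : v ∉ l := fun hvl => by
      have := hφ v hvl
      exact zero_ne_one (this.2.1.symm.trans this.1)
    refine ⟨List.nodup_cons.2 ⟨hvl, List.Nodup.of_map _ hn⟩, fun x hx' => ?_⟩
    rcases List.mem_cons.1 hx' with rfl | hx
    · refine ⟨β - ∑ y ∈ l.toFinset, β y • φ y, ?_, fun z hz hne => ?_⟩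
      · rw [LinearMap.sub_apply, LinearMap.sum_apply, Finset.sum_eq_zero, hv, sub_zero]
        intro y hy
        rw [LinearMap.smul_apply, (hφ y (List.mem_toFinset.1 hy)).2.1, smul_zero]
      · have hz := (List.mem_cons.1 hz).resolve_left hne
        rw [LinearMap.sub_apply, LinearMap.sum_apply, Finset.sum_eq_single z,
          LinearMap.smul_apply, (hφ z hz).1, smul_eq_mul, mul_one, sub_self]
        · intro y hy hyz
          rw [LinearMap.smul_apply, (hφ y (List.mem_toFinset.1 hy)).2.2 z hz hyz.symm, smul_zero]
        · exact fun h => absurd (List.mem_toFinset.2 hz) h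
    · refine ⟨φ x, (hφ x hx).1, fun y hy hne => ?_⟩
      rcases List.mem_cons.1 hy with rfl | hy
      exacts [(hφ x hx).2.1, (hφ x hx).2.2 y hy hne]

theorem WordConn.of_ker [Nontrivial R] {β : E →ₗ[Rᵐᵒᵖ] R} {v : E} (hv : β v = 1) {d : ℤ}
    {τ σ : List E} (hσ : σ.Perm (v :: τ)) {A' : Set (LinearMap.ker β)} {A : Set E}
    (hA : ∀ x, x ∈ A ↔ ∃ h : x ∈ LinearMap.ker β, (⟨x, h⟩ : LinearMap.ker β) ∈ A')
    (h : WordConn d (fun l => UnimodList R (l ++ τ.map (kerProj β v hv)) ∧ ∀ x ∈ l, x ∈ A')) :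
    WordConn d (fun l => UnimodList R (l ++ σ) ∧ ∀ x ∈ l, x ∈ A) := by
  refine WordConn.map_injective (f := fun x : LinearMap.ker β => (x : E))
    Subtype.val_injective (fun l => and_congr ?_ ?_) ?_ h
  · have e : l ++ τ.map (kerProj β v hv) =
        (l.map (fun x : LinearMap.ker β => (x : E)) ++ τ).map (kerProj β v hv) := by
      rw [List.map_append, List.map_map]
      congr 1
      conv_lhs => rw [← List.map_id l]
      exact List.map_congr_left fun x _ => (kerProj_of_mem β v hv x).symm
    rw [e, ← unimodList_cons_iff]
    have hp : (v :: (l.map (fun x : LinearMap.ker β => (x : E)) ++ τ)).Perm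
        (l.map (fun x : LinearMap.ker β => (x : E)) ++ σ) :=
      List.perm_middle.symm.trans (hσ.symm.append_left _)
    exact ⟨fun h => h.perm hp, fun h => h.perm hp.symm⟩
  · simp only [List.mem_map, forall_exists_index, and_imp, forall_apply_eq_imp_iff₂]
    refine forall₂_congr fun x hx => ?_
    rw [hA]
    exact ⟨fun h => ⟨x.2, h⟩, fun ⟨_, h⟩ => h⟩
  · rintro l ⟨-, hl⟩ x hx
    obtain ⟨h, -⟩ := (hA x).1 (hl x hx)
    exact ⟨⟨x, h⟩, rfl⟩

end Unimodular

section StableRange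

variable {R : Type*} [Ring R] {E : Type*} [AddCommGroup E] [Module Rᵐᵒᵖ E]

theorem isUnimodularSeq_column_iff {n : ℕ} (r : Fin n → R) :
    IsUnimodularSeq R (Fin n → R) (fun _ : Fin 1 => r) ↔ ∃ a : Fin n → R, ∑ i, a i * r i = 1 := by
  constructor
  · rintro ⟨f, φ, hf, hφ⟩
    refine ⟨fun i => φ 0 (Pi.single i 1), ?_⟩
    have h1 : φ 0 r = 1 := by
      have := LinearMap.congr_fun (hφ 0 0) 1
      simpa [hf 0] using this
    have h2 : r = ∑ i, op (r i) • (Pi.single i 1 : Fin n → R) := by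
      ext j
      simp [Finset.sum_apply, Pi.single_apply]
    conv_rhs => rw [← h1, h2]
    rw [map_sum]
    exact Finset.sum_congr rfl fun i _ => (functional_op_smul _ _ _).symm
  · rintro ⟨a, ha⟩
    refine ⟨fun _ => rightSpan r, fun _ => ∑ i, a i • LinearMap.proj i, fun i => ?_, fun i j => ?_⟩
    · simp [rightSpan_apply]
    · rw [Subsingleton.elim i j, if_pos rfl]
      ext
      simp [rightSpan_apply, ha]

/-- The stable range condition in terms of left inverses of columns. -/
def StableColumns (R : Type*) [Ring R] (n : ℕ) : Prop :=
  ∀ r : Fin (n + 1) → R, (∃ a : Fin (n + 1) → R, ∑ i, a i * r i = 1) →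
    ∃ t c : Fin n → R, ∑ i, c i * (r i.castSucc + t i * r (Fin.last n)) = 1

theorem SatisfiesStableRange.stableColumns {s : ℕ} (h : SatisfiesStableRange R s) :
    StableColumns R s := fun r hr => by
  obtain ⟨t, ht⟩ := h r ((isUnimodularSeq_column_iff r).2 hr)
  exact ⟨t, (isUnimodularSeq_column_iff _).1 ht⟩

theorem StableColumns.succ {n : ℕ} (h : StableColumns R n) : StableColumns R (n + 1) := by
  rintro r ⟨a, ha⟩
  rw [Fin.sum_univ_succ, Fin.sum_univ_castSucc] at ha
  obtain ⟨t, c, htc⟩ := h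
    (Fin.snoc (fun i : Fin n => r i.castSucc.succ) (a 0 * r 0 + a (Fin.last _) * r (Fin.last _)))
    ⟨Fin.snoc (fun i : Fin n => a i.castSucc.succ) 1, by
      rw [Fin.sum_univ_castSucc]
      simp only [Fin.snoc_castSucc, Fin.snoc_last, one_mul]
      rw [← ha, Fin.succ_last]
      abel⟩
  simp only [Fin.snoc_castSucc, Fin.snoc_last] at htc
  refine ⟨Fin.cons 0 fun i => t i * a (Fin.last _),
    Fin.cons (∑ i, c i * t i * a 0) c, ?_⟩
  rw [Fin.sum_univ_succ]
  simp only [Fin.cons_zero, Fin.cons_succ, zero_mul, add_zero, Fin.castSucc_zero]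
  rw [← htc, Finset.sum_mul, ← Finset.sum_add_distrib]
  refine Finset.sum_congr rfl fun i _ => ?_
  rw [Fin.succ_castSucc]
  noncomm_ring

theorem StableColumns.mono {m n : ℕ} (h : StableColumns R m) (hmn : m ≤ n) :
    StableColumns R n := by
  induction n, hmn using Nat.le_induction with
  | base => exact h
  | succ n _ ih => exact ih.succ

theorem StableColumns.pos [Nontrivial R] {n : ℕ} (h : StableColumns R n) : 1 ≤ n := by
  rcases Nat.eq_zero_or_pos n with rfl | hn
  · obtain ⟨t, c, htc⟩ := h (fun _ => 1) ⟨fun _ => 1, by simp⟩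
    simp at htc
  · exact hn

/-- A hyperbolic-type pairing between a family of vectors and a family of functionals. -/
def IsDualPair {n : ℕ} (b : Fin n → E) (β : Fin n → (E →ₗ[Rᵐᵒᵖ] R)) : Prop :=
  ∀ i j, β i (b j) = if i = j then 1 else 0

theorem StableColumns.exists_dual {n : ℕ} (h : StableColumns R n) {b : Fin n → E}
    {β : Fin n → (E →ₗ[Rᵐᵒᵖ] R)} (hb : IsDualPair b β) {v : E} {φ : E →ₗ[Rᵐᵒᵖ] R}
    (hφ : φ v = 1) : ∃ β' : Fin n → (E →ₗ[Rᵐᵒᵖ] R), IsDualPair b β' ∧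
      ∃ c : Fin n → R, ∑ i, c i * β' i v = 1 := by
  let ψ : E →ₗ[Rᵐᵒᵖ] R := φ - ∑ i, φ (b i) • β i
  have hψ : ∀ x, ψ x = φ x - ∑ i, φ (b i) * β i x := fun x => by
    simp [ψ, LinearMap.sum_apply]
  obtain ⟨t, c, htc⟩ := h (Fin.snoc (fun i => β i v) (ψ v)) ⟨Fin.snoc (fun i => φ (b i)) 1, by
    rw [Fin.sum_univ_castSucc]
    simp only [Fin.snoc_castSucc, Fin.snoc_last, one_mul]
    rw [hψ, hφ]
    abel⟩
  simp only [Fin.snoc_castSucc, Fin.snoc_last] at htc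
  refine ⟨fun i => β i + t i • ψ, fun i j => ?_, c, by simpa using htc⟩
  have : ψ (b j) = 0 := by
    rw [hψ, Finset.sum_eq_single j]
    · simp [hb j j]
    · intro i _ hij
      rw [hb i j, if_neg hij, mul_zero]
    · simp
  rw [LinearMap.add_apply, LinearMap.smul_apply, this, smul_zero, add_zero, hb i j]

theorem StableColumns.exists_splitting {k : ℕ} (h : StableColumns R k) (M : Submodule Rᵐᵒᵖ E)
    {b : Fin (k + 1) → E} {β : Fin (k + 1) → (E →ₗ[Rᵐᵒᵖ] R)} (hbM : ∀ i, b i ∈ M)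
    (hb : IsDualPair b β) {v : E} {φ : E →ₗ[Rᵐᵒᵖ] R} (hφ : φ v = 1) (e : E) :
    ∃ χ : E →ₗ[Rᵐᵒᵖ] R, χ v = 1 ∧ (∃ m ∈ M, χ (e - m) = 0) ∧
      ∃ (b' : Fin k → E) (β' : Fin k → (E →ₗ[Rᵐᵒᵖ] R)), (∀ i, b' i ∈ M) ∧ (∀ i, χ (b' i) = 0) ∧
        IsDualPair b' β' := by
  obtain ⟨γ, hγ, c, hc⟩ := h.succ.exists_dual hb hφ
  obtain ⟨t, c', hc'⟩ := h (fun i => γ i v) ⟨c, hc⟩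
  let L := Fin.last k
  have hγc : ∀ i j : Fin k, γ i.castSucc (b j.castSucc) = if i = j then 1 else 0 := fun i j => by
    rw [hγ]; simp
  have hγL : ∀ i : Fin k, γ i.castSucc (b L) = 0 := fun i => by
    rw [hγ, if_neg (Fin.castSucc_lt_last i).ne]
  have hLγ : ∀ i : Fin k, γ L (b i.castSucc) = 0 := fun i => by
    rw [hγ, if_neg (Fin.castSucc_lt_last i).ne']
  have hLL : γ L (b L) = 1 := by rw [hγ, if_pos rfl]
  let δ : Fin k → (E →ₗ[Rᵐᵒᵖ] R) := fun i => γ i.castSucc + t i • γ L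
  have hδ : ∀ i x, δ i x = γ i.castSucc x + t i * γ L x := fun i x => rfl
  let z : E := b L - ∑ i, op (t i) • b i.castSucc
  have hzM : z ∈ M := M.sub_mem (hbM _) (M.sum_mem fun i _ => M.smul_mem _ (hbM _))
  have hLz : γ L z = 1 := by
    simp only [z, map_sub, map_sum, functional_op_smul, hLγ, zero_mul, Finset.sum_const_zero,
      sub_zero, hLL]
  have hcz : ∀ i : Fin k, γ i.castSucc z = - t i := fun i => by
    simp only [z, map_sub, map_sum, functional_op_smul, hγc, hγL, ite_mul, one_mul, zero_mul,
      Finset.sum_ite_eq, Finset.mem_univ, if_true, zero_sub]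
  have hδz : ∀ i, δ i z = 0 := fun i => by rw [hδ, hcz, hLz, mul_one, neg_add_cancel]
  let χ : E →ₗ[Rᵐᵒᵖ] R := γ L + (1 - γ L v) • ∑ i, c' i • δ i
  have hχ : ∀ x, χ x = γ L x + (1 - γ L v) * ∑ i, c' i * δ i x := fun x => by
    simp [χ, LinearMap.sum_apply]
  have hχz : χ z = 1 := by
    simp [hχ, hLz, hδz]
  refine ⟨χ, ?_, ⟨op (χ e) • z, M.smul_mem _ hzM, ?_⟩,
    fun j => b j.castSucc - op (χ (b j.castSucc)) • z, δ,
    fun j => M.sub_mem (hbM _) (M.smul_mem _ hzM), fun j => ?_, fun i j => ?_⟩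
  · rw [hχ]
    simp only [hδ]
    rw [hc', mul_one, add_sub_cancel]
  · rw [map_sub, functional_op_smul, hχz, one_mul, sub_self]
  · rw [map_sub, functional_op_smul, hχz, one_mul, sub_self]
  · rw [map_sub, functional_op_smul, hδz, zero_mul, sub_zero, hδ, hLγ, mul_zero, add_zero, hγc]

end StableRange

/-- Connectivity of links of unimodular words over a submodule containing `R^g`. -/
def SubmoduleLinksConn (R : Type) [Ring R] (s g : ℕ) : Prop :=
  ∀ (E : Type) [AddCommGroup E] [Module Rᵐᵒᵖ E] (M : Submodule Rᵐᵒᵖ E) (b : Fin g → E)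
    (β : Fin g → (E →ₗ[Rᵐᵒᵖ] R)), (∀ i, b i ∈ M) → IsDualPair b β →
    ∀ v : List E, UnimodList R v →
      WordConn ((g : ℤ) - s - 1 - v.length) (fun l => UnimodList R (l ++ v) ∧ ∀ x ∈ l, x ∈ M)

/-- Connectivity of links of unimodular words over `M ∪ (M + e)`, where `M` contains `R^g`
and `e` is split off by a functional vanishing on `M`. -/
def ShiftedLinksConn (R : Type) [Ring R] (s g : ℕ) : Prop :=
  ∀ (E : Type) [AddCommGroup E] [Module Rᵐᵒᵖ E] (M : Submodule Rᵐᵒᵖ E) (b : Fin g → E)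
    (β : Fin g → (E →ₗ[Rᵐᵒᵖ] R)) (e : E) (ε : E →ₗ[Rᵐᵒᵖ] R), (∀ i, b i ∈ M) → IsDualPair b β →
    ε e = 1 → (∀ m ∈ M, ε m = 0) →
    ∀ v : List E, UnimodList R v →
      WordConn ((g : ℤ) - s - v.length)
        (fun l => UnimodList R (l ++ v) ∧ ∀ x ∈ l, x ∈ {x | x ∈ M ∨ x - e ∈ M})

section Induction

variable {R : Type} [Ring R] {s g : ℕ}

theorem ShiftedLinksConn.submoduleLinksConn_succ (h : ShiftedLinksConn R s g) :
    SubmoduleLinksConn R s (g + 1) := by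
  intro E _ _ M b β hbM hb v hv
  have e : ((g + 1 : ℕ) : ℤ) - s - 1 - v.length = (g : ℤ) - s - v.length := by push_cast; ring
  rw [e]
  let L := Fin.last g
  refine WordConn.links_mono (X := {x | x ∈ M ⊓ LinearMap.ker (β L) ∨
    x - b L ∈ M ⊓ LinearMap.ker (β L)}) (Z := M) unimodList_isWordComplex ?_
    (fun σ hσ => h E (M ⊓ LinearMap.ker (β L)) (fun i => b i.castSucc) (fun i => β i.castSucc)
      (b L) (β L) ?_ ?_ ?_ ?_ σ hσ) v hv
  · rintro x (hx | hx)
    · exact hx.1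
    · have := M.add_mem hx.1 (hbM L)
      rwa [sub_add_cancel] at this
  · intro i
    refine ⟨hbM _, ?_⟩
    change β L (b i.castSucc) = 0
    rw [hb, if_neg (Fin.castSucc_lt_last i).ne']
  · intro i j
    rw [hb]; simp
  · rw [hb, if_pos rfl]
  · exact fun m hm => hm.2

theorem SubmoduleLinksConn.shifted_nil [Nontrivial R] (h : SubmoduleLinksConn R s g) (E : Type)
    [AddCommGroup E] [Module Rᵐᵒᵖ E] (M : Submodule Rᵐᵒᵖ E) (b : Fin g → E)
    (β : Fin g → (E →ₗ[Rᵐᵒᵖ] R)) (e : E) (ε : E →ₗ[Rᵐᵒᵖ] R) (hbM : ∀ i, b i ∈ M)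
    (hb : IsDualPair b β) (he : ε e = 1) (hεM : ∀ m ∈ M, ε m = 0) :
    WordConn ((g : ℤ) - s)
      (fun l => UnimodList R l ∧ ∀ x ∈ l, x ∈ {x | x ∈ M ∨ x - e ∈ M}) := by
  classical
  let Z : Set E := {x | x ∈ M ∨ x - e ∈ M}
  have hU : IsWordComplex (UnimodList R (E := E)) := unimodList_isWordComplex
  have hK : IsWordComplex (fun l : List E => UnimodList R l ∧ ∀ x ∈ l, x ∈ Z) :=
    ⟨fun l hl => hl.1.1, fun l l' hn hs hl =>
      ⟨hU.of_subset l l' hn hs hl.1, fun x hx => hl.2 x (hs hx)⟩⟩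
  have heZ : e ∈ Z := Or.inr (by rw [sub_self]; exact M.zero_mem)
  have hMZ : (M : Set E) ⊆ Z := fun x hx => Or.inl hx
  have heM : e ∉ M := fun h => zero_ne_one ((hεM e h).symm.trans he)
  have main := WordConn.of_cone_letter (d := (g : ℤ) - s) hK hMZ (y := e) heM heZ
    ⟨⟨List.nodup_nil, by simp⟩, by simp⟩ ?_ ?_
  · exact main.congr fun l _ _ => ⟨fun h => h.1, fun h => ⟨h, h.2⟩⟩
  · rintro l ⟨hl, -⟩ hlM
    refine ⟨?_, ?_⟩
    · refine ⟨List.nodup_cons.2 ⟨fun h => heM (hlM e h), hl.1⟩, fun x hx' => ?_⟩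
      rcases List.mem_cons.1 hx' with rfl | hx
      · refine ⟨ε, he, fun y hy hne => hεM y (hlM y ?_)⟩
        exact (List.mem_cons.1 hy).resolve_left hne
      · obtain ⟨φ, h1, h2⟩ := hl.2 x hx
        have hφ : ∀ y, (φ - φ e • ε) y = φ y - φ e * ε y := fun _ => rfl
        refine ⟨φ - φ e • ε, ?_, fun y hy hne => ?_⟩
        · rw [hφ, hεM x (hlM x hx), mul_zero, sub_zero, h1]
        · rw [hφ]
          rcases List.mem_cons.1 hy with rfl | hy
          · rw [he, mul_one, sub_self]
          · rw [hεM y (hlM y hy), mul_zero, sub_zero, h2 y hy hne]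
    · intro x hx
      rcases List.mem_cons.1 hx with rfl | hx
      exacts [heZ, hMZ (hlM x hx)]
  · rintro σ ⟨x, hxσ, hxM⟩ ⟨hσ, hσZ⟩
    have hεx : ε x = 1 := by
      have := hεM _ ((hσZ x hxσ).resolve_left hxM)
      rwa [map_sub, he, sub_eq_zero] at this
    have hp : σ.Perm (x :: σ.erase x) := List.perm_cons_erase hxσ
    have hv : UnimodList R ((σ.erase x).map (kerProj ε x hεx)) :=
      (unimodList_cons_iff ε x hεx _).1 (hσ.perm hp)
    have h1 := h (LinearMap.ker ε) (M.comap (Submodule.subtype _))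
      (fun i => ⟨b i, hεM _ (hbM i)⟩) (fun i => (β i).comp (Submodule.subtype _)) hbM
      (fun i j => hb i j) _ hv
    have h2 := WordConn.of_ker hεx hp (A := (M : Set E))
      (A' := (M.comap (LinearMap.ker ε).subtype : Set (LinearMap.ker ε))) (fun y => ⟨fun hy =>
        ⟨hεM y hy, hy⟩, fun ⟨_, hy⟩ => hy⟩) h1
    have e1 : (g : ℤ) - s - 1 - (((σ.erase x).map (kerProj ε x hεx)).length : ℤ) =
        (g : ℤ) - s - σ.length := by
      have := hp.length_eq
      rw [List.length_cons] at this
      rw [List.length_map, this]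
      push_cast
      ring
    rw [e1] at h2
    refine h2.congr fun l _ _ => ⟨fun hl => ⟨⟨hl.1, fun y hy => ?_⟩, hl.2⟩, fun hl =>
      ⟨hl.1.1, hl.2⟩⟩
    rcases List.mem_append.1 hy with hy | hy
    exacts [hMZ (hl.2 y hy), hσZ y hy]

theorem StableColumns.exists_unimodList_pair [Nontrivial R] {E : Type} [AddCommGroup E]
    [Module Rᵐᵒᵖ E] (h : StableColumns R g) (M : Submodule Rᵐᵒᵖ E) {b : Fin g → E}
    {β : Fin g → (E →ₗ[Rᵐᵒᵖ] R)} {e : E} {ε : E →ₗ[Rᵐᵒᵖ] R} (hbM : ∀ i, b i ∈ M)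
    (hb : IsDualPair b β) (he : ε e = 1) (hεM : ∀ m ∈ M, ε m = 0) {v : E}
    (hv : UnimodList R [v]) : ∃ x, x - e ∈ M ∧ UnimodList R [x, v] := by
  obtain ⟨φ, hφ, -⟩ := hv.2 v (by simp)
  obtain ⟨γ, hγ, c, hc⟩ := h.exists_dual hb hφ
  let χ : E →ₗ[Rᵐᵒᵖ] R := ∑ i, c i • γ i
  have hχ : ∀ x, χ x = ∑ i, c i * γ i x := fun x => by simp [χ, LinearMap.sum_apply]
  have hsM : ∑ i, op (γ i e) • b i ∈ M := M.sum_mem fun i _ => M.smul_mem _ (hbM i)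
  let x := e - ∑ i, op (γ i e) • b i
  have hγx : ∀ i, γ i x = 0 := fun i => by
    simp [x, hγ i]
  have hχx : χ x = 0 := by simp [hχ, hγx]
  have hχv : χ v = 1 := by rw [hχ, hc]
  have hεx : ε x = 1 := by rw [map_sub, hεM _ hsM, sub_zero, he]
  have hxv : x ≠ v := by
    intro h
    rw [h, hχv] at hχx
    exact one_ne_zero hχx
  refine ⟨x, ?_, by simpa using hxv, fun y hy => ?_⟩
  · have : x - e = - ∑ i, op (γ i e) • b i := by simp [x]
    rw [this]
    exact M.neg_mem hsM
  · rcases List.mem_pair.1 hy with rfl | rfl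
    · refine ⟨ε - ε v • χ, ?_, fun y hy hne => ?_⟩
      · simp [hχx, hεx]
      · obtain rfl := (List.mem_pair.1 hy).resolve_left hne
        simp [hχv]
    · refine ⟨χ, hχv, fun y hy hne => ?_⟩
      obtain rfl := (List.mem_pair.1 hy).resolve_right hne
      exact hχx

theorem SetConn.of_nonempty {Y : Type*} [TopologicalSpace Y] {S : Set Y} (h : S.Nonempty) :
    SetConn (-1) S := by
  intro k hk f _ _
  obtain rfl : k = 0 := by omega
  obtain ⟨y, hy⟩ := h
  refine ⟨fun _ => y, continuousOn_const, fun _ _ => hy, fun x hx => ?_⟩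
  rw [mem_sphere_zero_iff_norm, Subsingleton.elim x 0, norm_zero] at hx
  exact absurd hx zero_ne_one

theorem ShiftedLinksConn.of_stableColumns [Nontrivial R] (hs : StableColumns R s)
    (hQ : SubmoduleLinksConn R s g) (hP : ∀ k, g = k + 1 → ShiftedLinksConn R s k) :
    ShiftedLinksConn R s g := by
  intro E _ _ M b β e ε hbM hb he hεM v hv
  have hU : IsWordComplex (UnimodList R (E := E)) := unimodList_isWordComplex
  cases v with
  | nil => simpa using hQ.shifted_nil E M b β e ε hbM hb he hεM
  | cons v τ =>
    rw [List.length_cons]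
    rcases lt_trichotomy g s with hlt | rfl | hgt
    · exact SetConn.of_le (by push_cast; omega)
    · cases τ with
      | cons _ _ => exact SetConn.of_le (by rw [List.length_cons]; push_cast; omega)
      | nil =>
        obtain ⟨x, hx, hxv⟩ := hs.exists_unimodList_pair M hbM hb he hεM hv
        have e1 : (g : ℤ) - g - (([] : List E).length + 1 : ℕ) = -1 := by simp
        rw [e1]
        exact SetConn.of_nonempty ⟨⟨[x], by simp, by simp⟩, hxv, by simpa using Or.inr hx⟩
    · obtain ⟨k, rfl⟩ : ∃ k, g = k + 1 := ⟨g - 1, by omega⟩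
      have hk : StableColumns R k := hs.mono (by omega)
      obtain ⟨φ, hφ, -⟩ := hv.2 v (by simp)
      obtain ⟨χ, hχv, ⟨m, hmM, hm⟩, b', β', hbM', hχb, hb'⟩ :=
        hk.exists_splitting M hbM hb hφ e
      let M' : Submodule Rᵐᵒᵖ (LinearMap.ker χ) := M.comap (Submodule.subtype _)
      have hlinks : ∀ σ, UnimodList R (σ ++ v :: τ) →
          WordConn (((k + 1 : ℕ) : ℤ) - s - (τ.length + 1 : ℕ) - σ.length)
            (fun l => UnimodList R (l ++ σ ++ v :: τ) ∧
              ∀ x ∈ l, x ∈ M ⊓ LinearMap.ker χ ∨ x - (e - m) ∈ M ⊓ LinearMap.ker χ) := by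
        intro σ hσ
        have hp : (σ ++ v :: τ).Perm (v :: (σ ++ τ)) := List.perm_middle
        have h1 := hP k rfl (LinearMap.ker χ) M' (fun i => ⟨b' i, hχb i⟩)
          (fun i => (β' i).comp (Submodule.subtype _)) ⟨e - m, hm⟩ (ε.comp (Submodule.subtype _))
          hbM' (fun i j => hb' i j) (by
            change ε (e - m) = 1
            rw [map_sub, he, hεM m hmM, sub_zero]) (fun x hx => hεM _ hx) _
          ((unimodList_cons_iff χ v hχv _).1 (hσ.perm hp))
        have h2 := WordConn.of_ker hχv hp
          (A := {x | x ∈ M ⊓ LinearMap.ker χ ∨ x - (e - m) ∈ M ⊓ LinearMap.ker χ})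
          (fun x => by
            constructor
            · rintro (hx | hx)
              · exact ⟨hx.2, Or.inl hx.1⟩
              · have hx2 : x ∈ LinearMap.ker χ := by
                  have := (LinearMap.ker χ).add_mem hx.2 hm
                  rwa [sub_add_cancel] at this
                exact ⟨hx2, Or.inr hx.1⟩
            · rintro ⟨hx, hx' | hx'⟩
              · exact Or.inl ⟨hx', hx⟩
              · exact Or.inr ⟨hx', (LinearMap.ker χ).sub_mem hx hm⟩) h1
        have e1 : (k : ℤ) - s - (((σ ++ τ).map (kerProj χ v hχv)).length : ℤ) =
            ((k + 1 : ℕ) : ℤ) - s - (τ.length + 1 : ℕ) - σ.length := by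
          rw [List.length_map, List.length_append]
          push_cast
          ring
        rw [e1] at h2
        simpa using h2
      have h3 := WordConn.links_mono (hU.link (v :: τ)) (X := {x | x ∈ M ⊓ LinearMap.ker χ ∨
          x - (e - m) ∈ M ⊓ LinearMap.ker χ}) (Z := {x | x ∈ M ∨ x - e ∈ M}) (by
          rintro x (hx | hx)
          · exact Or.inl hx.1
          · refine Or.inr ?_
            have := M.sub_mem hx.1 hmM
            rwa [show x - (e - m) - m = x - e by abel] at this) hlinks [] (by simpa using hv)
      simpa using h3

theorem shiftedLinksConn_of_stableColumns [Nontrivial R] (hs : StableColumns R s) (g : ℕ) :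
    ShiftedLinksConn R s g := by
  induction g with
  | zero =>
    refine ShiftedLinksConn.of_stableColumns hs ?_ fun k hk => by omega
    intro E _ _ M b β _ _ v _
    have := hs.pos
    exact SetConn.of_le (by push_cast; omega)
  | succ g ih =>
    refine ShiftedLinksConn.of_stableColumns hs ih.submoduleLinksConn_succ fun k hk => ?_
    obtain rfl : g = k := by omega
    exact ih

end Induction

theorem setDConnected_of_setConn {V : Type} [Nonempty V] {F : Set (OSeq V)} {d : ℤ}
    (h : SetConn d F) : SetDConnected F d := by
  classical
  rcases le_or_gt d (-2) with hd | hd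
  · exact Or.inl hd
  · obtain ⟨w₀, hw₀⟩ := h.nonempty (by omega) ⟨[Classical.arbitrary V], by simp, by simp⟩
    let _ : TopologicalSpace F := Topology.lowerSet F
    have : Topology.IsLowerSet F := ⟨rfl⟩
    have : Nonempty F := ⟨⟨w₀, hw₀⟩⟩
    have : Nonempty (OSeq V) := ⟨w₀⟩
    refine Or.inr (topDConnected_of_setConn (SetConn.image h
      (fun w => if hw : w ∈ F then (⟨w, hw⟩ : F) else ⟨w₀, hw₀⟩) (Set.mapsTo_univ _ _) ?_ ?_))
    · rintro ⟨w, hw⟩ -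
      exact ⟨w, hw, dif_pos hw⟩
    · intro a ha b hb
      simp only [dif_pos ha, dif_pos hb]
      rfl

theorem mem_unimodSeqs_iff {R : Type*} [Ring R] {W : Type*} [AddCommGroup W] [Module Rᵐᵒᵖ W]
    (w : OSeq W) : w ∈ UnimodSeqs R W ↔ UnimodList R w.1 := by
  constructor
  · rintro ⟨f, φ, hf, hφ⟩
    have hval : ∀ i j, φ j (w.1.get i) = if i = j then 1 else 0 := fun i j => by
      have := LinearMap.congr_fun (hφ i j) 1
      rw [LinearMap.comp_apply, hf] at this
      rw [this]
      split_ifs <;> simp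
    refine ⟨w.2.2, fun x hx => ?_⟩
    obtain ⟨i, rfl⟩ := List.get_of_mem hx
    refine ⟨φ i, by rw [hval, if_pos rfl], fun y hy hne => ?_⟩
    obtain ⟨j, rfl⟩ := List.get_of_mem hy
    rw [hval, if_neg]
    rintro rfl
    exact hne rfl
  · rintro ⟨hn, h⟩
    choose φ hφ using fun i : Fin w.1.length => h (w.1.get i) (List.get_mem _ _)
    refine ⟨fun i => rightSpan (w.1.get i), φ, fun i => by simp [rightSpan_apply], fun i j => ?_⟩
    have h1 : φ j (w.1.get i) = if i = j then 1 else 0 := by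
      split_ifs with hij
      · rw [hij, (hφ j).1]
      · exact (hφ j).2 _ (List.get_mem _ _) fun h => hij (List.nodup_iff_injective_get.1 hn h)
    ext
    rw [LinearMap.comp_apply, rightSpan_apply, functional_op_smul, h1]
    split_ifs <;> simp

/-- If `R` satisfies the stable range condition `(S_s)` and `R^g` is a
direct summand of `M`, then the poset `O(M ∪ (M + e_1)) ∩ U(M^∞)` is `(g − s)`-connected,
where `M ∪ (M + e_1)` consists of the elements of `M^∞` of the form `m` or `m + e_1`. -/
theorem unimodularComplex_shifted_connectivity (R : Type) [Ring R] (M : Type)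
    [AddCommGroup M] [Module Rᵐᵒᵖ M] (s g : ℕ) (hs : SatisfiesStableRange R s)
    (hg : ∃ (ι : (Fin g → R) →ₗ[Rᵐᵒᵖ] M) (π : M →ₗ[Rᵐᵒᵖ] (Fin g → R)),
      π.comp ι = LinearMap.id) :
    SetDConnected
      (SeqIn {p : MInf R M | p.2 = 0 ∨ p.2 = Finsupp.single 0 1} ∩
        UnimodSeqs R (MInf R M))
      ((g : ℤ) - s) := by
  refine setDConnected_of_setConn ?_
  rcases subsingleton_or_nontrivial R with hR | hR
  · have hsub : Subsingleton (MInf R M) := by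
      have : Subsingleton M := Module.subsingleton Rᵐᵒᵖ M
      infer_instance
    refine SetConn.of_cone _ ⟨[0], by simp, by simp⟩ ⟨?_, ?_⟩ id (fun _ h => h)
      (fun _ _ _ _ h => h) (fun _ _ => le_rfl) fun w _ => ?_
    · exact fun x _ => Or.inl (Subsingleton.elim _ _)
    · exact (mem_unimodSeqs_iff _).2 ⟨by simp, fun x _ =>
        ⟨0, Subsingleton.elim _ _, fun _ _ _ => Subsingleton.elim _ _⟩⟩
    · obtain ⟨x, l, hl⟩ := List.exists_cons_of_ne_nil w.2.1
      change [0].Sublist w.1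
      rw [hl, Subsingleton.elim x 0]
      simp
  · obtain ⟨ι, π, hπ⟩ := hg
    have h := shiftedLinksConn_of_stableColumns hs.stableColumns g (MInf R M)
      (LinearMap.ker (LinearMap.snd Rᵐᵒᵖ M (ℕ →₀ R))) (fun i => (ι (Pi.single i 1), 0))
      (fun i => ((LinearMap.proj i).comp π).comp (LinearMap.fst Rᵐᵒᵖ M (ℕ →₀ R)))
      (0, Finsupp.single 0 1) ((Finsupp.lapply 0).comp (LinearMap.snd Rᵐᵒᵖ M (ℕ →₀ R)))
      (fun i => rfl) (fun i j => ?_) (by simp) (fun m hm => ?_) [] ⟨List.nodup_nil, by simp⟩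
    · rw [List.length_nil, Nat.cast_zero, sub_zero] at h
      have e : SeqIn {p : MInf R M | p.2 = 0 ∨ p.2 = Finsupp.single 0 1} ∩
          UnimodSeqs R (MInf R M) = {w : OSeq (MInf R M) | UnimodList R (w.1 ++ []) ∧ ∀ x ∈ w.1,
            x ∈ {x : MInf R M | x ∈ LinearMap.ker (LinearMap.snd Rᵐᵒᵖ M (ℕ →₀ R)) ∨
              x - (0, Finsupp.single 0 1) ∈ LinearMap.ker (LinearMap.snd Rᵐᵒᵖ M (ℕ →₀ R))}} := by
        ext w
        rw [Set.mem_inter_iff, mem_unimodSeqs_iff, and_comm]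
        simp [SeqIn, sub_eq_zero]
      rw [e]
      exact h
    · have := LinearMap.congr_fun hπ (Pi.single j 1)
      rw [LinearMap.comp_apply] at this
      simp [this, Pi.single_apply]
    · rw [LinearMap.comp_apply, LinearMap.mem_ker.1 hm, map_zero]
end

section
/- Let M be a right R-module. If the poset O(M) ∩ U(M^∞) is path-connected (any two of its elements can be joined by a finite zig-zag of comparable elements), then for any two split injective R-module homomorphisms φ_0, φ_1 : R → M there is an R-module automorphism f of M with φ_1 = f ∘ φ_0. -/
open CategoryTheory MulOpposite

/-- A subposet is path-connected if any two of its elements can be joined by a finite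
zig-zag of comparable elements. -/
def ZigzagConnected {V : Type} (S : Set (OSeq V)) : Prop :=
  ∀ a b : S, Relation.ReflTransGen (fun x y : S => (x : OSeq V) ≤ y ∨ (y : OSeq V) ≤ x) a b

/-- Two vectors which are part of a unimodular pair are exchanged by an automorphism, namely
the reflection `x ↦ x + (f₂ - f₁) ((ψ₁ - ψ₂) x)`. -/
lemma exists_linearEquiv_swap {S A M : Type*} [Ring S] [AddCommGroup A] [AddCommGroup M]
    [Module S A] [Module S M] {f₁ f₂ : A →ₗ[S] M} {ψ₁ ψ₂ : M →ₗ[S] A}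
    (h₁₁ : ∀ a, ψ₁ (f₁ a) = a) (h₁₂ : ∀ a, ψ₁ (f₂ a) = 0)
    (h₂₁ : ∀ a, ψ₂ (f₁ a) = 0) (h₂₂ : ∀ a, ψ₂ (f₂ a) = a) :
    ∃ e : M ≃ₗ[S] M, ∀ a, e (f₁ a) = f₂ a := by
  have inv : Function.Involutive (LinearMap.id + (f₂ - f₁).comp (ψ₁ - ψ₂) : M →ₗ[S] M) := by
    intro x
    simp only [LinearMap.add_apply, LinearMap.id_apply, LinearMap.comp_apply,
      LinearMap.sub_apply, map_add, map_sub, h₁₁, h₁₂, h₂₁, h₂₂, map_zero]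
    abel
  refine ⟨LinearEquiv.ofInvolutive _ inv, fun a => ?_⟩
  simp [h₁₁, h₂₁]

/-- Any two entries of a unimodular sequence in `M ⊕ N` with entries in `M` lie in the same orbit of the
automorphism group of `M`. -/
lemma exists_linearEquiv_of_mem_unimodular {R : Type*} [Ring R] {M N : Type*} [AddCommGroup M]
    [Module Rᵐᵒᵖ M] [AddCommGroup N] [Module Rᵐᵒᵖ N] {l : List (M × N)}
    (hl : ∀ p ∈ l, p.2 = 0)
    (hu : IsUnimodularSeq R (M × N) (fun i : Fin l.length => l.get i))
    {x y : M × N} (hx : x ∈ l) (hy : y ∈ l) :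
    ∃ e : M ≃ₗ[Rᵐᵒᵖ] M, e x.1 = y.1 := by
  obtain ⟨i, rfl⟩ := List.mem_iff_get.1 hx
  obtain ⟨j, rfl⟩ := List.mem_iff_get.1 hy
  obtain rfl | hij := eq_or_ne i j
  · exact ⟨LinearEquiv.refl _ _, rfl⟩
  obtain ⟨f, φ, hf, hφ⟩ := hu
  have snd_zero : ∀ i r, (f i r).2 = 0 := fun i r => by
    have hr : r = op r • (1 : R) := by simp
    rw [hr, map_smul, hf, Prod.smul_snd, hl _ (List.get_mem l i), smul_zero]
  have dual : ∀ i j r, φ j ((f i r).1, 0) =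
      (if i = j then LinearMap.id else 0 : R →ₗ[Rᵐᵒᵖ] R) r := fun i j r => by
    rw [← hφ i j, LinearMap.comp_apply, ← snd_zero i r]
  obtain ⟨e, he⟩ := exists_linearEquiv_swap
    (f₁ := (LinearMap.fst Rᵐᵒᵖ M N).comp (f i)) (f₂ := (LinearMap.fst Rᵐᵒᵖ M N).comp (f j))
    (ψ₁ := (φ i).comp (LinearMap.inl Rᵐᵒᵖ M N)) (ψ₂ := (φ j).comp (LinearMap.inl Rᵐᵒᵖ M N))
    (fun a => by simp [dual]) (fun a => by simp [dual, hij.symm])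
    (fun a => by simp [dual, hij]) (fun a => by simp [dual])
  exact ⟨e, by simpa [hf] using he 1⟩

/-- A split injection `R → M` gives a one-term unimodular sequence in `M ⊕ N`. -/
lemma isUnimodularSeq_singleton_inl {R : Type*} [Ring R] {M N : Type*} [AddCommGroup M]
    [Module Rᵐᵒᵖ M] [AddCommGroup N] [Module Rᵐᵒᵖ N] {φ : R →ₗ[Rᵐᵒᵖ] M}
    (h : ∃ ψ : M →ₗ[Rᵐᵒᵖ] R, ψ.comp φ = LinearMap.id) :
    IsUnimodularSeq R (M × N)
      (fun i : Fin [(φ 1, (0 : N))].length => [(φ 1, (0 : N))].get i) := by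
  obtain ⟨ψ, hψ⟩ := h
  refine ⟨fun _ => (LinearMap.inl Rᵐᵒᵖ M N).comp φ, fun _ => ψ.comp (LinearMap.fst Rᵐᵒᵖ M N),
    fun i => ?_, fun i j => ?_⟩
  · simp
  · have hij : i = j := Fin.ext (by have := i.2; have := j.2; simp at *)
    rw [if_pos hij, ← hψ]
    rfl

/-- (Transitivity) If the poset `O(M) ∩ U(M^∞)` is path-connected, then for
any split injective module homomorphisms `φ₀, φ₁ : R → M` there is an automorphism `f` of
`M` with `φ₁ = f ∘ φ₀`. -/
theorem gl_transitivity (R : Type) [Ring R] (M : Type) [AddCommGroup M] [Module Rᵐᵒᵖ M]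
    (hconn : ZigzagConnected
      (SeqIn {p : MInf R M | p.2 = 0} ∩ UnimodSeqs R (MInf R M)))
    (φ₀ φ₁ : R →ₗ[Rᵐᵒᵖ] M)
    (h₀ : ∃ ψ : M →ₗ[Rᵐᵒᵖ] R, ψ.comp φ₀ = LinearMap.id)
    (h₁ : ∃ ψ : M →ₗ[Rᵐᵒᵖ] R, ψ.comp φ₁ = LinearMap.id) :
    ∃ f : M ≃ₗ[Rᵐᵒᵖ] M, (f : M →ₗ[Rᵐᵒᵖ] M).comp φ₀ = φ₁ := by
  obtain ⟨e, he⟩ : ∃ e : M ≃ₗ[Rᵐᵒᵖ] M, e (φ₀ 1) = φ₁ 1 := by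
    let vertex (φ : R →ₗ[Rᵐᵒᵖ] M) (h : ∃ ψ : M →ₗ[Rᵐᵒᵖ] R, ψ.comp φ = LinearMap.id) :
        ↥(SeqIn {p : MInf R M | p.2 = 0} ∩ UnimodSeqs R (MInf R M)) :=
      ⟨⟨[(φ 1, 0)], by simp, by simp⟩, fun p hp => by
        rw [List.mem_singleton.1 hp]; rfl, isUnimodularSeq_singleton_inl h⟩
    have orbit : ∀ b : ↥(SeqIn {p : MInf R M | p.2 = 0} ∩ UnimodSeqs R (MInf R M)),
        ∀ y ∈ b.1.1, ∃ e : M ≃ₗ[Rᵐᵒᵖ] M, e (φ₀ 1) = y.1 := by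
      intro b
      induction hconn (vertex φ₀ h₀) b with
      | refl =>
        intro y hy
        rw [List.mem_singleton.1 hy]
        exact ⟨LinearEquiv.refl _ _, rfl⟩
      | @tail b c _ hbc ih =>
        intro y hy
        obtain ⟨z, hzb, hzc⟩ : ∃ z, z ∈ b.1.1 ∧ z ∈ c.1.1 := by
          rcases hbc with hbc | hcb
          · obtain ⟨z, hz⟩ := List.exists_mem_of_ne_nil _ b.1.2.1
            exact ⟨z, hz, List.Sublist.subset hbc hz⟩
          · exact ⟨y, List.Sublist.subset hcb hy, hy⟩
        obtain ⟨e₁, he₁⟩ := ih z hzb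
        obtain ⟨e₂, he₂⟩ := exists_linearEquiv_of_mem_unimodular c.2.1 c.2.2 hzc hy
        exact ⟨e₁.trans e₂, by simp [he₁, he₂]⟩
    exact orbit (vertex φ₁ h₁) (φ₁ 1, 0) (List.mem_singleton.2 rfl)
  refine ⟨e, LinearMap.ext fun r => ?_⟩
  have hr : r = op r • (1 : R) := by simp
  rw [hr, map_smul, map_smul, LinearMap.comp_apply, LinearEquiv.coe_coe, he]
end

section
/- Let M and N be right R-modules with M ⊕ R ≅ N ⊕ R. If the poset O(M ⊕ R) ∩ U(M^∞) is path-connected (any two of its elements can be joined by a finite zig-zag of comparable elements), where M ⊕ R is regarded as the submodule M ⊕ R·e_1 of M^∞, then M ≅ N. -/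
open CategoryTheory MulOpposite

/-- An isomorphism `M ⊕ R ≅ N ⊕ R` preserving the last basis vector induces a one-sided inverse
pair between `M` and `N`. -/
theorem fst_symm_fst_of_map_inr {R M N : Type*} [Ring R] [AddCommGroup M] [Module Rᵐᵒᵖ M]
    [AddCommGroup N] [Module Rᵐᵒᵖ N] (e : (M × R) ≃ₗ[Rᵐᵒᵖ] (N × R))
    (he : e (0, 1) = (0, 1)) (m : M) : (e.symm ((e (m, 0)).1, 0)).1 = m := by
  have hr (r : R) : e (0, r) = (0, r) := by
    have h : (0, r) = op r • ((0, 1) : M × R) := by simp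
    rw [h, map_smul, he]
    simp
  have h : ((e (m, 0)).1, (0 : R)) = e (m, -(e (m, 0)).2) := by
    have h' : (m, -(e (m, 0)).2) = (m, (0 : R)) - (0, (e (m, 0)).2) := by simp
    rw [h', map_sub, hr]
    ext <;> simp
  rw [h, e.symm_apply_apply]

/-- Cancellation for an isomorphism `M ⊕ R ≅ N ⊕ R` preserving the last basis vector. -/
def fstEquivOfMapInr {R M N : Type*} [Ring R] [AddCommGroup M] [Module Rᵐᵒᵖ M]
    [AddCommGroup N] [Module Rᵐᵒᵖ N] (e : (M × R) ≃ₗ[Rᵐᵒᵖ] (N × R))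
    (he : e (0, 1) = (0, 1)) : M ≃ₗ[Rᵐᵒᵖ] N where
  toLinearMap := LinearMap.fst Rᵐᵒᵖ N R ∘ₗ e.toLinearMap ∘ₗ LinearMap.inl Rᵐᵒᵖ M R
  invFun n := (e.symm (n, 0)).1
  left_inv m := fst_symm_fst_of_map_inr e he m
  right_inv n := fst_symm_fst_of_map_inr e.symm (by rw [← he, e.symm_apply_apply]) n

/-- Two vectors which are part of a unimodular sequence are exchanged by an automorphism. -/
theorem exists_equiv_map_eq {R W : Type*} [Ring R] [AddCommGroup W] [Module Rᵐᵒᵖ W]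
    (f g : R →ₗ[Rᵐᵒᵖ] W) (φ ψ : W →ₗ[Rᵐᵒᵖ] R)
    (hφf : ∀ r, φ (f r) = r) (hφg : ∀ r, φ (g r) = 0)
    (hψf : ∀ r, ψ (f r) = 0) (hψg : ∀ r, ψ (g r) = r) :
    ∃ a : W ≃ₗ[Rᵐᵒᵖ] W, a (f 1) = g 1 := by
  have h : Function.Involutive (LinearMap.id + (g - f) ∘ₗ (φ - ψ) : W →ₗ[Rᵐᵒᵖ] W) := by
    intro x
    simp [hφf, hφg, hψf, hψg]
    abel
  exact ⟨LinearEquiv.ofInvolutive _ h, by simp [hφf, hψf]⟩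

section Stabilization

variable (R M : Type*) [Ring R] [AddCommGroup M] [Module Rᵐᵒᵖ M]

/-- The inclusion of `M ⊕ R` into `M ⊕ R^∞` as `M ⊕ R·e₁`. -/
noncomputable def stabIncl : (M × R) →ₗ[Rᵐᵒᵖ] (M × (ℕ →₀ R)) :=
  LinearMap.prodMap LinearMap.id (Finsupp.lsingle 0)

/-- The projection of `M ⊕ R^∞` onto `M ⊕ R`. -/
noncomputable def stabProj : (M × (ℕ →₀ R)) →ₗ[Rᵐᵒᵖ] (M × R) :=
  LinearMap.prodMap LinearMap.id (Finsupp.lapply 0)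

variable {R M}

@[simp]
theorem stabProj_stabIncl (x : M × R) : stabProj R M (stabIncl R M x) = x := by
  simp [stabProj, stabIncl]

theorem stabIncl_mem (x : M × R) (n : ℕ) (hn : n ≠ 0) : (stabIncl R M x).2 n = 0 := by
  simp [stabIncl, hn.symm]

theorem stabIncl_stabProj {p : M × (ℕ →₀ R)} (hp : ∀ n : ℕ, n ≠ 0 → p.2 n = 0) :
    stabIncl R M (stabProj R M p) = p := by
  refine Prod.ext rfl (Finsupp.ext fun n => ?_)
  rcases eq_or_ne n 0 with rfl | hn
  · simp [stabProj, stabIncl]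
  · rw [hp n hn, stabIncl_mem _ n hn]

/-- Two members of a unimodular sequence in `M ⊕ R ⊆ M ⊕ R^∞` are related by an automorphism
of `M ⊕ R`. -/
theorem exists_equiv_of_isUnimodularSeq {n : ℕ} {v : Fin n → M × (ℕ →₀ R)}
    (hv : IsUnimodularSeq R (M × (ℕ →₀ R)) v) (hmem : ∀ i, ∀ n : ℕ, n ≠ 0 → (v i).2 n = 0)
    (i j : Fin n) :
    ∃ a : (M × R) ≃ₗ[Rᵐᵒᵖ] (M × R), a (stabProj R M (v i)) = stabProj R M (v j) := by
  obtain ⟨f, φ, hf, hφ⟩ := hv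
  rcases eq_or_ne i j with rfl | hij
  · exact ⟨LinearEquiv.refl _ _, rfl⟩
  have hfr (i : Fin n) (r : R) : stabIncl R M (stabProj R M (f i r)) = f i r := by
    have h : r = op r • (1 : R) := by simp
    rw [h, map_smul, map_smul, map_smul, hf, stabIncl_stabProj (hmem i)]
  have hφr (i j : Fin n) (r : R) :
      φ j (f i r) = (if i = j then LinearMap.id else 0 : R →ₗ[Rᵐᵒᵖ] R) r := by
    rw [← hφ i j, LinearMap.comp_apply]
  obtain ⟨a, ha⟩ := exists_equiv_map_eq (stabProj R M ∘ₗ f i) (stabProj R M ∘ₗ f j)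
    (φ i ∘ₗ stabIncl R M) (φ j ∘ₗ stabIncl R M)
    (fun r => by simp [hfr, hφr]) (fun r => by simp [hfr, hφr, hij.symm])
    (fun r => by simp [hfr, hφr, hij]) (fun r => by simp [hfr, hφr])
  exact ⟨a, by simpa [hf] using ha⟩

end Stabilization

/-- The one-term unimodular sequence in `M ⊕ R ⊆ M^∞` given by the preimage of the last basis
vector under an isomorphism `M ⊕ R ≅ N ⊕ R`. -/
noncomputable def unimodSingleton {R M N : Type} [Ring R] [AddCommGroup M] [Module Rᵐᵒᵖ M]
    [AddCommGroup N] [Module Rᵐᵒᵖ N] (e : (M × R) ≃ₗ[Rᵐᵒᵖ] (N × R)) :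
    (SeqIn {p : MInf R M | ∀ n : ℕ, n ≠ 0 → p.2 n = 0} ∩ UnimodSeqs R (MInf R M) :
      Set (OSeq (MInf R M))) :=
  ⟨⟨[stabIncl R M (e.symm (0, 1))], by simp, by simp⟩, by
    constructor
    · intro x hx
      rw [List.mem_singleton.1 hx]
      exact stabIncl_mem _
    · refine ⟨fun _ => stabIncl R M ∘ₗ e.symm.toLinearMap ∘ₗ LinearMap.inr Rᵐᵒᵖ N R,
        fun _ => LinearMap.snd Rᵐᵒᵖ N R ∘ₗ e.toLinearMap ∘ₗ stabProj R M, ?_, ?_⟩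
      · intro i
        simp
      · intro i j
        have hij : i = j := Subsingleton.elim (α := Fin 1) i j
        rw [if_pos hij]
        ext
        simp⟩

/-- (Cancellation) Let `M` and `N` be right `R`-modules with
`M ⊕ R ≅ N ⊕ R`. If the poset `O(M ⊕ R) ∩ U(M^∞)` is path-connected, where `M ⊕ R` is
regarded as the submodule `M ⊕ R·e₁` of `M^∞`, then `M ≅ N`. -/
theorem gl_cancellation (R : Type) [Ring R] (M : Type) [AddCommGroup M] [Module Rᵐᵒᵖ M]
    (N : Type) [AddCommGroup N] [Module Rᵐᵒᵖ N]
    (hMN : Nonempty ((M × R) ≃ₗ[Rᵐᵒᵖ] (N × R)))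
    (hconn : ZigzagConnected
      (SeqIn {p : MInf R M | ∀ n : ℕ, n ≠ 0 → p.2 n = 0} ∩ UnimodSeqs R (MInf R M))) :
    Nonempty (M ≃ₗ[Rᵐᵒᵖ] N) := by
  obtain ⟨e⟩ := hMN
  have key : ∀ x ∈ (unimodSingleton e).1.1,
      ∃ a : (M × R) ≃ₗ[Rᵐᵒᵖ] (M × R), a (0, 1) = stabProj R M x := by
    have hpath := hconn (unimodSingleton (LinearEquiv.refl Rᵐᵒᵖ (M × R))) (unimodSingleton e)
    generalize unimodSingleton e = s at hpath ⊢
    induction hpath with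
    | refl =>
      intro x hx
      refine ⟨LinearEquiv.refl _ _, ?_⟩
      rw [List.mem_singleton.1 hx]
      simp
    | @tail b c _ hbc ih =>
      rcases hbc with hle | hle
      · intro x hx
        obtain ⟨y, hy⟩ := List.exists_mem_of_ne_nil _ b.1.2.1
        obtain ⟨a, ha⟩ := ih y hy
        obtain ⟨i, hi⟩ := List.mem_iff_get.1 (List.Sublist.subset hle hy)
        obtain ⟨j, hj⟩ := List.mem_iff_get.1 hx
        obtain ⟨a', ha'⟩ := exists_equiv_of_isUnimodularSeq c.2.2
          (fun k => c.2.1 _ (List.get_mem _ k)) i j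
        refine ⟨a.trans a', ?_⟩
        rw [LinearEquiv.trans_apply, ha, ← hi, ha', hj]
      · exact fun x hx => ih x (List.Sublist.subset hle hx)
  obtain ⟨a, ha⟩ := key _ (List.mem_singleton.2 rfl)
  refine ⟨fstEquivOfMapInr (a.trans e) ?_⟩
  rw [LinearEquiv.trans_apply, ha, stabProj_stabIncl, e.apply_symm_apply]
end
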